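/- arXiv:1511.00026 — 3 statements merged into one kernel-verified Lean document; each statement's English description precedes it below -/
import Mathlib

section
/- Let ℝ_+=(0,∞) and let a=(a_ij) be a continuous map from [0,T]×ℝ_+^d into the symmetric positive definite d×d matrices with each a_ij bounded and locally Hölder continuous on [0,T)×ℝ_+^d. Let f∈C(ℝ_+^d) satisfy |f(x)| ≤ c(1+|x|^p) for some c,p>0. Then the unique polynomial-growth solution v of (TVP^+) — v∈C^{1,2}([0,T)×ℝ_+^d)∩C([0,T]×ℝ_+^d), ∂v/∂t + ℒ^+v = 0, v(T,·)=f — satisfies |v(t,x)| ≤ c̃(1+|x|^p) for all (t,x)∈[0,T]×ℝ_+^d, for some constant c̃ and with the same exponent p. -/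
open Finset Filter Topology Set

noncomputable section

/-- The successor `s'` of `s` in the partition `P` of `[0,T]` (equal to `T` if there is none). -/
def succOf (T : ℝ) (P : Finset ℝ) (s : ℝ) : ℝ :=
  if h : (P.filter (fun u => s < u)).Nonempty then (P.filter (fun u => s < u)).min' h else T

/-- A refining sequence of partitions of `[0,T]` whose meshes tend to zero. -/
structure PartitionSeq (T : ℝ) where
  part : ℕ → Finset ℝ
  subset_Icc : ∀ n, ↑(part n) ⊆ Set.Icc (0 : ℝ) T
  zero_mem : ∀ n, (0 : ℝ) ∈ part n
  top_mem : ∀ n, T ∈ part n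
  refining : ∀ n, part n ⊆ part (n + 1)
  mesh_to_zero : ∀ ε > 0, ∃ N, ∀ n ≥ N, ∀ s ∈ part n, succOf T (part n) s - s < ε
/-- Approximating sums for the covariation `⟨S_i,S_j⟩(t)` along the `n`-th partition. -/
def covSum (T : ℝ) (𝕋 : PartitionSeq T) {d : ℕ} (S : ℝ → Fin d → ℝ) (i j : Fin d)
    (t : ℝ) (n : ℕ) : ℝ :=
  ∑ s ∈ (𝕋.part n).filter (fun s => s ≤ t),
    (S (succOf T (𝕋.part n) s) i - S s i) * (S (succOf T (𝕋.part n) s) j - S s j)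

/-- The Föllmer integral `∫_r^t ξ(s)·dS(s)` exists along `(𝕋_n)` with value `I`. -/
def HasFollmerIntegral (T : ℝ) (𝕋 : PartitionSeq T) {d : ℕ} (ξ S : ℝ → Fin d → ℝ)
    (r t I : ℝ) : Prop :=
  Tendsto (fun n => ∑ s ∈ (𝕋.part n).filter (fun s => r ≤ s ∧ s ≤ t),
    ∑ k, ξ s k * (S (succOf T (𝕋.part n) s) k - S s k)) atTop (𝓝 I)

/-- The open positive orthant `ℝ_+^d`. -/
def posOrth (d : ℕ) : Set (Fin d → ℝ) := {x | ∀ i, 0 < x i}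

/-- The class `𝒮_a`: continuous trajectories whose covariations are `∫_0^t a_ij(s,S(s)) ds`. -/
def SclassA (T : ℝ) (𝕋 : PartitionSeq T) {d : ℕ}
    (a : ℝ → (Fin d → ℝ) → Fin d → Fin d → ℝ) : Set (ℝ → Fin d → ℝ) :=
  {S | ContinuousOn S (Set.Icc 0 T) ∧
    ∀ i j : Fin d, ∀ t ∈ Set.Icc (0 : ℝ) T,
      Tendsto (fun n => covSum T 𝕋 S i j t n) atTop (𝓝 (∫ s in (0 : ℝ)..t, a s (S s) i j))}

/-- The class `𝒮_a^+`: positive continuous trajectories whose covariations are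
`∫_0^t a_ij(s,S(s)) S_i(s) S_j(s) ds`. -/
def SclassAPos (T : ℝ) (𝕋 : PartitionSeq T) {d : ℕ}
    (a : ℝ → (Fin d → ℝ) → Fin d → Fin d → ℝ) : Set (ℝ → Fin d → ℝ) :=
  {S | ContinuousOn S (Set.Icc 0 T) ∧ (∀ t ∈ Set.Icc (0 : ℝ) T, ∀ i, 0 < S t i) ∧
    ∀ i j : Fin d, ∀ t ∈ Set.Icc (0 : ℝ) T,
      Tendsto (fun n => covSum T 𝕋 S i j t n) atTop
        (𝓝 (∫ s in (0 : ℝ)..t, a s (S s) i j * S s i * S s j))}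

/-- First partial derivative in the `i`-th space direction. -/
def pd1 {d : ℕ} (f : (Fin d → ℝ) → ℝ) (i : Fin d) (x : Fin d → ℝ) : ℝ :=
  fderiv ℝ f x (Pi.single i 1)

/-- Second partial derivative in the space directions `i, j`. -/
def pd2 {d : ℕ} (f : (Fin d → ℝ) → ℝ) (i j : Fin d) (x : Fin d → ℝ) : ℝ :=
  fderiv ℝ (fun y => pd1 f j y) x (Pi.single i 1)

/-- Time derivative (within the time interval `I`). -/
def tderiv {d : ℕ} (I : Set ℝ) (v : ℝ → (Fin d → ℝ) → ℝ) (t : ℝ) (x : Fin d → ℝ) : ℝ :=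
  derivWithin (fun τ => v τ x) I t

/-- `v` is of class `C^{1,2}(I × D)`: continuous on `I × D`, continuously differentiable in
`(t,x)` and twice continuously differentiable in `x` on `(int I) × D`, with all derivatives
admitting continuous extensions to `I × D`. -/
structure IsC12 {d : ℕ} (I : Set ℝ) (D : Set (Fin d → ℝ)) (v : ℝ → (Fin d → ℝ) → ℝ) : Prop where
  cont : ContinuousOn (fun p : ℝ × (Fin d → ℝ) => v p.1 p.2) (I ×ˢ D)
  diff : ∀ t ∈ interior I, ∀ x ∈ D,
    DifferentiableAt ℝ (fun p : ℝ × (Fin d → ℝ) => v p.1 p.2) (t, x)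
  diff2 : ∀ t ∈ interior I, ∀ x ∈ D, ∀ j : Fin d, DifferentiableAt ℝ (pd1 (v t) j) x
  derivs_extend : ∃ (gt : ℝ × (Fin d → ℝ) → ℝ) (gx : Fin d → ℝ × (Fin d → ℝ) → ℝ)
      (gxx : Fin d → Fin d → ℝ × (Fin d → ℝ) → ℝ),
    ContinuousOn gt (I ×ˢ D) ∧ (∀ i, ContinuousOn (gx i) (I ×ˢ D)) ∧
    (∀ i j, ContinuousOn (gxx i j) (I ×ˢ D)) ∧
    ∀ t ∈ interior I, ∀ x ∈ D,
      gt (t, x) = deriv (fun τ => v τ x) t ∧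
      (∀ i, gx i (t, x) = pd1 (v t) i x) ∧
      ∀ i j, gxx i j (t, x) = pd2 (v t) i j x

/-- Local Hölder continuity on a set. -/
def LocallyHolderOn {E : Type*} [PseudoMetricSpace E] (f : E → ℝ) (s : Set E) : Prop :=
  ∀ p ∈ s, ∃ U ∈ 𝓝[s] p, ∃ α C : ℝ, 0 < α ∧ α ≤ 1 ∧ 0 ≤ C ∧
    ∀ q ∈ U, ∀ q' ∈ U, |f q - f q'| ≤ C * dist q q' ^ α

theorem IsLocalMin.second_deriv_nonneg {g g' : ℝ → ℝ} {b x : ℝ} (hmin : IsLocalMin g x)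
    (hg : ∀ᶠ s in 𝓝 x, HasDerivAt g (g' s) s) (hg' : HasDerivAt g' b x) : 0 ≤ b := by
  have hev : deriv g =ᶠ[𝓝 x] g' := hg.mono fun s hs => hs.deriv
  have hdd : deriv (deriv g) x = b := by rw [hev.deriv_eq, hg'.deriv]
  by_contra! hb
  have hmax : IsLocalMax g x := by
    refine isLocalMax_of_deriv_deriv_neg (by rw [hdd]; exact hb) hmin.deriv_eq_zero ?_
    exact hg.self_of_nhds.continuousAt
  have hconst : g =ᶠ[𝓝 x] fun _ => g x := by
    filter_upwards [hmin, hmax] with s h1 h2 using le_antisymm h2 h1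
  have hd0 : deriv g =ᶠ[𝓝 x] fun _ => 0 := by
    simpa using hconst.deriv
  have : b = 0 := by rw [← hdd, hd0.deriv_eq, deriv_const]
  exact hb.ne this

theorem HasDerivAt.nonneg_of_eventually_ge_right {g : ℝ → ℝ} {b x : ℝ} (hg : HasDerivAt g b x)
    (hmin : ∀ᶠ s in 𝓝[>] x, g x ≤ g s) : 0 ≤ b := by
  have h := (hasDerivWithinAt_iff_tendsto_slope' (s := Ioi x) (by simp)).1 hg.hasDerivWithinAt
  refine ge_of_tendsto h ?_
  filter_upwards [hmin, self_mem_nhdsWithin] with s hs hxs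
  rw [slope_def_field]
  exact div_nonneg (sub_nonneg.2 hs) (sub_nonneg.2 (le_of_lt hxs))

open scoped MatrixOrder in
theorem sum_mul_nonneg_of_quadratic_nonneg {n : Type*} [Fintype n] [DecidableEq n]
    {A M : n → n → ℝ}
    (hsymm : ∀ i j, A i j = A j i)
    (hA : ∀ y : n → ℝ, y ≠ 0 → 0 < ∑ i, ∑ j, A i j * y i * y j)
    (hM : ∀ y : n → ℝ, 0 ≤ ∑ i, ∑ j, M i j * y i * y j) (x : n → ℝ) :
    0 ≤ ∑ i, ∑ j, A i j * x i * x j * M i j := by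
  have hpos : (Matrix.of A).PosSemidef := by
    refine .of_dotProduct_mulVec_nonneg (Matrix.IsHermitian.ext fun i j => by
      simpa using (hsymm j i)) fun y => ?_
    have : star y ⬝ᵥ ((Matrix.of A).mulVec y) = ∑ i, ∑ j, A i j * y i * y j := by
      simp only [dotProduct, Matrix.mulVec, Matrix.of_apply, Finset.mul_sum]
      refine Finset.sum_congr rfl fun i _ => Finset.sum_congr rfl fun j _ => ?_
      simp; ring
    rw [this]
    rcases eq_or_ne y 0 with rfl | hy
    · simp
    · exact (hA y hy).le
  obtain ⟨B, hB⟩ := CStarAlgebra.nonneg_iff_eq_star_mul_self.mp (Matrix.nonneg_iff_posSemidef.2 hpos)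
  have hAB : ∀ i j, A i j = ∑ k, B k i * B k j := fun i j => by
    have := congrFun (congrFun hB i) j
    simpa [Matrix.mul_apply] using this
  have : ∑ i, ∑ j, A i j * x i * x j * M i j
      = ∑ k, ∑ i, ∑ j, M i j * (B k i * x i) * (B k j * x j) := by
    symm
    rw [Finset.sum_comm]
    refine Finset.sum_congr rfl fun i _ => ?_
    rw [Finset.sum_comm]
    refine Finset.sum_congr rfl fun j _ => ?_
    rw [hAB, Finset.sum_mul, Finset.sum_mul, Finset.sum_mul]
    exact Finset.sum_congr rfl fun k _ => by ring
  rw [this]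
  exact Finset.sum_nonneg fun k _ => hM fun i => B k i * x i

theorem isOpen_posOrth (d : ℕ) : IsOpen (posOrth d) := by
  simp only [posOrth, Set.ofPred_forall]
  exact isOpen_iInter_of_finite fun i => isOpen_lt continuous_const (continuous_apply i)

/-- At a minimum point over the orthant of `E * (c₀ + ∑ φ (x i)) - u x`, the Hessian of this
function is nonnegative as a quadratic form. -/
theorem hessian_quadratic_nonneg_of_isMinOn {d : ℕ} {φ φ₁ φ₂ : ℝ → ℝ}
    (hφ : ∀ r, 0 < r → HasDerivAt φ (φ₁ r) r) (hφ₁ : ∀ r, 0 < r → HasDerivAt φ₁ (φ₂ r) r)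
    {u : (Fin d → ℝ) → ℝ} {G : (Fin d → ℝ) → (Fin d → ℝ) →L[ℝ] ℝ}
    {H : (Fin d → ℝ) →L[ℝ] (Fin d → ℝ) →L[ℝ] ℝ} {x : Fin d → ℝ} (hx : x ∈ posOrth d)
    (hG : ∀ z ∈ posOrth d, HasFDerivAt u (G z) z) (hH : HasFDerivAt G H x) (E c₀ : ℝ)
    (hmin : ∀ z ∈ posOrth d, E * (c₀ + ∑ i, φ (x i)) - u x ≤ E * (c₀ + ∑ i, φ (z i)) - u z)
    (y : Fin d → ℝ) :
    0 ≤ ∑ i, ∑ j, ((if i = j then E * φ₂ (x i) else 0)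
      - H (Pi.single i 1) (Pi.single j 1)) * y i * y j := by
  have hline : ∀ s : ℝ, HasDerivAt (fun s : ℝ => x + s • y) y s := fun s => by
    simpa using ((hasDerivAt_id s).smul_const y).const_add x
  have hcoord : ∀ (i : Fin d) (s : ℝ), HasDerivAt (fun s : ℝ => x i + s * y i) (y i) s :=
    fun i s => by simpa using ((hasDerivAt_id s).mul_const (y i)).const_add (x i)
  have hpos : ∀ᶠ s : ℝ in 𝓝 0, x + s • y ∈ posOrth d := by
    refine (hline 0).continuousAt.eventually_mem ?_
    exact (isOpen_posOrth d).mem_nhds (by simpa using hx)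
  have hg : ∀ᶠ s : ℝ in 𝓝 0,
      HasDerivAt (fun s : ℝ => E * (c₀ + ∑ i, φ (x i + s * y i)) - u (x + s • y))
        (E * (∑ i, φ₁ (x i + s * y i) * y i) - G (x + s • y) y) s := by
    filter_upwards [hpos] with s hs
    refine HasDerivAt.sub (HasDerivAt.const_mul E (HasDerivAt.const_add c₀
      (HasDerivAt.fun_sum fun i _ => ?_))) ((hG _ hs).comp_hasDerivAt s (hline s))
    exact (hφ _ (hs i)).comp s (hcoord i s)
  have hg' : HasDerivAt (fun s : ℝ => E * (∑ i, φ₁ (x i + s * y i) * y i) - G (x + s • y) y)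
      (E * (∑ i, φ₂ (x i) * y i * y i) - H y y) 0 := by
    refine HasDerivAt.sub (HasDerivAt.const_mul E
      (HasDerivAt.fun_sum fun i _ => HasDerivAt.mul_const ?_ _)) ?_
    · have h0 : HasDerivAt φ₁ (φ₂ (x i)) (x i + 0 * y i) := by simpa using hφ₁ _ (hx i)
      exact h0.comp (0 : ℝ) (hcoord i 0)
    · have h0 : HasFDerivAt G H (x + (0 : ℝ) • y) := by simpa using hH
      have h1 : HasDerivAt (fun s : ℝ => G (x + s • y)) (H y) 0 :=
        h0.comp_hasDerivAt (0 : ℝ) (hline 0)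
      have h2 := h1.clm_apply (hasDerivAt_const (0 : ℝ) y)
      rwa [map_zero, add_zero] at h2
  have hloc : IsLocalMin (fun s : ℝ => E * (c₀ + ∑ i, φ (x i + s * y i)) - u (x + s • y)) 0 := by
    filter_upwards [hpos] with s hs
    simpa using hmin _ hs
  have hnn := hloc.second_deriv_nonneg hg hg'
  have hHy : H y y = ∑ i, ∑ j, H (Pi.single i 1) (Pi.single j 1) * y i * y j := by
    have hy : y = ∑ i, y i • (Pi.single i (1 : ℝ) : Fin d → ℝ) := pi_eq_sum_univ' y
    conv_lhs => rw [hy]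
    simp only [map_sum, map_smul, _root_.sum_apply, smul_apply,
      smul_eq_mul, Finset.mul_sum]
    rw [Finset.sum_comm]
    exact Finset.sum_congr rfl fun i _ => Finset.sum_congr rfl fun j _ => by ring
  convert hnn using 1
  rw [hHy, Finset.mul_sum, ← Finset.sum_sub_distrib]
  refine Finset.sum_congr rfl fun i _ => ?_
  simp only [sub_mul, Finset.sum_sub_distrib, ite_mul, zero_mul, Finset.sum_ite_eq,
    Finset.mem_univ, if_true]
  ring

/-- The comparison principle against a separable supersolution `c₀ + ∑ φ (x i)` that dominates
`v` at time `T` and outside a compact box. -/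
theorem le_exp_mul_of_le_barrier {T : ℝ} {d : ℕ} {a : ℝ → (Fin d → ℝ) → Fin d → Fin d → ℝ}
    (ha_symm : ∀ t ∈ Set.Icc (0 : ℝ) T, ∀ x ∈ posOrth d, ∀ i j, a t x i j = a t x j i)
    (ha_pd : ∀ t ∈ Set.Icc (0 : ℝ) T, ∀ x ∈ posOrth d, ∀ y : Fin d → ℝ, y ≠ 0 →
      0 < ∑ i, ∑ j, a t x i j * y i * y j)
    {Cb : ℝ} (hCb : 0 ≤ Cb)
    (ha_bdd : ∀ t ∈ Set.Icc (0 : ℝ) T, ∀ x ∈ posOrth d, ∀ i j, |a t x i j| ≤ Cb)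
    {φ φ₁ φ₂ : ℝ → ℝ}
    (hφ : ∀ r, 0 < r → HasDerivAt φ (φ₁ r) r) (hφ₁ : ∀ r, 0 < r → HasDerivAt φ₁ (φ₂ r) r)
    {K₀ c₀ : ℝ} (hK₀ : 0 ≤ K₀) (hc₀ : 0 < c₀)
    (hφ₂ : ∀ r, 0 < r → |r ^ 2 * φ₂ r| ≤ K₀ * φ r) (hφ_nonneg : ∀ r, 0 < r → 0 ≤ φ r)
    {v vt : ℝ → (Fin d → ℝ) → ℝ} {G : ℝ → (Fin d → ℝ) → (Fin d → ℝ) →L[ℝ] ℝ}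
    {H : ℝ → (Fin d → ℝ) → (Fin d → ℝ) →L[ℝ] (Fin d → ℝ) →L[ℝ] ℝ}
    (hv_cont : ContinuousOn (fun q : ℝ × (Fin d → ℝ) => v q.1 q.2) (Set.Icc 0 T ×ˢ posOrth d))
    (hvt : ∀ t ∈ Set.Ioo 0 T, ∀ x ∈ posOrth d, HasDerivAt (fun s => v s x) (vt t x) t)
    (hG : ∀ t ∈ Set.Ioo 0 T, ∀ x ∈ posOrth d, HasFDerivAt (v t) (G t x) x)
    (hH : ∀ t ∈ Set.Ioo 0 T, ∀ x ∈ posOrth d, HasFDerivAt (G t) (H t x) x)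
    (hpde : ∀ t ∈ Set.Ioo 0 T, ∀ x ∈ posOrth d, vt t x
      + (1 / 2) * ∑ i, ∑ j, a t x i j * x i * x j * H t x (Pi.single i 1) (Pi.single j 1) = 0)
    {δ R : ℝ} (hδ : 0 < δ)
    (hterm : ∀ x ∈ posOrth d, v T x ≤ c₀ + ∑ i, φ (x i))
    (hbox : ∀ t ∈ Set.Icc 0 T, ∀ x ∈ posOrth d, (¬ ∀ i, x i ∈ Set.Icc δ R) →
      v t x ≤ c₀ + ∑ i, φ (x i))
    {t : ℝ} (ht : t ∈ Set.Ioc 0 T) {x : Fin d → ℝ} (hx : x ∈ posOrth d) :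
    v t x ≤ Real.exp ((Cb * K₀ + 1) * (T - t)) * (c₀ + ∑ i, φ (x i)) := by
  set K := Cb * K₀ + 1 with hK
  have hKpos : 0 < K := by positivity
  have hBpos : ∀ z ∈ posOrth d, 0 < c₀ + ∑ i, φ (z i) := fun z hz =>
    add_pos_of_pos_of_nonneg hc₀ (Finset.sum_nonneg fun i _ => hφ_nonneg _ (hz i))
  set w : ℝ × (Fin d → ℝ) → ℝ := fun q =>
    Real.exp (K * (T - q.1)) * (c₀ + ∑ i, φ (q.2 i)) - v q.1 q.2 with hw
  by_contra! hlt
  have hwneg : w (t, x) < 0 := sub_neg.2 hlt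
  have hout : ∀ s ∈ Set.Icc t T, ∀ z ∈ posOrth d, (¬ ∀ i, z i ∈ Set.Icc δ R) → 0 ≤ w (s, z) := by
    intro s hs z hz hzb
    have h1 := hbox s ⟨ht.1.le.trans hs.1, hs.2⟩ z hz hzb
    have h2 : 1 ≤ Real.exp (K * (T - s)) :=
      Real.one_le_exp (mul_nonneg hKpos.le (sub_nonneg.2 hs.2))
    have h3 := le_mul_of_one_le_left (hBpos z hz).le h2
    exact sub_nonneg.2 (h1.trans h3)
  have hbpos : ∀ z : Fin d → ℝ, (∀ i, z i ∈ Set.Icc δ R) → z ∈ posOrth d :=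
    fun z hz i => hδ.trans_le (hz i).1
  set S : Set (ℝ × (Fin d → ℝ)) := Set.Icc t T ×ˢ Set.pi Set.univ fun _ => Set.Icc δ R with hS
  have hScomp : IsCompact S := isCompact_Icc.prod (isCompact_univ_pi fun _ => isCompact_Icc)
  have hxbox : ∀ i, x i ∈ Set.Icc δ R := by
    by_contra hxb
    exact absurd (hout t ⟨le_rfl, ht.2⟩ x hx hxb) (not_le.2 hwneg)
  have hxS : (t, x) ∈ S := ⟨⟨le_rfl, ht.2⟩, fun i _ => hxbox i⟩
  have hSsub : S ⊆ Set.Icc 0 T ×ˢ posOrth d := fun q hq =>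
    ⟨⟨ht.1.le.trans hq.1.1, hq.1.2⟩, hbpos _ fun i => hq.2 i (Set.mem_univ i)⟩
  have hwcont : ContinuousOn w S := by
    refine ContinuousOn.sub (ContinuousOn.mul (by fun_prop) (continuousOn_const.add
      (continuousOn_finsetSum _ fun i _ => ?_))) (hv_cont.mono hSsub)
    intro q hq
    have h1 : ContinuousAt φ (q.2 i) := (hφ _ ((hSsub hq).2 i)).continuousAt
    exact (ContinuousAt.comp (f := fun q : ℝ × (Fin d → ℝ) => q.2 i) h1
      (by fun_prop)).continuousWithinAt
  obtain ⟨⟨t₀, x₀⟩, hqS, hqmin⟩ := hScomp.exists_isMinOn ⟨_, hxS⟩ hwcont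
  have hw₀ : w (t₀, x₀) < 0 := (hqmin hxS).trans_lt hwneg
  have hx₀ : x₀ ∈ posOrth d := (hSsub hqS).2
  have ht₀T : t₀ < T := by
    refine lt_of_le_of_ne hqS.1.2 fun h => absurd (hterm x₀ hx₀) (not_le.2 ?_)
    change t₀ = T at h
    subst h
    simpa [hw] using hw₀
  have ht₀ : t₀ ∈ Set.Ioo 0 T := ⟨ht.1.trans_le hqS.1.1, ht₀T⟩
  have ht₀' : t₀ ∈ Set.Icc 0 T := ⟨ht₀.1.le, ht₀.2.le⟩
  have hxmin : ∀ z ∈ posOrth d, w (t₀, x₀) ≤ w (t₀, z) := by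
    intro z hz
    by_cases hzb : ∀ i, z i ∈ Set.Icc δ R
    · exact hqmin (show (t₀, z) ∈ S from ⟨hqS.1, fun i _ => hzb i⟩)
    · exact hw₀.le.trans (hout t₀ hqS.1 z hz hzb)
  have htime : 0 ≤ -K * Real.exp (K * (T - t₀)) * (c₀ + ∑ i, φ (x₀ i)) - vt t₀ x₀ := by
    have hd : HasDerivAt (fun s => Real.exp (K * (T - s)) * (c₀ + ∑ i, φ (x₀ i)) - v s x₀)
        (-K * Real.exp (K * (T - t₀)) * (c₀ + ∑ i, φ (x₀ i)) - vt t₀ x₀) t₀ := by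
      refine HasDerivAt.sub (HasDerivAt.mul_const ?_ _) (hvt t₀ ht₀ x₀ hx₀)
      have hlin : HasDerivAt (fun s => K * (T - s)) (-K) t₀ := by
        simpa using ((hasDerivAt_id' t₀).const_sub T).const_mul K
      rw [mul_comm (-K)]
      exact hlin.exp
    refine hd.nonneg_of_eventually_ge_right ?_
    filter_upwards [Ioo_mem_nhdsGT ht₀T] with s hs
    exact hqmin (show (s, x₀) ∈ S from ⟨⟨hqS.1.1.trans hs.1.le, hs.2.le⟩, hqS.2⟩)
  set E := Real.exp (K * (T - t₀)) with hE
  have hEpos : 0 < E := Real.exp_pos _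
  have htrace := sum_mul_nonneg_of_quadratic_nonneg (ha_symm t₀ ht₀' x₀ hx₀)
    (ha_pd t₀ ht₀' x₀ hx₀)
    (hessian_quadratic_nonneg_of_isMinOn hφ hφ₁ hx₀ (hG t₀ ht₀) (hH t₀ ht₀ x₀ hx₀) E c₀ hxmin) x₀
  have hsplit : ∑ i, ∑ j, a t₀ x₀ i j * x₀ i * x₀ j * ((if i = j then E * φ₂ (x₀ i) else 0)
        - H t₀ x₀ (Pi.single i 1) (Pi.single j 1))
      = E * (∑ i, a t₀ x₀ i i * (x₀ i ^ 2 * φ₂ (x₀ i)))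
        - ∑ i, ∑ j, a t₀ x₀ i j * x₀ i * x₀ j * H t₀ x₀ (Pi.single i 1) (Pi.single j 1) := by
    rw [Finset.mul_sum, ← Finset.sum_sub_distrib]
    refine Finset.sum_congr rfl fun i _ => ?_
    simp only [mul_sub, Finset.sum_sub_distrib, mul_ite, mul_zero, Finset.sum_ite_eq,
      Finset.mem_univ, if_true]
    ring
  rw [hsplit] at htrace
  have hle : ∑ i, a t₀ x₀ i i * (x₀ i ^ 2 * φ₂ (x₀ i)) ≤ Cb * K₀ * ∑ i, φ (x₀ i) := by
    rw [Finset.mul_sum]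
    refine Finset.sum_le_sum fun i _ => ?_
    calc a t₀ x₀ i i * (x₀ i ^ 2 * φ₂ (x₀ i))
        ≤ |a t₀ x₀ i i| * |x₀ i ^ 2 * φ₂ (x₀ i)| := by rw [← abs_mul]; exact le_abs_self _
      _ ≤ Cb * (K₀ * φ (x₀ i)) := by
          gcongr
          · exact ha_bdd t₀ ht₀' x₀ hx₀ i i
          · exact hφ₂ _ (hx₀ i)
      _ = Cb * K₀ * φ (x₀ i) := by ring
  have hΦ : 0 ≤ ∑ i, φ (x₀ i) := Finset.sum_nonneg fun i _ => hφ_nonneg _ (hx₀ i)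
  have h1 := mul_le_mul_of_nonneg_left hle hEpos.le
  have h2 := hpde t₀ ht₀ x₀ hx₀
  have h3 : 0 < E * c₀ := by positivity
  have h4 : 0 ≤ E * (∑ i, φ (x₀ i)) := by positivity
  have h5 : 0 ≤ Cb * K₀ * (E * c₀) := by positivity
  have h6 : 0 ≤ Cb * K₀ * (E * ∑ i, φ (x₀ i)) := by positivity
  rw [hK] at htime
  nlinarith

theorem norm_rpow_le_sum_rpow {d : ℕ} {p : ℝ} (hp : 0 < p) {x : Fin d → ℝ}
    (hx : x ∈ posOrth d) : ‖x‖ ^ p ≤ ∑ i, x i ^ p := by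
  rcases isEmpty_or_nonempty (Fin d) with h | h
  · simp [Subsingleton.elim x 0, Real.zero_rpow hp.ne']
  · obtain ⟨i, hi⟩ := Finite.exists_max x
    have hn : ‖x‖ ≤ x i := (pi_norm_le_iff_of_nonneg (hx i).le).2 fun j => by
      rw [Real.norm_of_nonneg (hx j).le]
      exact hi j
    exact (Real.rpow_le_rpow (norm_nonneg _) hn hp.le).trans
      (Finset.single_le_sum (f := fun i => x i ^ p)
        (fun j _ => Real.rpow_nonneg (hx j).le p) (Finset.mem_univ i))

theorem sum_rpow_le_card_mul_norm_rpow {d : ℕ} {p : ℝ} (hp : 0 < p) {x : Fin d → ℝ}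
    (hx : x ∈ posOrth d) : ∑ i, x i ^ p ≤ d * ‖x‖ ^ p := by
  have h : ∀ i ∈ Finset.univ, x i ^ p ≤ ‖x‖ ^ p := fun i _ =>
    Real.rpow_le_rpow (hx i).le ((le_abs_self _).trans (norm_le_pi_norm x i)) hp.le
  simpa using Finset.sum_le_card_nsmul _ _ _ h

/-- A function of growth order `q` is dominated by `ε ∑ (x i ^ (q + 1) + (x i)⁻¹)` outside a
compact box contained in the open orthant. -/
theorem exists_box_growth_le {d : ℕ} {C q ε : ℝ} (hC : 0 < C) (hq : 0 < q) (hε : 0 < ε) :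
    ∃ δ R : ℝ, 0 < δ ∧ ∀ x ∈ posOrth d, (¬ ∀ i, x i ∈ Set.Icc δ R) →
      C * (1 + ‖x‖ ^ q) ≤ ε * ∑ i, (x i ^ (q + 1) + x i ^ (-1 : ℝ)) := by
  set R := max 1 (2 * C / ε) with hR
  have hR1 : 1 ≤ R := le_max_left _ _
  have hD : 0 < C * (1 + R ^ q) := by positivity
  refine ⟨ε / (C * (1 + R ^ q)), R, by positivity, fun x hx hxb => ?_⟩
  have hm : ∀ i, 0 ≤ x i ^ (q + 1) := fun i => Real.rpow_nonneg (hx i).le _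
  have hi : ∀ i, 0 ≤ x i ^ (-1 : ℝ) := fun i => Real.rpow_nonneg (hx i).le _
  rcases lt_or_ge R ‖x‖ with hxR | hxR
  · have hx1 : 1 ≤ ‖x‖ := hR1.trans hxR.le
    have h1 : 1 ≤ ‖x‖ ^ q := Real.one_le_rpow hx1 hq.le
    have h2 : 2 * C ≤ ‖x‖ * ε := (div_le_iff₀ hε).1 ((le_max_right _ _).trans hxR.le)
    have h3 : ‖x‖ ^ (q + 1) = ‖x‖ ^ q * ‖x‖ := by
      rw [Real.rpow_add (by linarith), Real.rpow_one]
    calc C * (1 + ‖x‖ ^ q) ≤ 2 * C * ‖x‖ ^ q := by nlinarith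
      _ ≤ ‖x‖ * ε * ‖x‖ ^ q := by gcongr
      _ = ε * ‖x‖ ^ (q + 1) := by rw [h3]; ring
      _ ≤ ε * ∑ i, x i ^ (q + 1) := by
          gcongr
          exact norm_rpow_le_sum_rpow (by linarith) hx
      _ ≤ ε * ∑ i, (x i ^ (q + 1) + x i ^ (-1 : ℝ)) := by
          gcongr with i
          exact le_add_of_nonneg_right (hi i)
  · push Not at hxb
    obtain ⟨i, hib⟩ := hxb
    have hxi : x i < ε / (C * (1 + R ^ q)) := by
      by_contra! hcon
      exact hib ⟨hcon, ((le_abs_self _).trans (norm_le_pi_norm x i)).trans hxR⟩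
    calc C * (1 + ‖x‖ ^ q) ≤ C * (1 + R ^ q) := by gcongr
      _ ≤ ε * x i ^ (-1 : ℝ) := by
          rw [Real.rpow_neg_one, ← div_eq_mul_inv, le_div_iff₀ (hx i), mul_comm]
          exact ((lt_div_iff₀ hD).1 hxi).le
      _ ≤ ε * (x i ^ (q + 1) + x i ^ (-1 : ℝ)) := by
          gcongr
          exact le_add_of_nonneg_left (hm i)
      _ ≤ ε * ∑ i, (x i ^ (q + 1) + x i ^ (-1 : ℝ)) := by
          gcongr
          exact Finset.single_le_sum (f := fun i => x i ^ (q + 1) + x i ^ (-1 : ℝ))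
            (fun j _ => add_nonneg (hm j) (hi j)) (Finset.mem_univ i)

theorem abs_sq_mul_rpow_second_deriv_le {r p : ℝ} (hr : 0 < r) :
    |r ^ 2 * (p * ((p - 1) * r ^ (p - 1 - 1)))| ≤ (p ^ 2 + |p|) * r ^ p := by
  have h : r ^ 2 * (p * ((p - 1) * r ^ (p - 1 - 1))) = p * (p - 1) * r ^ p := by
    have : r ^ p = r ^ (p - 1 - 1) * r ^ 2 := by
      rw [← Real.rpow_natCast r 2, ← Real.rpow_add hr]
      congr 1
      push_cast
      ring
    rw [this]; ring
  rw [h, abs_mul, abs_of_pos (Real.rpow_pos_of_pos hr p)]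
  gcongr
  rw [abs_le]
  constructor <;> nlinarith [le_abs_self p, neg_abs_le p, sq_nonneg p]

/-- One-sided growth estimate for solutions of polynomial growth. -/
theorem le_exp_mul_sum_rpow {T : ℝ} {d : ℕ} {a : ℝ → (Fin d → ℝ) → Fin d → Fin d → ℝ}
    (ha_symm : ∀ t ∈ Set.Icc (0 : ℝ) T, ∀ x ∈ posOrth d, ∀ i j, a t x i j = a t x j i)
    (ha_pd : ∀ t ∈ Set.Icc (0 : ℝ) T, ∀ x ∈ posOrth d, ∀ y : Fin d → ℝ, y ≠ 0 →
      0 < ∑ i, ∑ j, a t x i j * y i * y j)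
    {Cb : ℝ} (hCb : 0 ≤ Cb)
    (ha_bdd : ∀ t ∈ Set.Icc (0 : ℝ) T, ∀ x ∈ posOrth d, ∀ i j, |a t x i j| ≤ Cb)
    {c p C q : ℝ} (hc : 0 < c) (hp : 0 < p) (hC : 0 < C) (hq : 0 < q)
    {v vt : ℝ → (Fin d → ℝ) → ℝ} {G : ℝ → (Fin d → ℝ) → (Fin d → ℝ) →L[ℝ] ℝ}
    {H : ℝ → (Fin d → ℝ) → (Fin d → ℝ) →L[ℝ] (Fin d → ℝ) →L[ℝ] ℝ}
    (hv_cont : ContinuousOn (fun q : ℝ × (Fin d → ℝ) => v q.1 q.2) (Set.Icc 0 T ×ˢ posOrth d))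
    (hvt : ∀ t ∈ Set.Ioo 0 T, ∀ x ∈ posOrth d, HasDerivAt (fun s => v s x) (vt t x) t)
    (hG : ∀ t ∈ Set.Ioo 0 T, ∀ x ∈ posOrth d, HasFDerivAt (v t) (G t x) x)
    (hH : ∀ t ∈ Set.Ioo 0 T, ∀ x ∈ posOrth d, HasFDerivAt (G t) (H t x) x)
    (hpde : ∀ t ∈ Set.Ioo 0 T, ∀ x ∈ posOrth d, vt t x
      + (1 / 2) * ∑ i, ∑ j, a t x i j * x i * x j * H t x (Pi.single i 1) (Pi.single j 1) = 0)
    (hterm : ∀ x ∈ posOrth d, v T x ≤ c * (1 + ‖x‖ ^ p))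
    (hgrowth : ∀ t ∈ Set.Icc 0 T, ∀ x ∈ posOrth d, v t x ≤ C * (1 + ‖x‖ ^ q)) :
    ∃ K, ∀ t ∈ Set.Ioc 0 T, ∀ x ∈ posOrth d,
      v t x ≤ Real.exp (K * (T - t)) * (c + c * ∑ i, x i ^ p) := by
  set K₀ := (p ^ 2 + |p|) + ((q + 1) ^ 2 + |q + 1|) + ((-1) ^ 2 + |(-1 : ℝ)|) with hK₀
  refine ⟨Cb * K₀ + 1, fun t ht x hx => ?_⟩
  have hε : ∀ ε > 0, v t x ≤ Real.exp ((Cb * K₀ + 1) * (T - t)) *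
      (c + (c * ∑ i, x i ^ p + ε * ∑ i, (x i ^ (q + 1) + x i ^ (-1 : ℝ)))) := by
    intro ε hε
    obtain ⟨δ, R, hδ, hbox⟩ := exists_box_growth_le (d := d) hC hq hε
    have hd : ∀ s r : ℝ, 0 < r → HasDerivAt (fun r : ℝ => r ^ s) (s * r ^ (s - 1)) r :=
      fun s r hr => Real.hasDerivAt_rpow_const (Or.inl hr.ne')
    have hsum : ∀ x : Fin d → ℝ, c * ∑ i, x i ^ p + ε * ∑ i, (x i ^ (q + 1) + x i ^ (-1 : ℝ))
        = ∑ i, (c * x i ^ p + ε * (x i ^ (q + 1) + x i ^ (-1 : ℝ))) := fun x => by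
      rw [Finset.mul_sum, Finset.mul_sum, ← Finset.sum_add_distrib]
    have hnn : ∀ x ∈ posOrth d, ∀ s : ℝ, ∀ i, 0 ≤ x i ^ s :=
      fun x hx s i => Real.rpow_nonneg (hx i).le s
    have hsumE : ∀ x ∈ posOrth d, 0 ≤ ε * ∑ i, (x i ^ (q + 1) + x i ^ (-1 : ℝ)) :=
      fun x hx => mul_nonneg hε.le (Finset.sum_nonneg fun i _ =>
        add_nonneg (hnn x hx _ i) (hnn x hx _ i))
    rw [hsum]
    refine le_exp_mul_of_le_barrier (φ := fun r => c * r ^ p + ε * (r ^ (q + 1) + r ^ (-1 : ℝ)))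
      ha_symm ha_pd hCb ha_bdd
      (fun r hr => ((hd p r hr).const_mul c).add
        (((hd (q + 1) r hr).add (hd (-1) r hr)).const_mul ε))
      (fun r hr => (((hd (p - 1) r hr).const_mul p).const_mul c).add
        ((((hd (q + 1 - 1) r hr).const_mul (q + 1)).add
          ((hd (-1 - 1) r hr).const_mul (-1))).const_mul ε))
      (K₀ := K₀) (by positivity) hc ?_ ?_ hv_cont hvt hG hH hpde hδ (R := R) ?_ ?_ ht hx
    · intro r hr
      have h1 := abs_sq_mul_rpow_second_deriv_le (p := p) hr
      have h2 := abs_sq_mul_rpow_second_deriv_le (p := q + 1) hr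
      have h3 := abs_sq_mul_rpow_second_deriv_le (p := -1) hr
      have g1 := Real.rpow_nonneg hr.le p
      have g2 := Real.rpow_nonneg hr.le (q + 1)
      have g3 := Real.rpow_nonneg hr.le (-1)
      have k1 : p ^ 2 + |p| ≤ K₀ := by
        rw [hK₀, add_assoc]
        exact le_add_of_nonneg_right (by positivity)
      have k2 : (q + 1) ^ 2 + |q + 1| ≤ K₀ := by
        have : 0 ≤ p ^ 2 + |p| := by positivity
        have : 0 ≤ (-1) ^ 2 + |(-1 : ℝ)| := by positivity
        linarith
      have k3 : (-1) ^ 2 + |(-1 : ℝ)| ≤ K₀ := by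
        rw [hK₀]; exact le_add_of_nonneg_left (by positivity)
      have l1 := h1.trans (mul_le_mul_of_nonneg_right k1 g1)
      have l2 := h2.trans (mul_le_mul_of_nonneg_right k2 g2)
      have l3 := h3.trans (mul_le_mul_of_nonneg_right k3 g3)
      rw [abs_le] at l1 l2 l3 ⊢
      constructor
      · nlinarith [mul_le_mul_of_nonneg_left l1.1 hc.le, mul_le_mul_of_nonneg_left l2.1 hε.le,
          mul_le_mul_of_nonneg_left l3.1 hε.le]
      · nlinarith [mul_le_mul_of_nonneg_left l1.2 hc.le, mul_le_mul_of_nonneg_left l2.2 hε.le,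
          mul_le_mul_of_nonneg_left l3.2 hε.le]
    · intro r hr
      positivity
    · intro z hz
      rw [← hsum]
      have h1 := mul_le_mul_of_nonneg_left (norm_rpow_le_sum_rpow hp hz) hc.le
      linarith [hterm z hz, hsumE z hz]
    · intro s hs z hz hzb
      rw [← hsum]
      have h1 : 0 ≤ c * ∑ i, z i ^ p :=
        mul_nonneg hc.le (Finset.sum_nonneg fun i _ => hnn z hz p i)
      linarith [hgrowth s hs z hz, hbox z hz hzb]
  have hlim : Tendsto (fun ε : ℝ => Real.exp ((Cb * K₀ + 1) * (T - t)) *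
      (c + (c * ∑ i, x i ^ p + ε * ∑ i, (x i ^ (q + 1) + x i ^ (-1 : ℝ))))) (𝓝[>] 0)
      (𝓝 (Real.exp ((Cb * K₀ + 1) * (T - t)) *
      (c + (c * ∑ i, x i ^ p + 0 * ∑ i, (x i ^ (q + 1) + x i ^ (-1 : ℝ)))))) :=
    (Continuous.tendsto (by fun_prop) 0).mono_left nhdsWithin_le_nhds
  rw [zero_mul, add_zero] at hlim
  exact ge_of_tendsto hlim (by filter_upwards [self_mem_nhdsWithin] with ε h using hε ε h)

/-- A function whose partial derivatives are differentiable has a differentiable derivative, and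
the second partial derivatives are the entries of the latter's derivative. -/
theorem differentiableAt_fderiv_of_pd1 {d : ℕ} {u : (Fin d → ℝ) → ℝ} {x : Fin d → ℝ}
    (h : ∀ j, DifferentiableAt ℝ (pd1 u j) x) : DifferentiableAt ℝ (fderiv ℝ u) x := by
  have hsum : fderiv ℝ u = fun y => ∑ j, pd1 u j y • ContinuousLinearMap.proj (R := ℝ) j := by
    funext y
    ext z
    conv_lhs => rw [pi_eq_sum_univ' z]
    simp [pd1, map_sum, _root_.sum_apply, mul_comm]
  rw [hsum]
  exact DifferentiableAt.fun_sum fun j _ => (h j).smul_const _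

theorem pd2_eq_fderiv_fderiv {d : ℕ} {u : (Fin d → ℝ) → ℝ} {x : Fin d → ℝ}
    (h : DifferentiableAt ℝ (fderiv ℝ u) x) (i j : Fin d) :
    pd2 u i j x = fderiv ℝ (fderiv ℝ u) x (Pi.single i 1) (Pi.single j 1) := by
  have := h.hasFDerivAt.clm_apply (hasFDerivAt_const (Pi.single j (1 : ℝ)) x)
  unfold pd2 pd1
  rw [this.fderiv]
  simp

/-- Remark 5.3: if `|f(x)| ≤ c(1+|x|^p)`, then the polynomial-growth solution `v` of (TVP⁺)
satisfies `|v(t,x)| ≤ c̃(1+|x|^p)` with the same exponent `p`. -/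
theorem stmt8 (T : ℝ) (hT : 0 < T) (d : ℕ)
    (a : ℝ → (Fin d → ℝ) → Fin d → Fin d → ℝ)
    (ha_cont : ∀ i j, ContinuousOn (fun p : ℝ × (Fin d → ℝ) => a p.1 p.2 i j)
      (Set.Icc 0 T ×ˢ posOrth d))
    (ha_symm : ∀ t ∈ Set.Icc (0 : ℝ) T, ∀ x ∈ posOrth d, ∀ i j, a t x i j = a t x j i)
    (ha_pd : ∀ t ∈ Set.Icc (0 : ℝ) T, ∀ x ∈ posOrth d, ∀ y : Fin d → ℝ, y ≠ 0 →
      0 < ∑ i, ∑ j, a t x i j * y i * y j)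
    (ha_bdd : ∃ Cb : ℝ, ∀ t ∈ Set.Icc (0 : ℝ) T, ∀ x ∈ posOrth d, ∀ i j, |a t x i j| ≤ Cb)
    (ha_holder : ∀ i j, LocallyHolderOn (fun p : ℝ × (Fin d → ℝ) => a p.1 p.2 i j)
      (Set.Ico 0 T ×ˢ posOrth d))
    (f : (Fin d → ℝ) → ℝ) (hf : ContinuousOn f (posOrth d))
    (c p : ℝ) (hc : 0 < c) (hp : 0 < p)
    (hfg : ∀ x ∈ posOrth d, |f x| ≤ c * (1 + ‖x‖ ^ p))
    (v : ℝ → (Fin d → ℝ) → ℝ)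
    (hv_cont : ContinuousOn (fun q : ℝ × (Fin d → ℝ) => v q.1 q.2) (Set.Icc 0 T ×ˢ posOrth d))
    (hv_C12 : IsC12 (Set.Ico 0 T) (posOrth d) v)
    (hv_pde : ∀ t ∈ Set.Ico (0 : ℝ) T, ∀ x ∈ posOrth d,
      tderiv (Set.Icc 0 T) v t x
        + (1 / 2) * ∑ i, ∑ j, a t x i j * x i * x j * pd2 (v t) i j x = 0)
    (hv_term : ∀ x ∈ posOrth d, v T x = f x)
    (hv_growth : ∃ C q : ℝ, 0 < C ∧ 0 < q ∧
      ∀ t ∈ Set.Icc (0 : ℝ) T, ∀ x ∈ posOrth d, |v t x| ≤ C * (1 + ‖x‖ ^ q)) :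
    ∃ ctil : ℝ, ∀ t ∈ Set.Icc (0 : ℝ) T, ∀ x ∈ posOrth d, |v t x| ≤ ctil * (1 + ‖x‖ ^ p) := by
  obtain ⟨Cb, hCb⟩ := ha_bdd
  obtain ⟨C, q, hC, hq, hgrowth⟩ := hv_growth
  have hint : ∀ t ∈ Set.Ioo 0 T, t ∈ interior (Set.Ico 0 T) := fun t ht => by
    rwa [interior_Ico]
  have hvt : ∀ t ∈ Set.Ioo 0 T, ∀ x ∈ posOrth d,
      HasDerivAt (fun s => v s x) (tderiv (Set.Icc 0 T) v t x) t := fun t ht x hx => by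
    have h1 : DifferentiableAt ℝ (fun s => v s x) t :=
      (hv_C12.diff t (hint t ht) x hx).comp (f := fun s : ℝ => (s, x)) t (by fun_prop)
    rw [tderiv, derivWithin_of_mem_nhds (Icc_mem_nhds ht.1 ht.2)]
    exact h1.hasDerivAt
  have hG : ∀ t ∈ Set.Ioo 0 T, ∀ x ∈ posOrth d,
      HasFDerivAt (v t) (fderiv ℝ (v t) x) x := fun t ht x hx => by
    have h1 : DifferentiableAt ℝ (v t) x :=
      (hv_C12.diff t (hint t ht) x hx).comp (f := fun z : Fin d → ℝ => (t, z)) x (by fun_prop)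
    exact h1.hasFDerivAt
  have hH : ∀ t ∈ Set.Ioo 0 T, ∀ x ∈ posOrth d,
      HasFDerivAt (fderiv ℝ (v t)) (fderiv ℝ (fderiv ℝ (v t)) x) x := fun t ht x hx =>
    (differentiableAt_fderiv_of_pd1 (hv_C12.diff2 t (hint t ht) x hx)).hasFDerivAt
  have hpde : ∀ t ∈ Set.Ioo 0 T, ∀ x ∈ posOrth d, tderiv (Set.Icc 0 T) v t x
      + (1 / 2) * ∑ i, ∑ j, a t x i j * x i * x j
        * fderiv ℝ (fderiv ℝ (v t)) x (Pi.single i 1) (Pi.single j 1) = 0 := fun t ht x hx => by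
    simpa only [pd2_eq_fderiv_fderiv (hH t ht x hx).differentiableAt]
      using hv_pde t ⟨ht.1.le, ht.2⟩ x hx
  have hCb' : ∀ t ∈ Set.Icc (0 : ℝ) T, ∀ x ∈ posOrth d, ∀ i j, |a t x i j| ≤ |Cb| :=
    fun t ht x hx i j => (hCb t ht x hx i j).trans (le_abs_self _)
  obtain ⟨K₁, hK₁⟩ := le_exp_mul_sum_rpow ha_symm ha_pd (abs_nonneg Cb) hCb' hc hp hC hq
    hv_cont hvt hG hH hpde
    (fun x hx => by rw [hv_term x hx]; exact (le_abs_self _).trans (hfg x hx))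
    (fun t ht x hx => (le_abs_self _).trans (hgrowth t ht x hx))
  obtain ⟨K₂, hK₂⟩ := le_exp_mul_sum_rpow (v := fun t x => -v t x)
    (vt := fun t x => -tderiv (Set.Icc 0 T) v t x) (G := fun t x => -fderiv ℝ (v t) x)
    (H := fun t x => -fderiv ℝ (fderiv ℝ (v t)) x)
    ha_symm ha_pd (abs_nonneg Cb) hCb' hc hp hC hq
    hv_cont.neg (fun t ht x hx => (hvt t ht x hx).neg) (fun t ht x hx => (hG t ht x hx).neg)
    (fun t ht x hx => (hH t ht x hx).neg)
    (fun t ht x hx => by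
      have := hpde t ht x hx
      simp only [neg_apply, mul_neg, Finset.sum_neg_distrib]
      linarith)
    (fun x hx => by rw [hv_term x hx]; exact (neg_le_abs _).trans (hfg x hx))
    (fun t ht x hx => (neg_le_abs _).trans (hgrowth t ht x hx))
  set M := max (|K₁| * T) (|K₂| * T) with hM
  have hexp : ∀ K, |K| * T ≤ M → ∀ t ∈ Set.Ioc 0 T, Real.exp (K * (T - t)) ≤ Real.exp M := by
    intro K hK t ht
    refine Real.exp_le_exp.2 (le_trans ?_ hK)
    have h1 : 0 ≤ T - t := sub_nonneg.2 ht.2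
    calc K * (T - t) ≤ |K| * (T - t) := mul_le_mul_of_nonneg_right (le_abs_self K) h1
      _ ≤ |K| * T := mul_le_mul_of_nonneg_left (by linarith [ht.1]) (abs_nonneg K)
  refine ⟨Real.exp M * (c * (1 + d)), ?_⟩
  have hpos : ∀ t ∈ Set.Ioc 0 T, ∀ x ∈ posOrth d,
      |v t x| ≤ Real.exp M * (c * (1 + d)) * (1 + ‖x‖ ^ p) := by
    intro t ht x hx
    have hs : 0 ≤ ∑ i, x i ^ p := Finset.sum_nonneg fun i _ => Real.rpow_nonneg (hx i).le p
    have hB : c + c * ∑ i, x i ^ p ≤ c * (1 + d) * (1 + ‖x‖ ^ p) := by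
      have h1 := mul_le_mul_of_nonneg_left (sum_rpow_le_card_mul_norm_rpow hp hx) hc.le
      have h2 : 0 ≤ c * ‖x‖ ^ p := by positivity
      have h3 : 0 ≤ c * (d : ℝ) := by positivity
      nlinarith
    have hB0 : 0 ≤ c + c * ∑ i, x i ^ p := by positivity
    have hfin : ∀ K, |K| * T ≤ M → Real.exp (K * (T - t)) * (c + c * ∑ i, x i ^ p)
        ≤ Real.exp M * (c * (1 + d)) * (1 + ‖x‖ ^ p) := fun K hK => by
      rw [mul_assoc]
      exact mul_le_mul (hexp K hK t ht) hB hB0 (Real.exp_pos _).le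
    exact abs_le'.2 ⟨(hK₁ t ht x hx).trans (hfin K₁ (le_max_left _ _)),
      (hK₂ t ht x hx).trans (hfin K₂ (le_max_right _ _))⟩
  intro t ht x hx
  rcases ht.1.eq_or_lt with rfl | ht0
  · have hcont : ContinuousOn (fun s => v s x) (Set.Icc 0 T) :=
      hv_cont.comp (f := fun s : ℝ => (s, x)) (by fun_prop) fun s hs => ⟨hs, hx⟩
    have hlim : Tendsto (fun s => |v s x|) (𝓝[Set.Ioc 0 T] 0) (𝓝 |v 0 x|) :=
      ((hcont 0 ⟨le_rfl, hT.le⟩).mono Set.Ioc_subset_Icc_self).abs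
    have : (𝓝[Set.Ioc 0 T] (0 : ℝ)).NeBot := by
      rw [nhdsWithin_Ioc_eq_nhdsGT hT]
      infer_instance
    refine le_of_tendsto hlim ?_
    filter_upwards [self_mem_nhdsWithin] with s hs using hpos s hs x hx
  · exact hpos t ⟨ht0, ht.2⟩ x hx
end
end

section
/- Let 0=t_0<t_1<⋯<t_N=T and let H = h(S(t_0),…,S(t_N)) be an exotic option, and suppose functions v_k (k=0,…,N) satisfy the recursive scheme: v_N(t,x_0,…,x_N,x)=h(x_0,…,x_N), and for k=N−1,…,0, (t,x)↦v_k(t,x_0,…,x_k,x) belongs to C^{1,2}([t_k,t_{k+1})×ℝ^d)∩C([t_k,t_{k+1}]×ℝ^d), solves ∂v_k/∂t + ℒv_k = 0 on [t_k,t_{k+1})×ℝ^d, and has terminal value v_k(t_{k+1},x_0,…,x_k,x) = v_{k+1}(t_{k+1},x_0,…,x_k,x,x). For S∈𝒮_a define ξ^S(t) := ∇_x v_k(t,S(t_0),…,S(t_k),S(t)) for t∈[t_k,t_{k+1}). Then for each S∈𝒮_a and each k: for t∈[t_k,t_{k+1}) the Föllmer integral ∫_{t_k}^t ξ^S(s)·dS(s)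 exists and v_k(t,S(t_0),…,S(t_k),S(t)) = v_k(t_k,S(t_0),…,S(t_k),S(t_k)) + ∫_{t_k}^t ξ^S(s)·dS(s); the limit ∫_{t_k}^{t_{k+1}} ξ^S(s)·dS(s) := lim_{t↑t_{k+1}} ∫_{t_k}^t ξ^S(s)·dS(s) exists; and, with ∫_0^t ξ^S dS defined by concatenating these pieces, lim_{t↑T} v_{N−1}(t,S(t_0),…,S(t_{N−1}),S(t)) = v_0(0,S(t_0)) + ∫_0^T ξ^S(s)·dS(s) = h(S(t_0),…,S(t_N)). In this sense ξ^S is a strictly pathwise Delta hedging strategy for H. -/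
open Finset Filter Topology Set

noncomputable section

section Partition

variable {T : ℝ} {P : Finset ℝ}

lemma succOf_mem (hT : T ∈ P) (s : ℝ) : succOf T P s ∈ P := by
  unfold succOf
  split_ifs with h
  · exact (Finset.mem_filter.1 (Finset.min'_mem _ h)).1
  · exact hT

lemma lt_succOf {s : ℝ} (hs : s < T) : s < succOf T P s := by
  unfold succOf
  split_ifs with h
  · exact (Finset.mem_filter.1 (Finset.min'_mem _ h)).2
  · exact hs

lemma succOf_le_of_mem {s u : ℝ} (hu : u ∈ P) (hsu : s < u) : succOf T P s ≤ u := by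
  have hu' : u ∈ P.filter (fun u => s < u) := Finset.mem_filter.2 ⟨hu, hsu⟩
  rw [succOf, dif_pos ⟨u, hu'⟩]
  exact Finset.min'_le _ _ hu'

lemma succOf_eq_of_forall_notMem {r q : ℝ} (hrq : r ≤ q)
    (h : ∀ u ∈ P, r < u → ¬ u ≤ q) : succOf T P r = succOf T P q := by
  have : P.filter (fun u => r < u) = P.filter (fun u => q < u) := by
    ext u
    simp only [Finset.mem_filter, and_congr_right_iff]
    exact fun hu => ⟨fun hr => not_le.1 (h u hu hr), fun hq => hrq.trans_lt hq⟩
  simp only [succOf, this]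

/-- Telescoping along the points of a partition lying in `(r, q]`. -/
lemma sum_succOf_sub (T : ℝ) (P : Finset ℝ) (f : ℝ → ℝ) {r q : ℝ} (hrq : r ≤ q) :
    ∑ s ∈ P.filter (fun s => r < s ∧ s ≤ q), (f (succOf T P s) - f s)
      = f (succOf T P q) - f (succOf T P r) := by
  induction hn : (P.filter (fun s => r < s ∧ s ≤ q)).card generalizing r with
  | zero =>
    have h0 := Finset.card_eq_zero.1 hn
    rw [h0, Finset.sum_empty, succOf_eq_of_forall_notMem (T := T) hrq, sub_self]
    intro u hu hr hq
    exact Finset.notMem_empty u (h0 ▸ Finset.mem_filter.2 ⟨hu, hr, hq⟩)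
  | succ n ih =>
    have hne : (P.filter (fun s => r < s ∧ s ≤ q)).Nonempty := by
      rw [← Finset.card_pos]; omega
    obtain ⟨u, hu⟩ := hne
    obtain ⟨huP, hru, huq⟩ := Finset.mem_filter.1 hu
    have hrne : (P.filter (fun u => r < u)).Nonempty := ⟨u, Finset.mem_filter.2 ⟨huP, hru⟩⟩
    set m := succOf T P r with hm
    have hm' := Finset.mem_filter.1 (Finset.min'_mem _ hrne)
    rw [← show m = _ from dif_pos hrne] at hm'
    have hmq : m ≤ q := (succOf_le_of_mem huP hru).trans huq
    have hins : P.filter (fun s => r < s ∧ s ≤ q)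
        = insert m (P.filter (fun s => m < s ∧ s ≤ q)) := by
      ext s
      simp only [Finset.mem_filter, Finset.mem_insert]
      constructor
      · rintro ⟨hs, hrs, hsq⟩
        rcases (succOf_le_of_mem (T := T) hs hrs).eq_or_lt with h | h
        · exact Or.inl h.symm
        · exact Or.inr ⟨hs, h, hsq⟩
      · rintro (rfl | ⟨hs, hms, hsq⟩)
        · exact ⟨hm'.1, hm'.2, hmq⟩
        · exact ⟨hs, hm'.2.trans hms, hsq⟩
    have hnot : m ∉ P.filter (fun s => m < s ∧ s ≤ q) := by simp
    rw [hins, Finset.card_insert_of_notMem hnot] at hn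
    rw [hins, Finset.sum_insert hnot, ih hmq (by omega)]
    ring

lemma sum_filter_Ioc_add (P : Finset ℝ) (f : ℝ → ℝ) {p q w : ℝ} (hpq : p ≤ q) (hqw : q ≤ w) :
    ∑ s ∈ P.filter (fun s => p < s ∧ s ≤ w), f s
      = ∑ s ∈ P.filter (fun s => p < s ∧ s ≤ q), f s
        + ∑ s ∈ P.filter (fun s => q < s ∧ s ≤ w), f s := by
  rw [← Finset.sum_union]
  · congr 1
    ext s
    simp only [Finset.mem_filter, Finset.mem_union]
    constructor
    · rintro ⟨hs, h1, h2⟩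
      rcases le_or_gt s q with h | h
      · exact Or.inl ⟨hs, h1, h⟩
      · exact Or.inr ⟨hs, h, h2⟩
    · rintro (⟨hs, h1, h2⟩ | ⟨hs, h1, h2⟩)
      · exact ⟨hs, h1, h2.trans hqw⟩
      · exact ⟨hs, hpq.trans_lt h1, h2⟩
  · rw [Finset.disjoint_left]
    intro s h1 h2
    exact absurd (Finset.mem_filter.1 h1).2.2 (not_le.2 (Finset.mem_filter.1 h2).2.1)

lemma sum_filter_le_sub (P : Finset ℝ) (f : ℝ → ℝ) {p q : ℝ} (hpq : p ≤ q) :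
    ∑ s ∈ P.filter (fun s => p < s ∧ s ≤ q), f s
      = ∑ s ∈ P.filter (fun s => s ≤ q), f s - ∑ s ∈ P.filter (fun s => s ≤ p), f s := by
  rw [eq_sub_iff_add_eq, ← Finset.sum_union]
  · congr 1
    ext s
    simp only [Finset.mem_filter, Finset.mem_union]
    constructor
    · rintro (⟨hs, h1, h2⟩ | ⟨hs, h1⟩)
      · exact ⟨hs, h2⟩
      · exact ⟨hs, h1.trans hpq⟩
    · rintro ⟨hs, h2⟩
      rcases le_or_gt s p with h | h
      · exact Or.inr ⟨hs, h⟩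
      · exact Or.inl ⟨hs, h, h2⟩
  · rw [Finset.disjoint_left]
    intro s h1 h2
    exact absurd (Finset.mem_filter.1 h2).2 (not_le.2 (Finset.mem_filter.1 h1).2.1)

end Partition

namespace PartitionSeq

variable {T : ℝ} (𝕋 : PartitionSeq T)

lemma succOf_le (n : ℕ) (s : ℝ) : succOf T (𝕋.part n) s ≤ T :=
  (𝕋.subset_Icc n (succOf_mem (𝕋.top_mem n) s)).2

lemma le_succOf (n : ℕ) {s : ℝ} (hs : s ≤ T) : s ≤ succOf T (𝕋.part n) s := by
  rcases hs.eq_or_lt with rfl | h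
  · unfold succOf
    split_ifs with h
    · exact (Finset.mem_filter.1 (Finset.min'_mem _ h)).2.le
    · exact le_rfl
  · exact (lt_succOf h).le

/-- The mesh condition also controls the distance from an arbitrary time to the next
partition point. -/
lemma eventually_succOf_sub_lt {ε : ℝ} (hε : 0 < ε) :
    ∀ᶠ n in atTop, ∀ r, 0 ≤ r → succOf T (𝕋.part n) r - r < ε := by
  obtain ⟨N, hN⟩ := 𝕋.mesh_to_zero ε hε
  filter_upwards [eventually_ge_atTop N] with n hn r hr
  have hne : ((𝕋.part n).filter (fun u => u ≤ r)).Nonempty :=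
    ⟨0, Finset.mem_filter.2 ⟨𝕋.zero_mem n, hr⟩⟩
  obtain ⟨hsP, hsr⟩ := Finset.mem_filter.1 (Finset.max'_mem _ hne)
  set s := Finset.max' _ hne
  have heq : succOf T (𝕋.part n) s = succOf T (𝕋.part n) r := by
    refine succOf_eq_of_forall_notMem hsr fun u hu hsu hur => ?_
    exact absurd (Finset.le_max' _ u (Finset.mem_filter.2 ⟨hu, hur⟩)) (not_le.2 hsu)
  have := hN n hn s hsP
  linarith

lemma tendsto_succOf {r : ℝ} (h0 : 0 ≤ r) (hT : r ≤ T) :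
    Tendsto (fun n => succOf T (𝕋.part n) r) atTop (𝓝 r) := by
  rw [Metric.tendsto_nhds]
  intro ε hε
  filter_upwards [𝕋.eventually_succOf_sub_lt hε] with n hn
  rw [Real.dist_eq, abs_of_nonneg (sub_nonneg.2 (𝕋.le_succOf n hT))]
  exact hn r h0

lemma tendsto_comp_succOf {E : Type*} [TopologicalSpace E] {F : ℝ → E} {b r : ℝ}
    (h0 : 0 ≤ r) (hrb : r < b) (hbT : b ≤ T) (hF : ContinuousOn F (Set.Icc r b)) :
    Tendsto (fun n => F (succOf T (𝕋.part n) r)) atTop (𝓝 (F r)) := by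
  have h1 := 𝕋.tendsto_succOf h0 (hrb.le.trans hbT)
  refine (hF r (Set.left_mem_Icc.2 hrb.le)).tendsto.comp (tendsto_nhdsWithin_iff.2 ⟨h1, ?_⟩)
  filter_upwards [h1.eventually (gt_mem_nhds hrb)] with n hn
  exact ⟨𝕋.le_succOf n (hrb.le.trans hbT), hn.le⟩

end PartitionSeq

open MeasureTheory in
/-- Weak convergence of discrete signed measures of bounded total variation: convergence of the
masses of all intervals implies convergence of the integrals of continuous functions. -/
lemma tendsto_sum_filter_Ioc_mul {P : ℕ → Finset ℝ} {c : ℕ → ℝ → ℝ} {α f : ℝ → ℝ} {r b C : ℝ}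
    (hrb : r ≤ b) (hα : ContinuousOn α (Set.Icc r b)) (hf : ContinuousOn f (Set.Icc r b))
    (hc : ∀ p q, r ≤ p → p ≤ q → q ≤ b →
      Tendsto (fun n => ∑ s ∈ (P n).filter (fun s => p < s ∧ s ≤ q), c n s) atTop
        (𝓝 (∫ s in p..q, α s)))
    (hC : ∀ᶠ n in atTop, ∑ s ∈ (P n).filter (fun s => r < s ∧ s ≤ b), |c n s| ≤ C) :
    Tendsto (fun n => ∑ s ∈ (P n).filter (fun s => r < s ∧ s ≤ b), f s * c n s) atTop
      (𝓝 (∫ s in r..b, f s * α s)) := by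
  have hii : ∀ g : ℝ → ℝ, ContinuousOn g (Set.Icc r b) → ∀ p q, r ≤ p → p ≤ q → q ≤ b →
      IntervalIntegrable g volume p q := fun g hg p q hp hpq hq =>
    (hg.mono (Set.Icc_subset_Icc hp hq)).intervalIntegrable_of_Icc hpq
  have hfα : ContinuousOn (fun s => f s * α s) (Set.Icc r b) := hf.mul hα
  have key : ∀ ε > 0, ∃ η > 0, ∀ p q, r ≤ p → p ≤ q → q ≤ b → q - p ≤ η → ∀ ε' > 0,
      ∀ᶠ n in atTop,
      |∑ s ∈ (P n).filter (fun s => p < s ∧ s ≤ q), f s * c n s - ∫ s in p..q, f s * α s|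
        ≤ ε * (∑ s ∈ (P n).filter (fun s => p < s ∧ s ≤ q), |c n s| + ∫ s in p..q, |α s|)
          + ε' := by
    intro ε hε
    obtain ⟨η, hη, hu⟩ := Metric.uniformContinuousOn_iff.1
      (isCompact_Icc.uniformContinuousOn_of_continuous hf) ε hε
    refine ⟨η / 2, by positivity, fun p q hp hpq hq hη' ε' hε' => ?_⟩
    have hclose : ∀ s, p ≤ s → s ≤ q → |f s - f p| ≤ ε := fun s h1 h2 => by
      have := hu s ⟨hp.trans h1, h2.trans hq⟩ p ⟨hp, hpq.trans hq⟩
        (by rw [Real.dist_eq, abs_of_nonneg (by linarith)]; linarith)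
      rw [Real.dist_eq] at this
      exact this.le
    have hlim := ((hc p q hp hpq hq).const_mul (f p)).eventually (Metric.ball_mem_nhds _ hε')
    have hdev : |∫ s in p..q, (f p - f s) * α s| ≤ ε * ∫ s in p..q, |α s| := by
      rw [← intervalIntegral.integral_const_mul]
      refine (intervalIntegral.abs_integral_le_integral_abs hpq).trans ?_
      refine intervalIntegral.integral_mono_on hpq ?_ ?_ fun s hs => ?_
      · exact hii _ ((continuousOn_const.sub hf).mul hα).abs p q hp hpq hq
      · exact hii _ (continuousOn_const.mul hα.abs) p q hp hpq hq
      · rw [abs_mul, abs_sub_comm]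
        exact mul_le_mul_of_nonneg_right (hclose s hs.1 hs.2) (abs_nonneg _)
    have hsplit : ∫ s in p..q, (f p - f s) * α s
        = f p * (∫ s in p..q, α s) - ∫ s in p..q, f s * α s := by
      rw [← intervalIntegral.integral_const_mul, ← intervalIntegral.integral_sub
        (hii (fun s => f p * α s) (continuousOn_const.mul hα) p q hp hpq hq)
        (hii _ hfα p q hp hpq hq)]
      exact intervalIntegral.integral_congr fun s _ => sub_mul _ _ _
    filter_upwards [hlim] with n hn
    have hn' : |f p * ∑ s ∈ (P n).filter (fun s => p < s ∧ s ≤ q), c n s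
        - f p * ∫ s in p..q, α s| < ε' := hn
    have hsum : |∑ s ∈ (P n).filter (fun s => p < s ∧ s ≤ q), f s * c n s
        - f p * ∑ s ∈ (P n).filter (fun s => p < s ∧ s ≤ q), c n s|
        ≤ ε * ∑ s ∈ (P n).filter (fun s => p < s ∧ s ≤ q), |c n s| := by
      rw [Finset.mul_sum, ← Finset.sum_sub_distrib, Finset.mul_sum]
      refine (Finset.abs_sum_le_sum_abs _ _).trans (Finset.sum_le_sum fun s hs => ?_)
      have hs := (Finset.mem_filter.1 hs).2
      rw [← sub_mul, abs_mul]
      exact mul_le_mul_of_nonneg_right (hclose s hs.1.le hs.2) (abs_nonneg _)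
    rw [hsplit] at hdev
    rw [abs_le] at *
    rw [abs_lt] at hn'
    constructor <;> linarith [hdev.1, hdev.2, hsum.1, hsum.2, hn'.1, hn'.2]
  have glue : ∀ ε > 0, ∀ ε' > 0, ∀ᶠ n in atTop,
      |∑ s ∈ (P n).filter (fun s => r < s ∧ s ≤ b), f s * c n s - ∫ s in r..b, f s * α s|
        ≤ ε * (∑ s ∈ (P n).filter (fun s => r < s ∧ s ≤ b), |c n s| + ∫ s in r..b, |α s|)
          + ε' := by
    intro ε hε
    obtain ⟨η, hη, hk⟩ := key ε hε
    have main : ∀ m : ℕ, ∀ q, r ≤ q → q ≤ b → q - r ≤ (m + 1) * η → ∀ ε' > 0, ∀ᶠ n in atTop,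
        |∑ s ∈ (P n).filter (fun s => r < s ∧ s ≤ q), f s * c n s - ∫ s in r..q, f s * α s|
        ≤ ε * (∑ s ∈ (P n).filter (fun s => r < s ∧ s ≤ q), |c n s| + ∫ s in r..q, |α s|)
          + ε' := by
      intro m
      induction m with
      | zero =>
        intro q hrq hqb hq
        exact hk r q le_rfl hrq hqb (by simpa using hq)
      | succ m ih =>
        intro q hrq hqb hq ε' hε'
        push_cast at hq
        have hp1 : r ≤ max r (q - η) := le_max_left _ _
        have hp2 : max r (q - η) ≤ q := max_le hrq (by linarith)
        have hp3 : q - η ≤ max r (q - η) := le_max_right _ _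
        have hp4 : max r (q - η) - r ≤ (m + 1) * η := by
          rw [sub_le_iff_le_add]
          exact max_le (by nlinarith [Nat.cast_nonneg (α := ℝ) m]) (by linarith)
        set p := max r (q - η)
        filter_upwards [ih p hp1 (hp2.trans hqb) hp4 (ε' / 2) (by positivity),
          hk p q hp1 hp2 hqb (by linarith) (ε' / 2) (by positivity)] with n h1 h2
        rw [sum_filter_Ioc_add _ _ hp1 hp2, sum_filter_Ioc_add _ (fun s => |c n s|) hp1 hp2,
          ← intervalIntegral.integral_add_adjacent_intervals
            (hii _ hfα r p le_rfl hp1 (hp2.trans hqb)) (hii _ hfα p q hp1 hp2 hqb),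
          ← intervalIntegral.integral_add_adjacent_intervals
            (hii _ hα.abs r p le_rfl hp1 (hp2.trans hqb)) (hii _ hα.abs p q hp1 hp2 hqb)]
        rw [abs_le] at *
        constructor <;> linarith [h1.1, h1.2, h2.1, h2.2]
    obtain ⟨m, hm⟩ := exists_nat_ge ((b - r) / η)
    refine main m b hrb le_rfl ?_
    rw [div_le_iff₀ hη] at hm
    nlinarith
  rw [Metric.tendsto_nhds]
  intro e he
  set D := |C| + ∫ s in r..b, |α s| with hD
  have hD0 : 0 ≤ D := add_nonneg (abs_nonneg _)
    (intervalIntegral.integral_nonneg hrb fun _ _ => abs_nonneg _)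
  filter_upwards [glue (e / (2 * (D + 1))) (by positivity) (e / 3) (by positivity), hC]
    with n hn hCn
  rw [Real.dist_eq]
  have h1 : e / (2 * (D + 1)) *
      (∑ s ∈ (P n).filter (fun s => r < s ∧ s ≤ b), |c n s| + ∫ s in r..b, |α s|)
      ≤ e / (2 * (D + 1)) * (D + 1) := by
    refine mul_le_mul_of_nonneg_left ?_ (by positivity)
    linarith [le_abs_self C]
  have h2 : e / (2 * (D + 1)) * (D + 1) = e / 2 := by field_simp
  linarith

/-- The gradient of a function on `Fin d → ℝ` in terms of its partial derivatives. -/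
lemma fderiv_apply_eq_sum_pd1 {d : ℕ} (f : (Fin d → ℝ) → ℝ) (x y : Fin d → ℝ) :
    fderiv ℝ f x y = ∑ k, pd1 f k x * y k := by
  conv_lhs => rw [pi_eq_sum_univ' y, map_sum]
  exact Finset.sum_congr rfl fun k _ => by rw [map_smul, smul_eq_mul, mul_comm]; rfl

/-- Second-order Taylor estimate for functions whose partial derivatives are differentiable. -/
lemma abs_taylor_second_order_le {d : ℕ} {f : (Fin d → ℝ) → ℝ} (hf : Differentiable ℝ f)
    (hf2 : ∀ j, Differentiable ℝ (pd1 f j)) (x y : Fin d → ℝ) {ε : ℝ}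
    (hε : ∀ θ ∈ Set.Icc (0 : ℝ) 1, ∀ i j, |pd2 f i j (x + θ • y) - pd2 f i j x| ≤ ε) :
    |f (x + y) - f x - ∑ k, pd1 f k x * y k
        - (1 / 2) * ∑ i, ∑ j, pd2 f i j x * (y i * y j)| ≤ ε * (d * ∑ i, y i ^ 2) := by
  set A := ∑ k, pd1 f k x * y k with hA
  set B := ∑ i, ∑ j, pd2 f i j x * (y i * y j) with hB
  set M := ε * (d * ∑ i, y i ^ 2) with hM
  have hline : ∀ θ : ℝ, HasDerivAt (fun θ : ℝ => x + θ • y) y θ := fun θ => by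
    simpa using ((hasDerivAt_id θ).smul_const y).const_add x
  have h1 : ∀ θ : ℝ, HasDerivAt (fun θ : ℝ => f (x + θ • y))
      (∑ k, pd1 f k (x + θ • y) * y k) θ := fun θ => by
    rw [← fderiv_apply_eq_sum_pd1]
    exact (hf _).hasFDerivAt.comp_hasDerivAt θ (hline θ)
  have h2 : ∀ θ : ℝ, HasDerivAt (fun θ : ℝ => ∑ k, pd1 f k (x + θ • y) * y k)
      (∑ i, ∑ j, pd2 f i j (x + θ • y) * (y i * y j)) θ := fun θ => by
    rw [Finset.sum_comm]
    refine HasDerivAt.fun_sum fun j _ => ?_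
    have := ((hf2 j _).hasFDerivAt.comp_hasDerivAt θ (hline θ)).mul_const (y j)
    rw [fderiv_apply_eq_sum_pd1, Finset.sum_mul] at this
    exact this.congr_deriv (Finset.sum_congr rfl fun i _ => by rw [mul_assoc]; rfl)
  have hbound : ∀ θ ∈ Set.Icc (0 : ℝ) 1,
      |∑ i, ∑ j, pd2 f i j (x + θ • y) * (y i * y j) - B| ≤ M := by
    intro θ hθ
    have hε0 : d ≠ 0 → 0 ≤ ε := fun hd =>
      (abs_nonneg _).trans (hε θ hθ ⟨0, Nat.pos_of_ne_zero hd⟩ ⟨0, Nat.pos_of_ne_zero hd⟩)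
    rcases eq_or_ne d 0 with rfl | hd
    · simp [hB, hM]
    rw [hB, ← Finset.sum_sub_distrib]
    simp_rw [← Finset.sum_sub_distrib, ← sub_mul]
    calc _ ≤ ∑ i, ∑ j, ε * (|y i| * |y j|) := by
          refine (Finset.abs_sum_le_sum_abs _ _).trans (Finset.sum_le_sum fun i _ =>
            (Finset.abs_sum_le_sum_abs _ _).trans (Finset.sum_le_sum fun j _ => ?_))
          rw [abs_mul, abs_mul]
          exact mul_le_mul_of_nonneg_right (hε θ hθ i j) (by positivity)
      _ = ε * (∑ i, |y i|) ^ 2 := by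
          rw [sq, Finset.sum_mul_sum, Finset.mul_sum]
          exact Finset.sum_congr rfl fun i _ => (Finset.mul_sum _ _ _).symm
      _ ≤ M := by
          refine mul_le_mul_of_nonneg_left ?_ (hε0 hd)
          have := sq_sum_le_card_mul_sum_sq (s := Finset.univ) (f := fun i => |y i|)
          simpa using this
  have hx : x + (0 : ℝ) • y = x := by simp
  have step1 : ∀ θ ∈ Set.Icc (0 : ℝ) 1,
      |∑ k, pd1 f k (x + θ • y) * y k - A - θ * B| ≤ M := by
    intro θ hθ
    have hd : ∀ z ∈ Set.Icc (0 : ℝ) 1, HasDerivWithinAt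
        (fun θ : ℝ => ∑ k, pd1 f k (x + θ • y) * y k - A - θ * B)
        (∑ i, ∑ j, pd2 f i j (x + z • y) * (y i * y j) - B) (Set.Icc 0 1) z := fun z _ => by
      have := ((h2 z).sub_const A).fun_sub ((hasDerivAt_id z).mul_const B)
      exact (this.congr_deriv (by rw [one_mul])).hasDerivWithinAt
    have := (convex_Icc (0 : ℝ) 1).norm_image_sub_le_of_norm_hasDerivWithin_le hd hbound
      (Set.left_mem_Icc.2 zero_le_one) hθ
    have hM0 : 0 ≤ M := (abs_nonneg _).trans (hbound θ hθ)
    simp only [hx, ← hA, sub_self, zero_mul, sub_zero, Real.norm_eq_abs] at this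
    refine this.trans (mul_le_of_le_one_right hM0 ?_)
    rw [abs_of_nonneg hθ.1]
    exact hθ.2
  have hd : ∀ z ∈ Set.Icc (0 : ℝ) 1, HasDerivWithinAt
      (fun θ : ℝ => f (x + θ • y) - θ * A - θ ^ 2 / 2 * B)
      (∑ k, pd1 f k (x + z • y) * y k - A - z * B) (Set.Icc 0 1) z := fun z _ => by
    have := ((h1 z).fun_sub ((hasDerivAt_id z).mul_const A)).fun_sub
      (((hasDerivAt_pow 2 z).div_const 2).mul_const B)
    exact (this.congr_deriv (by simp)).hasDerivWithinAt
  have := (convex_Icc (0 : ℝ) 1).norm_image_sub_le_of_norm_hasDerivWithin_le hd step1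
    (Set.left_mem_Icc.2 zero_le_one) (Set.right_mem_Icc.2 zero_le_one)
  simp only [hx, one_smul, Real.norm_eq_abs, sub_zero, abs_one, mul_one] at this
  convert this using 2
  ring

/-- Increment estimate for functions of time and space that are once differentiable in time and
twice differentiable in space. -/
lemma abs_taylor_time_space_le {d : ℕ} {w : ℝ → (Fin d → ℝ) → ℝ} {s s' : ℝ} (hss' : s ≤ s')
    (hdiff : ∀ σ ∈ Set.Icc s s', ∀ z,
      DifferentiableAt ℝ (fun p : ℝ × (Fin d → ℝ) => w p.1 p.2) (σ, z))
    (hdiff2 : ∀ j, Differentiable ℝ (pd1 (w s) j)) (x y : Fin d → ℝ) {A ε : ℝ}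
    (htime : ∀ σ ∈ Set.Icc s s', |deriv (fun τ => w τ (x + y)) σ - A| ≤ ε)
    (hspace : ∀ θ ∈ Set.Icc (0 : ℝ) 1, ∀ i j,
      |pd2 (w s) i j (x + θ • y) - pd2 (w s) i j x| ≤ ε) :
    |w s' (x + y) - w s x - A * (s' - s) - ∑ k, pd1 (w s) k x * y k
        - (1 / 2) * ∑ i, ∑ j, pd2 (w s) i j x * (y i * y j)|
      ≤ ε * ((s' - s) + d * ∑ i, y i ^ 2) := by
  have hspaceDiff : Differentiable ℝ (w s) := fun z =>
    (hdiff s (Set.left_mem_Icc.2 hss') z).comp (f := fun z => (s, z)) z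
      ((differentiableAt_const s).prodMk differentiableAt_id)
  have h1 := abs_taylor_second_order_le hspaceDiff hdiff2 x y hspace
  have hd : ∀ σ ∈ Set.Icc s s', HasDerivWithinAt (fun σ => w σ (x + y) - σ * A)
      (deriv (fun τ => w τ (x + y)) σ - A) (Set.Icc s s') σ := fun σ hσ => by
    have hw : DifferentiableAt ℝ (fun τ => w τ (x + y)) σ :=
      (hdiff σ hσ (x + y)).comp (f := fun τ => (τ, x + y)) σ
        (differentiableAt_id.prodMk (differentiableAt_const (x + y)))
    have := hw.hasDerivAt.fun_sub ((hasDerivAt_id σ).mul_const A)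
    exact (this.congr_deriv (by rw [one_mul])).hasDerivWithinAt
  have h2 := (convex_Icc s s').norm_image_sub_le_of_norm_hasDerivWithin_le hd htime
    (Set.left_mem_Icc.2 hss') (Set.right_mem_Icc.2 hss')
  rw [Real.norm_eq_abs, Real.norm_eq_abs, abs_of_nonneg (sub_nonneg.2 hss')] at h2
  rw [abs_le] at *
  constructor <;> linarith [h1.1, h1.2, h2.1, h2.2]

/-- Uniform smallness of the Taylor remainders along a path and a refining sequence of
partitions. -/
lemma eventually_abs_remainder_le {T : ℝ} (𝕋 : PartitionSeq T) {d : ℕ} {S : ℝ → Fin d → ℝ}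
    (hS : ContinuousOn S (Set.Icc 0 T)) {r R τ : ℝ} (hr : 0 ≤ r) (hR : R ≤ T) (hτR : τ < R)
    {w : ℝ → (Fin d → ℝ) → ℝ} (hw : IsC12 (Set.Ico r R) Set.univ w)
    {gt : ℝ × (Fin d → ℝ) → ℝ} {gxx : Fin d → Fin d → ℝ × (Fin d → ℝ) → ℝ}
    (hgt : ContinuousOn gt (Set.Ico r R ×ˢ Set.univ))
    (hgxx : ∀ i j, ContinuousOn (gxx i j) (Set.Ico r R ×ˢ Set.univ))
    (hgt_eq : ∀ s ∈ Set.Ioo r R, ∀ x, gt (s, x) = deriv (fun σ => w σ x) s)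
    (hgxx_eq : ∀ s ∈ Set.Ioo r R, ∀ x i j, gxx i j (s, x) = pd2 (w s) i j x)
    {ε : ℝ} (hε : 0 < ε) :
    ∀ᶠ n in atTop, ∀ s, r < s → s ≤ τ →
      |w (succOf T (𝕋.part n) s) (S (succOf T (𝕋.part n) s)) - w s (S s)
        - gt (s, S s) * (succOf T (𝕋.part n) s - s)
        - ∑ k, pd1 (w s) k (S s) * (S (succOf T (𝕋.part n) s) k - S s k)
        - (1 / 2) * ∑ i, ∑ j, gxx i j (s, S s) *
          ((S (succOf T (𝕋.part n) s) i - S s i) * (S (succOf T (𝕋.part n) s) j - S s j))|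
      ≤ ε * ((succOf T (𝕋.part n) s - s)
        + d * ∑ i, (S (succOf T (𝕋.part n) s) i - S s i) ^ 2) := by
  obtain ⟨M, hM⟩ := isCompact_Icc.exists_bound_of_continuousOn hS
  obtain ⟨b, hτb, hbR⟩ := exists_between hτR
  set K : Set (ℝ × (Fin d → ℝ)) := Set.Icc r b ×ˢ Metric.closedBall 0 M with hK
  have hKsub : K ⊆ Set.Ico r R ×ˢ Set.univ :=
    Set.prod_mono (fun s hs => ⟨hs.1, hs.2.trans_lt hbR⟩) (Set.subset_univ _)
  have hG : ContinuousOn (fun p => (gt p, fun i j => gxx i j p)) K :=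
    (hgt.mono hKsub).prodMk
      (continuousOn_pi.2 fun i => continuousOn_pi.2 fun j => (hgxx i j).mono hKsub)
  obtain ⟨δ, hδ, hu⟩ := Metric.uniformContinuousOn_iff.1
    ((isCompact_Icc.prod (isCompact_closedBall 0 M)).uniformContinuousOn_of_continuous hG) ε hε
  have hu1 : ∀ p ∈ K, ∀ q ∈ K, dist p q < δ → |gt p - gt q| ≤ ε := fun p hp q hq hpq =>
    (le_max_left _ _).trans (hu p hp q hq hpq).le
  have hu2 : ∀ p ∈ K, ∀ q ∈ K, dist p q < δ → ∀ i j, |gxx i j p - gxx i j q| ≤ ε :=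
    fun p hp q hq hpq i j =>
      (dist_le_pi_dist (fun j => gxx i j p) (fun j => gxx i j q) j).trans
        ((dist_le_pi_dist (fun i j => gxx i j p) (fun i j => gxx i j q) i).trans
          ((le_max_right _ _).trans (hu p hp q hq hpq).le))
  obtain ⟨η, hη, hSu⟩ := Metric.uniformContinuousOn_iff.1
    (isCompact_Icc.uniformContinuousOn_of_continuous hS) δ hδ
  filter_upwards [𝕋.eventually_succOf_sub_lt (lt_min hη (lt_min hδ (sub_pos.2 hτb)))]
    with n hn s hrs hsτ
  have hs0 : 0 ≤ s := hr.trans hrs.le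
  have hsT : s ≤ T := (hsτ.trans hτR.le).trans hR
  have hn := hn s hs0
  have hss' := 𝕋.le_succOf n hsT
  have hs'T := 𝕋.succOf_le n s
  set s' := succOf T (𝕋.part n) s
  obtain ⟨hnη, hn'⟩ := lt_min_iff.1 hn
  obtain ⟨hnδ, hnb⟩ := lt_min_iff.1 hn'
  have hs'b : s' ≤ b := by linarith
  have hIoo : ∀ σ ∈ Set.Icc s s', σ ∈ Set.Ioo r R := fun σ hσ =>
    ⟨hrs.trans_le hσ.1, (hσ.2.trans hs'b).trans_lt hbR⟩
  have hsIcc : s ∈ Set.Icc s s' := Set.left_mem_Icc.2 hss'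
  have hSs : S s ∈ Metric.closedBall (0 : Fin d → ℝ) M :=
    mem_closedBall_zero_iff.2 (hM s ⟨hs0, hsT⟩)
  have hSs' : S s' ∈ Metric.closedBall (0 : Fin d → ℝ) M :=
    mem_closedBall_zero_iff.2 (hM s' ⟨hs0.trans hss', hs'T⟩)
  have hdist : dist (S s') (S s) < δ := hSu s' ⟨hs0.trans hss', hs'T⟩ s ⟨hs0, hsT⟩
    (by rwa [Real.dist_eq, abs_of_nonneg (sub_nonneg.2 hss')])
  have hpK : (s, S s) ∈ K := ⟨⟨hrs.le, hss'.trans hs'b⟩, hSs⟩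
  have hadd : S s + (S s' - S s) = S s' := add_sub_cancel _ _
  have hdev : ∀ σ ∈ Set.Icc s s', σ ∈ interior (Set.Ico r R) := fun σ hσ => by
    rw [interior_Ico]; exact hIoo σ hσ
  have main := abs_taylor_time_space_le (w := w) hss'
    (fun σ hσ z => hw.diff σ (hdev σ hσ) z (Set.mem_univ z))
    (fun j z => hw.diff2 s (hdev s hsIcc) z (Set.mem_univ z) j) (S s) (S s' - S s)
    (A := gt (s, S s)) (ε := ε) ?_ ?_
  · rw [hadd] at main
    simpa only [Pi.sub_apply, hgxx_eq s (hIoo s hsIcc)] using main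
  · intro σ hσ
    rw [hadd, ← hgt_eq σ (hIoo σ hσ)]
    refine hu1 _ ⟨⟨(hIoo σ hσ).1.le, hσ.2.trans hs'b⟩, hSs'⟩ _ hpK (max_lt ?_ hdist)
    rw [Real.dist_eq, abs_of_nonneg (sub_nonneg.2 hσ.1)]
    linarith [hσ.2]
  · intro θ hθ i j
    rw [← hgxx_eq s (hIoo s hsIcc), ← hgxx_eq s (hIoo s hsIcc)]
    refine hu2 _ ⟨⟨hrs.le, hss'.trans hs'b⟩, ?_⟩ _ hpK (max_lt ?_ ?_) i j
    · exact (convex_closedBall _ _).add_smul_sub_mem hSs hSs' hθ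
    · simpa using hδ
    · rw [dist_eq_norm] at hdist
      simp only [dist_self_add_left, norm_smul, Real.norm_eq_abs, abs_of_nonneg hθ.1]
      exact (mul_le_of_le_one_left (norm_nonneg _) hθ.2).trans_lt hdist

open MeasureTheory in
/-- The pathwise Itô formula for a `C^{1,2}` function of time and a path with absolutely
continuous covariations, when the drift term vanishes. -/
lemma tendsto_sum_gradient {T : ℝ} (𝕋 : PartitionSeq T) {d : ℕ} {S : ℝ → Fin d → ℝ}
    (hS : ContinuousOn S (Set.Icc 0 T)) {α : Fin d → Fin d → ℝ → ℝ}
    (hα : ∀ i j, ContinuousOn (α i j) (Set.Icc 0 T))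
    (hcov : ∀ i j, ∀ t ∈ Set.Icc (0 : ℝ) T,
      Tendsto (fun n => covSum T 𝕋 S i j t n) atTop (𝓝 (∫ s in (0 : ℝ)..t, α i j s)))
    {r R τ : ℝ} (hr : 0 ≤ r) (hR : R ≤ T) (hrτ : r ≤ τ) (hτR : τ < R)
    {w : ℝ → (Fin d → ℝ) → ℝ} (hw : IsC12 (Set.Ico r R) Set.univ w)
    (hpde : ∀ s ∈ Set.Ioo r R, deriv (fun σ => w σ (S s)) s
      + (1 / 2) * ∑ i, ∑ j, α i j s * pd2 (w s) i j (S s) = 0) :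
    Tendsto (fun n => ∑ s ∈ (𝕋.part n).filter (fun s => r < s ∧ s ≤ τ),
      ∑ k, pd1 (w s) k (S s) * (S (succOf T (𝕋.part n) s) k - S s k)) atTop
      (𝓝 (w τ (S τ) - w r (S r))) := by
  obtain ⟨gt, _, gxx, hgt, -, hgxx, hext⟩ := hw.derivs_extend
  rw [interior_Ico] at hext
  have hgt_eq : ∀ s ∈ Set.Ioo r R, ∀ x, gt (s, x) = deriv (fun σ => w σ x) s :=
    fun s hs x => (hext s hs x (Set.mem_univ x)).1
  have hgxx_eq : ∀ s ∈ Set.Ioo r R, ∀ x i j, gxx i j (s, x) = pd2 (w s) i j x :=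
    fun s hs x => (hext s hs x (Set.mem_univ x)).2.2
  have hT : τ ≤ T := hτR.le.trans hR
  obtain ⟨b, hτb, hbR⟩ := exists_between hτR
  have hgraph : ∀ {c}, c < R → ∀ {g : ℝ × (Fin d → ℝ) → ℝ},
      ContinuousOn g (Set.Ico r R ×ˢ Set.univ) →
      ContinuousOn (fun s => g (s, S s)) (Set.Icc r c) := fun {c} hc {g} hg =>
    hg.comp (continuousOn_id.prodMk
        (hS.mono (Set.Icc_subset_Icc hr (hc.le.trans hR))))
      fun s hs => ⟨⟨hs.1, hs.2.trans_lt hc⟩, Set.mem_univ _⟩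
  have hαm : ∀ i j, ContinuousOn (α i j) (Set.Icc r τ) := fun i j =>
    (hα i j).mono (Set.Icc_subset_Icc hr hT)
  have hcov' : ∀ i j p q, r ≤ p → p ≤ q → q ≤ τ →
      Tendsto (fun n => ∑ s ∈ (𝕋.part n).filter (fun s => p < s ∧ s ≤ q),
        (S (succOf T (𝕋.part n) s) i - S s i) * (S (succOf T (𝕋.part n) s) j - S s j)) atTop
        (𝓝 (∫ s in p..q, α i j s)) := by
    intro i j p q hp hpq hq
    have hp0 := hr.trans hp
    have hii : ∀ c ∈ Set.Icc (0 : ℝ) T, IntervalIntegrable (α i j) volume 0 c := fun c hc =>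
      ((hα i j).mono (Set.Icc_subset_Icc le_rfl hc.2)).intervalIntegrable_of_Icc hc.1
    have hpm : p ∈ Set.Icc (0 : ℝ) T := ⟨hp0, (hpq.trans hq).trans hT⟩
    have hqm : q ∈ Set.Icc (0 : ℝ) T := ⟨hp0.trans hpq, hq.trans hT⟩
    rw [← intervalIntegral.integral_interval_sub_left (hii q hqm) (hii p hpm)]
    refine ((hcov i j q hqm).sub (hcov i j p hpm)).congr fun n => ?_
    rw [sum_filter_le_sub _ _ hpq]
    rfl
  -- the total quadratic variation is eventually bounded
  obtain ⟨C, hC⟩ : ∃ C, ∀ᶠ n in atTop,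
      ∑ s ∈ (𝕋.part n).filter (fun s => r < s ∧ s ≤ τ),
        ∑ i, (S (succOf T (𝕋.part n) s) i - S s i) ^ 2 ≤ C := by
    have := tendsto_finsetSum Finset.univ fun i _ => hcov' i i r τ le_rfl hrτ le_rfl
    refine ⟨(∑ i, ∫ s in r..τ, α i i s) + 1, ?_⟩
    filter_upwards [this.eventually (ge_mem_nhds (lt_add_one _))] with n hn
    rw [Finset.sum_comm] at hn
    simpa only [sq] using hn
  have hquad : ∀ i j, Tendsto (fun n => ∑ s ∈ (𝕋.part n).filter (fun s => r < s ∧ s ≤ τ),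
      gxx i j (s, S s) * ((S (succOf T (𝕋.part n) s) i - S s i)
        * (S (succOf T (𝕋.part n) s) j - S s j))) atTop
      (𝓝 (∫ s in r..τ, gxx i j (s, S s) * α i j s)) := fun i j => by
    refine tendsto_sum_filter_Ioc_mul (C := C) (c := fun n s =>
      (S (succOf T (𝕋.part n) s) i - S s i) * (S (succOf T (𝕋.part n) s) j - S s j))
      hrτ (hαm i j) (hgraph hτR (hgxx i j)) (hcov' i j) ?_
    filter_upwards [hC] with n hn
    refine (Finset.sum_le_sum fun s _ => ?_).trans hn
    set y := fun i => S (succOf T (𝕋.part n) s) i - S s i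
    have hi := Finset.single_le_sum (f := fun i => y i ^ 2) (fun i _ => sq_nonneg (y i))
      (Finset.mem_univ i)
    have hj := Finset.single_le_sum (f := fun i => y i ^ 2) (fun i _ => sq_nonneg (y i))
      (Finset.mem_univ j)
    change |y i * y j| ≤ ∑ i, y i ^ 2
    rw [abs_le]
    constructor <;> nlinarith [sq_nonneg (y i + y j), sq_nonneg (y i - y j)]
  have htime_sum : ∀ p q, r ≤ p → p ≤ q → q ≤ τ →
      Tendsto (fun n => ∑ s ∈ (𝕋.part n).filter (fun s => p < s ∧ s ≤ q),
        (succOf T (𝕋.part n) s - s)) atTop (𝓝 (q - p)) := by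
    intro p q hp hpq hq
    simp_rw [fun n => sum_succOf_sub T (𝕋.part n) (fun s => s) hpq]
    exact (𝕋.tendsto_succOf ((hr.trans hp).trans hpq) (hq.trans hT)).sub
      (𝕋.tendsto_succOf (hr.trans hp) ((hpq.trans hq).trans hT))
  have htime_le : ∀ n, ∑ s ∈ (𝕋.part n).filter (fun s => r < s ∧ s ≤ τ),
      (succOf T (𝕋.part n) s - s) ≤ T := fun n => by
    rw [sum_succOf_sub T (𝕋.part n) (fun s => s) hrτ]
    linarith [𝕋.succOf_le n τ, 𝕋.le_succOf n (hrτ.trans hT)]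
  have htime : Tendsto (fun n => ∑ s ∈ (𝕋.part n).filter (fun s => r < s ∧ s ≤ τ),
      gt (s, S s) * (succOf T (𝕋.part n) s - s)) atTop (𝓝 (∫ s in r..τ, gt (s, S s))) := by
    have := tendsto_sum_filter_Ioc_mul (P := 𝕋.part) (C := T) (α := fun _ => 1)
      (c := fun n s => succOf T (𝕋.part n) s - s) hrτ
      continuousOn_const (hgraph hτR hgt) (by simpa using htime_sum) ?_
    · simpa using this
    · refine Eventually.of_forall fun n => (Finset.sum_le_sum fun s hs => ?_).trans (htime_le n)
      have hs := (Finset.mem_filter.1 hs).2.2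
      rw [abs_of_nonneg (sub_nonneg.2 (𝕋.le_succOf n (hs.trans hT)))]
  have htel : Tendsto (fun n => ∑ s ∈ (𝕋.part n).filter (fun s => r < s ∧ s ≤ τ),
      (w (succOf T (𝕋.part n) s) (S (succOf T (𝕋.part n) s)) - w s (S s))) atTop
      (𝓝 (w τ (S τ) - w r (S r))) := by
    have hF := hgraph hbR hw.cont
    simp_rw [fun n => sum_succOf_sub T (𝕋.part n) (fun s => w s (S s)) hrτ]
    exact (𝕋.tendsto_comp_succOf (hr.trans hrτ) hτb (hbR.le.trans hR)
        (hF.mono (Set.Icc_subset_Icc hrτ le_rfl))).sub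
      (𝕋.tendsto_comp_succOf hr (hrτ.trans_lt hτb) (hbR.le.trans hR) hF)
  have hdrift : (∫ s in r..τ, gt (s, S s))
      + (1 / 2) * ∑ i, ∑ j, ∫ s in r..τ, gxx i j (s, S s) * α i j s = 0 := by
    have hii : ∀ i j, IntervalIntegrable (fun s => gxx i j (s, S s) * α i j s) volume r τ :=
      fun i j => ((hgraph hτR (hgxx i j)).mul (hαm i j)).intervalIntegrable_of_Icc hrτ
    have hii' : ∀ i, IntervalIntegrable (fun s => ∑ j, gxx i j (s, S s) * α i j s) volume r τ :=
      fun i => (continuousOn_finsetSum _ fun j _ =>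
        (hgraph hτR (hgxx i j)).mul (hαm i j)).intervalIntegrable_of_Icc hrτ
    have hii'' : IntervalIntegrable (fun s => ∑ i, ∑ j, gxx i j (s, S s) * α i j s) volume r τ :=
      (continuousOn_finsetSum _ fun i _ => continuousOn_finsetSum _ fun j _ =>
        (hgraph hτR (hgxx i j)).mul (hαm i j)).intervalIntegrable_of_Icc hrτ
    simp_rw [fun i => (intervalIntegral.integral_finsetSum (μ := volume)
      (s := (Finset.univ : Finset (Fin d))) fun j _ => hii i j).symm]
    rw [← intervalIntegral.integral_finsetSum fun i _ => hii' i,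
      ← intervalIntegral.integral_const_mul, ← intervalIntegral.integral_add
        ((hgraph hτR hgt).intervalIntegrable_of_Icc hrτ) (hii''.const_mul _)]
    refine intervalIntegral.integral_zero_ae (Eventually.of_forall fun s hs => ?_)
    rw [Set.uIoc_of_le hrτ] at hs
    have hs' : s ∈ Set.Ioo r R := ⟨hs.1, hs.2.trans_lt hτR⟩
    rw [hgt_eq s hs', ← hpde s hs']
    simp_rw [hgxx_eq s hs', mul_comm]
  have hrem : Tendsto (fun n => ∑ s ∈ (𝕋.part n).filter (fun s => r < s ∧ s ≤ τ),
      (w (succOf T (𝕋.part n) s) (S (succOf T (𝕋.part n) s)) - w s (S s)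
        - gt (s, S s) * (succOf T (𝕋.part n) s - s)
        - ∑ k, pd1 (w s) k (S s) * (S (succOf T (𝕋.part n) s) k - S s k)
        - (1 / 2) * ∑ i, ∑ j, gxx i j (s, S s) * ((S (succOf T (𝕋.part n) s) i - S s i)
          * (S (succOf T (𝕋.part n) s) j - S s j)))) atTop (𝓝 0) := by
    rw [Metric.tendsto_nhds]
    intro e he
    set D := T + d * |C|
    have hD : 0 ≤ D := add_nonneg ((hr.trans hrτ).trans hT) (by positivity)
    filter_upwards [hC, eventually_abs_remainder_le 𝕋 hS hr hR hτR hw hgt hgxx hgt_eq hgxx_eq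
      (show 0 < e / (D + 1) by positivity)] with n hCn hn
    rw [dist_zero_right, Real.norm_eq_abs]
    calc _ ≤ ∑ s ∈ (𝕋.part n).filter (fun s => r < s ∧ s ≤ τ), e / (D + 1) *
            ((succOf T (𝕋.part n) s - s)
              + d * ∑ i, (S (succOf T (𝕋.part n) s) i - S s i) ^ 2) :=
          (Finset.abs_sum_le_sum_abs _ _).trans (Finset.sum_le_sum fun s hs =>
            hn s (Finset.mem_filter.1 hs).2.1 (Finset.mem_filter.1 hs).2.2)
      _ ≤ e / (D + 1) * D := by
          rw [← Finset.mul_sum, Finset.sum_add_distrib, ← Finset.mul_sum]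
          refine mul_le_mul_of_nonneg_left (add_le_add (htime_le n) ?_) (by positivity)
          exact mul_le_mul_of_nonneg_left (hCn.trans (le_abs_self C)) (Nat.cast_nonneg d)
      _ < e := by
          rw [div_mul_eq_mul_div, div_lt_iff₀ (by positivity)]
          nlinarith
  have hquad_sum := tendsto_finsetSum Finset.univ fun i _ =>
    tendsto_finsetSum Finset.univ fun j _ => hquad i j
  have hlim := ((htel.sub htime).sub hrem).sub (hquad_sum.const_mul (1 / 2))
  have hval : w τ (S τ) - w r (S r) - (∫ s in r..τ, gt (s, S s)) - 0
      - (1 / 2) * ∑ i, ∑ j, ∫ s in r..τ, gxx i j (s, S s) * α i j s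
      = w τ (S τ) - w r (S r) := by linarith
  rw [hval] at hlim
  refine hlim.congr fun n => ?_
  simp_rw [Finset.sum_sub_distrib, ← Finset.mul_sum]
  have hcomm : ∑ i, ∑ j, ∑ s ∈ (𝕋.part n).filter (fun s => r < s ∧ s ≤ τ),
      gxx i j (s, S s) * ((S (succOf T (𝕋.part n) s) i - S s i)
        * (S (succOf T (𝕋.part n) s) j - S s j))
      = ∑ s ∈ (𝕋.part n).filter (fun s => r < s ∧ s ≤ τ), ∑ i, ∑ j,
      gxx i j (s, S s) * ((S (succOf T (𝕋.part n) s) i - S s i)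
        * (S (succOf T (𝕋.part n) s) j - S s j)) := by
    simp_rw [Finset.sum_comm (s := (𝕋.part n).filter (fun s => r < s ∧ s ≤ τ))]
  rw [hcomm]
  ring

/-- A single left endpoint does not contribute to a Föllmer integral. -/
lemma hasFollmerIntegral_of_tendsto_Ioc {T : ℝ} (𝕋 : PartitionSeq T) {d : ℕ}
    {ξ S : ℝ → Fin d → ℝ} (hS : ContinuousOn S (Set.Icc 0 T)) {r τ I : ℝ} (hr : 0 ≤ r)
    (hrT : r < T) (hrτ : r ≤ τ)
    (h : Tendsto (fun n => ∑ s ∈ (𝕋.part n).filter (fun s => r < s ∧ s ≤ τ),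
      ∑ k, ξ s k * (S (succOf T (𝕋.part n) s) k - S s k)) atTop (𝓝 I)) :
    HasFollmerIntegral T 𝕋 ξ S r τ I := by
  have hSr := 𝕋.tendsto_comp_succOf hr hrT le_rfl (hS.mono (Set.Icc_subset_Icc hr le_rfl))
  have hterm : Tendsto (fun n => ∑ k, ξ r k * (S (succOf T (𝕋.part n) r) k - S r k)) atTop
      (𝓝 0) := by
    have := tendsto_finsetSum Finset.univ fun k _ =>
      (((tendsto_pi_nhds.1 hSr k).sub_const (S r k)).const_mul (ξ r k))
    simpa using this
  have hterm' : Tendsto (fun n => if r ∈ 𝕋.part n then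
      ∑ k, ξ r k * (S (succOf T (𝕋.part n) r) k - S r k) else 0) atTop (𝓝 0) := by
    refine squeeze_zero_norm (fun n => ?_) (by simpa using hterm.norm)
    split_ifs
    · exact le_rfl
    · simp
  have := hterm'.add h
  rw [zero_add] at this
  refine this.congr fun n => ?_
  split_ifs with hmem
  · rw [show (𝕋.part n).filter (fun s => r ≤ s ∧ s ≤ τ)
        = insert r ((𝕋.part n).filter (fun s => r < s ∧ s ≤ τ)) from ?_,
      Finset.sum_insert (by simp)]
    ext s
    simp only [Finset.mem_filter, Finset.mem_insert]
    constructor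
    · rintro ⟨hs, h1, h2⟩
      exact h1.eq_or_lt.imp Eq.symm fun h1 => ⟨hs, h1, h2⟩
    · rintro (rfl | ⟨hs, h1, h2⟩)
      · exact ⟨hmem, le_rfl, hrτ⟩
      · exact ⟨hs, h1.le, h2⟩
  · rw [zero_add]
    refine Finset.sum_congr (Finset.filter_congr fun s hs => ?_) fun _ _ => rfl
    have hne : r ≠ s := fun h => hmem (h ▸ hs)
    rw [hne.le_iff_lt]

/-- Corollary 2.7: strictly pathwise Delta hedging of the exotic option
`H = h(S(t₀),…,S(t_N))` via the recursive scheme of terminal-value problems. -/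
theorem stmt10 (T : ℝ) (hT : 0 < T) (𝕋 : PartitionSeq T) (d N : ℕ) (hN : 0 < N)
    (a : ℝ → (Fin d → ℝ) → Fin d → Fin d → ℝ)
    (ha_cont : ∀ i j, ContinuousOn (fun p : ℝ × (Fin d → ℝ) => a p.1 p.2 i j)
      (Set.Icc 0 T ×ˢ (Set.univ : Set (Fin d → ℝ))))
    (ha_symm : ∀ t ∈ Set.Icc (0 : ℝ) T, ∀ x : Fin d → ℝ, ∀ i j, a t x i j = a t x j i)
    (ha_pd : ∀ t ∈ Set.Icc (0 : ℝ) T, ∀ x : Fin d → ℝ, ∀ y : Fin d → ℝ, y ≠ 0 →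
      0 < ∑ i, ∑ j, a t x i j * y i * y j)
    (t : ℕ → ℝ) (ht0 : t 0 = 0) (htN : t N = T) (htm : ∀ k < N, t k < t (k + 1))
    (h : (Fin (N + 1) → Fin d → ℝ) → ℝ)
    (v : ℕ → ℝ → (ℕ → Fin d → ℝ) → (Fin d → ℝ) → ℝ)
    -- the recursive scheme of Theorem 2.6 holds for the functions `v_k`
    (hvN : ∀ τ : ℝ, ∀ xs : ℕ → Fin d → ℝ, ∀ x : Fin d → ℝ,
      v N τ xs x = h fun i : Fin (N + 1) => xs i)
    (hscheme : ∀ k < N, ∀ xs : ℕ → Fin d → ℝ,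
      ContinuousOn (fun pr : ℝ × (Fin d → ℝ) => v k pr.1 xs pr.2)
        (Set.Icc (t k) (t (k + 1)) ×ˢ (Set.univ : Set (Fin d → ℝ))) ∧
      IsC12 (Set.Ico (t k) (t (k + 1))) (Set.univ : Set (Fin d → ℝ))
        (fun τ x => v k τ xs x) ∧
      (∀ τ ∈ Set.Ico (t k) (t (k + 1)), ∀ x : Fin d → ℝ,
        tderiv (Set.Icc (t k) (t (k + 1))) (fun σ y => v k σ xs y) τ x
          + (1 / 2) * ∑ i, ∑ j, a τ x i j * pd2 (fun y => v k τ xs y) i j x = 0) ∧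
      (∀ x : Fin d → ℝ,
        v k (t (k + 1)) xs x = v (k + 1) (t (k + 1)) (Function.update xs (k + 1) x) x))
    (S : ℝ → Fin d → ℝ) (hS : S ∈ SclassA T 𝕋 a)
    -- the Delta hedging strategy
    (ξ : ℝ → Fin d → ℝ)
    (hξ : ∀ k < N, ∀ s ∈ Set.Ico (t k) (t (k + 1)), ∀ i : Fin d,
      ξ s i = pd1 (fun y => v k s (fun l => S (t l)) y) i (S s)) :
    -- on each interval `[t_k, t_{k+1})` the Föllmer integral exists and `v_k(·,S(·))` is the
    -- value of the corresponding self-financing strategy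
    (∀ k < N, ∀ τ ∈ Set.Ico (t k) (t (k + 1)),
      HasFollmerIntegral T 𝕋 ξ S (t k) τ
        (v k τ (fun l => S (t l)) (S τ) - v k (t k) (fun l => S (t l)) (S (t k)))) ∧
    -- the integral over `[t_k, t_{k+1}]` exists as a left limit
    (∀ k < N,
      Tendsto (fun τ => v k τ (fun l => S (t l)) (S τ)
          - v k (t k) (fun l => S (t l)) (S (t k)))
        (𝓝[<] t (k + 1))
        (𝓝 (v k (t (k + 1)) (fun l => S (t l)) (S (t (k + 1)))
          - v k (t k) (fun l => S (t l)) (S (t k))))) ∧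
    -- concatenating the pieces replicates the exotic payoff
    (v 0 (t 0) (fun l => S (t l)) (S (t 0))
        + ∑ k ∈ Finset.range N,
          (v k (t (k + 1)) (fun l => S (t l)) (S (t (k + 1)))
            - v k (t k) (fun l => S (t l)) (S (t k)))
      = h fun i : Fin (N + 1) => S (t i)) ∧
    Tendsto (fun τ => v (N - 1) τ (fun l => S (t l)) (S τ)) (𝓝[<] T)
      (𝓝 (h fun i : Fin (N + 1) => S (t i))) := by
  have hmono : ∀ m ≤ N, ∀ k ≤ m, t k ≤ t m := by
    intro m
    induction m with
    | zero => intro _ k hk; rw [Nat.le_zero.1 hk]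
    | succ m ih =>
      intro hm k hk
      rcases hk.eq_or_lt with rfl | hk
      · exact le_rfl
      · exact (ih (by omega) k (by omega)).trans (htm m (by omega)).le
  have ht_nonneg : ∀ k ≤ N, 0 ≤ t k := fun k hk => ht0 ▸ hmono k hk 0 k.zero_le
  have ht_le : ∀ k ≤ N, t k ≤ T := fun k hk => htN ▸ hmono N le_rfl k hk
  obtain ⟨hScont, hcov⟩ := hS
  have hα : ∀ i j, ContinuousOn (fun s => a s (S s) i j) (Set.Icc 0 T) := fun i j =>
    (ha_cont i j).comp (continuousOn_id.prodMk hScont) fun s hs => ⟨hs, Set.mem_univ _⟩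
  have hleft : ∀ k < N, Tendsto (fun τ => v k τ (fun l => S (t l)) (S τ)) (𝓝[<] t (k + 1))
      (𝓝 (v k (t (k + 1)) (fun l => S (t l)) (S (t (k + 1))))) := by
    intro k hk
    have hc : ContinuousOn (fun τ => v k τ (fun l => S (t l)) (S τ))
        (Set.Icc (t k) (t (k + 1))) :=
      (hscheme k hk fun l => S (t l)).1.comp (continuousOn_id.prodMk (hScont.mono
        (Set.Icc_subset_Icc (ht_nonneg k hk.le) (ht_le (k + 1) hk))))
        fun s hs => ⟨hs, Set.mem_univ _⟩
    refine (hc _ (Set.right_mem_Icc.2 (htm k hk).le)).tendsto.mono_left ?_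
    rw [← nhdsWithin_Ico_eq_nhdsLT (htm k hk)]
    exact nhdsWithin_mono _ Set.Ico_subset_Icc_self
  have hnext : ∀ k < N, v k (t (k + 1)) (fun l => S (t l)) (S (t (k + 1)))
      = v (k + 1) (t (k + 1)) (fun l => S (t l)) (S (t (k + 1))) := by
    intro k hk
    rw [(hscheme k hk fun l => S (t l)).2.2.2, Function.update_eq_self_iff.2 rfl]
  refine ⟨fun k hk τ hτ => ?_, fun k hk => (hleft k hk).sub_const _, ?_, ?_⟩
  · obtain ⟨-, hC12, hpde, -⟩ := hscheme k hk fun l => S (t l)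
    have hT' := ht_le (k + 1) hk
    have hk0 := ht_nonneg k hk.le
    refine hasFollmerIntegral_of_tendsto_Ioc 𝕋 hScont hk0
      ((htm k hk).trans_le hT') hτ.1 ?_
    refine (tendsto_sum_gradient 𝕋 hScont hα hcov hk0 hT' hτ.1 hτ.2 hC12
      fun s hs => ?_).congr fun n => Finset.sum_congr rfl fun s hs => ?_
    · rw [← hpde s ⟨hs.1.le, hs.2⟩ (S s), tderiv,
        derivWithin_of_mem_nhds (Icc_mem_nhds hs.1 hs.2)]
    · have hs := (Finset.mem_filter.1 hs).2
      refine Finset.sum_congr rfl fun i _ => ?_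
      rw [hξ k hk s ⟨hs.1.le, hs.2.trans_lt hτ.2⟩ i]
  · rw [Finset.sum_congr rfl fun k hk => by rw [hnext k (Finset.mem_range.1 hk)],
      Finset.sum_range_sub (fun k => v k (t k) (fun l => S (t l)) (S (t k))), hvN]
    ring
  · obtain ⟨m, rfl⟩ : ∃ m, N = m + 1 := ⟨N - 1, by omega⟩
    have := hleft m m.lt_succ_self
    rw [hnext m m.lt_succ_self, hvN, htN] at this
    exact this
end
end

section
/- Suppose a(t,x)=(a_ij(t,x)) is continuous, bounded, and symmetric positive definite for all (t,x)∈[0,T̃]×ℝ^d with T̃>T, and let 0<t_1<⋯<t_N≤T. Then for every x∈ℝ^d, the set {(S(t_1),…,S(t_N)) : S∈𝒮_a, S(0)=x} is dense in (ℝ^d)^N. -/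
open Finset Filter Topology Set

noncomputable section

/-! ### Step paths and their jump covariations -/

/-- The step path with jump `γ u` at time `u`, started at the origin. -/
def stepPath {d : ℕ} (γ : ℝ →₀ (Fin d → ℝ)) (t : ℝ) : Fin d → ℝ :=
  γ.sum fun u v => if u ≤ t then v else 0

/-- The covariation of the jumps of `stepPath γ` up to time `t`. -/
def jumpCov {d : ℕ} (γ : ℝ →₀ (Fin d → ℝ)) (i j : Fin d) (t : ℝ) : ℝ :=
  γ.sum fun u v => if u ≤ t then v i * v j else 0

/-- Move the part `A` of the jump at time `p` to time `u`. -/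
def splitJump {d : ℕ} (γ : ℝ →₀ (Fin d → ℝ)) (u p : ℝ) (A : Fin d → ℝ) : ℝ →₀ (Fin d → ℝ) :=
  γ + Finsupp.single u A - Finsupp.single p A

/-- All jumps of `stepPath γ` occur at positive times in `P`. -/
def JumpsIn {d : ℕ} (P : Finset ℝ) (γ : ℝ →₀ (Fin d → ℝ)) : Prop :=
  ∀ u, γ u ≠ 0 → u ∈ P ∧ 0 < u

lemma stepPath_splitJump {d : ℕ} (γ : ℝ →₀ (Fin d → ℝ)) (u p : ℝ) (A : Fin d → ℝ) (t : ℝ) :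
    stepPath (splitJump γ u p A) t =
      stepPath γ t + (if u ≤ t then A else 0) - (if p ≤ t then A else 0) := by
  unfold stepPath splitJump
  rw [Finsupp.sum_sub_index, Finsupp.sum_add_index', Finsupp.sum_single_index,
    Finsupp.sum_single_index]
  · simp
  · simp
  · simp
  · intro a b c; split_ifs <;> simp
  · intro a b c; split_ifs <;> simp

lemma splitJump_apply_of_ne {d : ℕ} (γ : ℝ →₀ (Fin d → ℝ)) {u p v : ℝ} (A : Fin d → ℝ)
    (hu : v ≠ u) (hp : v ≠ p) : splitJump γ u p A v = γ v := by
  simp [splitJump, hu.symm, hp.symm]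

lemma splitJump_apply_left {d : ℕ} (γ : ℝ →₀ (Fin d → ℝ)) {u p : ℝ} (A : Fin d → ℝ)
    (hup : u ≠ p) : splitJump γ u p A u = γ u + A := by
  simp [splitJump, hup.symm]

lemma splitJump_apply_right {d : ℕ} (γ : ℝ →₀ (Fin d → ℝ)) {u p : ℝ} (A : Fin d → ℝ)
    (hup : u ≠ p) : splitJump γ u p A p = γ p - A := by
  simp [splitJump, hup]

lemma jumpCov_eq_sum {d : ℕ} (γ : ℝ →₀ (Fin d → ℝ)) {P : Finset ℝ} (h : γ.support ⊆ P)
    (i j : Fin d) (t : ℝ) :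
    jumpCov γ i j t = ∑ u ∈ P, if u ≤ t then γ u i * γ u j else 0 :=
  Finsupp.sum_of_support_subset _ h _ (by simp)

lemma stepPath_eq_sum {d : ℕ} (γ : ℝ →₀ (Fin d → ℝ)) {P : Finset ℝ} (h : γ.support ⊆ P)
    (t : ℝ) : stepPath γ t = ∑ u ∈ P, if u ≤ t then γ u else 0 :=
  Finsupp.sum_of_support_subset _ h _ (by simp)

lemma jumpCov_splitJump {d : ℕ} (γ : ℝ →₀ (Fin d → ℝ)) {u p : ℝ} (A : Fin d → ℝ)
    (hup : u ≠ p) (hu : γ u = 0) (i j : Fin d) (t : ℝ) :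
    jumpCov (splitJump γ u p A) i j t = jumpCov γ i j t + (if u ≤ t then A i * A j else 0) +
      (if p ≤ t then (γ p - A) i * (γ p - A) j - γ p i * γ p j else 0) := by
  classical
  set P : Finset ℝ := insert u (insert p γ.support) with hP
  have h1 : γ.support ⊆ P := fun v hv => by simp only [hP, Finset.mem_insert]; tauto
  have h2 : (splitJump γ u p A).support ⊆ P := by
    intro v hv
    by_cases hvu : v = u
    · simp [hP, hvu]
    by_cases hvp : v = p
    · simp [hP, hvp]
    rw [Finsupp.mem_support_iff, splitJump_apply_of_ne γ A hvu hvp] at hv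
    exact h1 (Finsupp.mem_support_iff.2 hv)
  have h3 : (if u ≤ t then A i * A j else 0) =
      ∑ v ∈ P, if v = u then (if v ≤ t then A i * A j else 0) else 0 := by
    rw [Finset.sum_ite_eq' P u]; simp [hP]
  have h4 : (if p ≤ t then (γ p - A) i * (γ p - A) j - γ p i * γ p j else 0) =
      ∑ v ∈ P, if v = p then
        (if v ≤ t then (γ p - A) i * (γ p - A) j - γ p i * γ p j else 0) else 0 := by
    rw [Finset.sum_ite_eq' P p]; simp [hP]
  rw [jumpCov_eq_sum _ h2, jumpCov_eq_sum _ h1, h3, h4, ← Finset.sum_add_distrib,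
    ← Finset.sum_add_distrib]
  refine Finset.sum_congr rfl fun v _ => ?_
  by_cases hvu : v = u
  · subst hvu
    rw [splitJump_apply_left γ A hup]
    simp [hup, hu]
  by_cases hvp : v = p
  · subst hvp
    rw [splitJump_apply_right γ A hup]
    by_cases hvt : v ≤ t <;> simp [hvu, hvt]
  · rw [splitJump_apply_of_ne γ A hvu hvp]
    simp [hvu, hvp]

lemma stepPath_sub {d : ℕ} (γ : ℝ →₀ (Fin d → ℝ)) {s t : ℝ} (hst : s ≤ t) :
    stepPath γ t - stepPath γ s = ∑ u ∈ γ.support.filter (fun u => s < u ∧ u ≤ t), γ u := by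
  rw [stepPath_eq_sum γ Finset.Subset.rfl, stepPath_eq_sum γ Finset.Subset.rfl, ← Finset.sum_sub_distrib,
    Finset.sum_filter]
  refine Finset.sum_congr rfl fun u _ => ?_
  by_cases h1 : u ≤ s
  · simp [h1, h1.trans hst, not_lt.2 h1]
  · simp [h1, not_le.1 h1]

lemma stepPath_congr {d : ℕ} (γ : ℝ →₀ (Fin d → ℝ)) {s t : ℝ} (hst : s ≤ t)
    (h : ∀ u, s < u → u ≤ t → γ u = 0) : stepPath γ t = stepPath γ s := by
  rw [← sub_eq_zero, stepPath_sub γ hst]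
  refine Finset.sum_eq_zero fun u hu => ?_
  rw [Finset.mem_filter] at hu
  exact h u hu.2.1 hu.2.2

lemma stepPath_jump {d : ℕ} (γ : ℝ →₀ (Fin d → ℝ)) {s t : ℝ} (hst : s < t)
    (h : ∀ u, s < u → u < t → γ u = 0) : stepPath γ t - stepPath γ s = γ t := by
  classical
  rw [stepPath_sub γ hst.le]
  rw [Finset.sum_eq_single t]
  · intro u hu hut
    rw [Finset.mem_filter] at hu
    exact h u hu.2.1 (lt_of_le_of_ne hu.2.2 hut)
  · intro ht
    by_contra hne
    exact ht (by simp [hst, hne])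

lemma jumpCov_sub {d : ℕ} (γ : ℝ →₀ (Fin d → ℝ)) (i j : Fin d) {s t : ℝ} (hst : s ≤ t) :
    jumpCov γ i j t - jumpCov γ i j s =
      ∑ u ∈ γ.support.filter (fun u => s < u ∧ u ≤ t), γ u i * γ u j := by
  rw [jumpCov_eq_sum γ Finset.Subset.rfl, jumpCov_eq_sum γ Finset.Subset.rfl, ← Finset.sum_sub_distrib,
    Finset.sum_filter]
  refine Finset.sum_congr rfl fun u _ => ?_
  by_cases h1 : u ≤ s
  · simp [h1, h1.trans hst, not_lt.2 h1]
  · simp [h1, not_le.1 h1]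

lemma jumpCov_congr {d : ℕ} (γ : ℝ →₀ (Fin d → ℝ)) (i j : Fin d) {s t : ℝ} (hst : s ≤ t)
    (h : ∀ u, s < u → u ≤ t → γ u = 0) : jumpCov γ i j t = jumpCov γ i j s := by
  rw [← sub_eq_zero, jumpCov_sub γ i j hst]
  refine Finset.sum_eq_zero fun u hu => ?_
  rw [Finset.mem_filter] at hu
  simp [h u hu.2.1 hu.2.2]

lemma jumpCov_jump {d : ℕ} (γ : ℝ →₀ (Fin d → ℝ)) (i j : Fin d) {s t : ℝ} (hst : s < t)
    (h : ∀ u, s < u → u < t → γ u = 0) :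
    jumpCov γ i j t - jumpCov γ i j s = γ t i * γ t j := by
  classical
  rw [jumpCov_sub γ i j hst.le]
  rw [Finset.sum_eq_single t]
  · intro u hu hut
    rw [Finset.mem_filter] at hu
    simp [h u hu.2.1 (lt_of_le_of_ne hu.2.2 hut)]
  · intro ht
    by_contra hne
    exact ht (by
      simp only [Finset.mem_filter, Finsupp.mem_support_iff, hst, le_refl, and_true]
      rintro h0
      simp [h0] at hne)

/-! ### Neighbours in a partition -/

lemma succOf_spec {T : ℝ} {P : Finset ℝ} (hT : T ∈ P) {s : ℝ} (hs : s < T) :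
    succOf T P s ∈ P ∧ s < succOf T P s ∧ ∀ u ∈ P, s < u → succOf T P s ≤ u := by
  have h : (P.filter (fun u => s < u)).Nonempty := ⟨T, by simp [hT, hs]⟩
  have hm := Finset.min'_mem _ h
  rw [Finset.mem_filter] at hm
  simp only [succOf, h, dif_pos]
  exact ⟨hm.1, hm.2, fun u hu hsu => Finset.min'_le _ _ (by simp [hu, hsu])⟩

lemma succOf_top {T : ℝ} {P : Finset ℝ} (hP : ↑P ⊆ Set.Icc (0 : ℝ) T) : succOf T P T = T := by
  have h : ¬ (P.filter (fun u => T < u)).Nonempty := by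
    rintro ⟨u, hu⟩
    rw [Finset.mem_filter] at hu
    exact absurd (hP hu.1).2 (not_le.2 hu.2)
  simp [succOf, h]

lemma exists_pred {P : Finset ℝ} {p q₀ : ℝ} (hq₀ : q₀ ∈ P) (h : q₀ < p) :
    ∃ q ∈ P, q < p ∧ q₀ ≤ q ∧ ∀ u ∈ P, q < u → ¬ u < p := by
  have hne : (P.filter (fun u => u < p)).Nonempty := ⟨q₀, by simp [hq₀, h]⟩
  have hm := Finset.max'_mem _ hne
  rw [Finset.mem_filter] at hm
  refine ⟨_, hm.1, hm.2, Finset.le_max' _ _ (by simp [hq₀, h]), fun u hu hlt hup => ?_⟩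
  exact absurd (Finset.le_max' _ u (by simp [hu, hup])) (not_le.2 hlt)

lemma PartitionSeq.mono {T : ℝ} (𝕋 : PartitionSeq T) {m n : ℕ} (h : m ≤ n) :
    𝕋.part m ⊆ 𝕋.part n :=
  monotone_nat_of_le_succ (f := 𝕋.part) 𝕋.refining h

lemma PartitionSeq.exists_mem_Ioo {T : ℝ} (𝕋 : PartitionSeq T) {m : ℕ} {q p : ℝ}
    (hq : q ∈ 𝕋.part m) (hqp : q < p) (hp : p ∈ 𝕋.part m) :
    ∃ n ≥ m, ∃ u ∈ 𝕋.part n, q < u ∧ u < p := by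
  obtain ⟨n, hn⟩ := 𝕋.mesh_to_zero (p - q) (sub_pos.2 hqp)
  have h := hn (max m n) (le_max_right _ _) q (𝕋.mono (le_max_left _ _) hq)
  have hs := succOf_spec (𝕋.top_mem (max m n)) (hqp.trans_le (𝕋.subset_Icc m hp).2)
  exact ⟨_, le_max_left _ _, _, hs.1, hs.2.1, by linarith⟩

/-- The approximating sums of a step path agree with the covariation of its jumps up to one
jump. -/
lemma abs_covSum_sub_jumpCov_le {T : ℝ} (𝕋 : PartitionSeq T) {d : ℕ} {k : ℕ}
    {S : ℝ → Fin d → ℝ} (x : Fin d → ℝ) {γ : ℝ →₀ (Fin d → ℝ)} (hγ : JumpsIn (𝕋.part k) γ)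
    (hS : ∀ s ∈ 𝕋.part k, S s = x + stepPath γ s) {η : ℝ} (hη : ∀ u, ‖γ u‖ ≤ η)
    (i j : Fin d) (t : ℝ) :
    |covSum T 𝕋 S i j t k - jumpCov γ i j t| ≤ η ^ 2 := by
  classical
  set P := 𝕋.part k with hP
  have hη0 : 0 ≤ η := (norm_nonneg _).trans (hη 0)
  have hsp : ∀ s ∈ P, s < T → succOf T P s ∈ P ∧ s < succOf T P s ∧
      ∀ u ∈ P, s < u → succOf T P s ≤ u := fun s _ h => succOf_spec (𝕋.top_mem k) h
  have hle : ∀ s ∈ P, s ≤ T := fun s hs => (𝕋.subset_Icc k hs).2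
  have hterm : ∀ s ∈ P, s < T → S (succOf T P s) - S s = γ (succOf T P s) := by
    intro s hs hsT
    obtain ⟨h1, h2, h3⟩ := hsp s hs hsT
    rw [hS _ h1, hS _ hs, add_sub_add_left_eq_sub]
    refine stepPath_jump γ h2 fun u hu1 hu2 => ?_
    by_contra hne
    exact absurd (h3 u (hγ u hne).1 hu1) (not_le.2 hu2)
  have e1 : covSum T 𝕋 S i j t k =
      ∑ s ∈ P.filter (fun s => s ≤ t ∧ s < T), γ (succOf T P s) i * γ (succOf T P s) j := by
    unfold covSum
    rw [← hP, Finset.sum_filter, Finset.sum_filter]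
    refine Finset.sum_congr rfl fun s hs => ?_
    by_cases hst : s ≤ t
    · by_cases hsT : s < T
      · rw [if_pos hst, if_pos ⟨hst, hsT⟩, ← hterm s hs hsT]; rfl
      · have : s = T := le_antisymm (hle s hs) (not_lt.1 hsT)
        have hfix : succOf T P s = s := by rw [this, succOf_top (𝕋.subset_Icc k)]
        simp [hfix, hsT]
    · simp [hst]
  have e2 : jumpCov γ i j t =
      ∑ s ∈ (P.filter (fun s => s ≤ t ∧ s < T)).filter (fun s => succOf T P s ≤ t),
        γ (succOf T P s) i * γ (succOf T P s) j := by
    have hsub : γ.support ⊆ P := fun u hu => (hγ u (Finsupp.mem_support_iff.1 hu)).1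
    rw [jumpCov_eq_sum γ hsub, ← Finset.sum_filter]
    symm
    have : ∑ v ∈ P.filter (fun v => v ≤ t), γ v i * γ v j =
        ∑ v ∈ P.filter (fun v => v ≤ t ∧ 0 < v), γ v i * γ v j := by
      symm
      refine Finset.sum_subset (fun v => by simp +contextual) fun v hv hv' => ?_
      have : γ v = 0 := by
        by_contra hne
        have := hγ v hne
        simp_all
      simp [this]
    rw [this]
    refine Finset.sum_bij (fun s _ => succOf T P s) ?_ ?_ ?_ ?_
    · intro s hs
      simp only [Finset.mem_filter] at hs ⊢
      obtain ⟨h1, h2, h3⟩ := hsp s hs.1.1 hs.1.2.2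
      exact ⟨h1, hs.2, (𝕋.subset_Icc k hs.1.1).1.trans_lt h2⟩
    · intro s hs s' hs' h
      simp only [Finset.mem_filter] at hs hs'
      obtain ⟨h1, h2, h3⟩ := hsp s hs.1.1 hs.1.2.2
      obtain ⟨h1', h2', h3'⟩ := hsp s' hs'.1.1 hs'.1.2.2
      rcases lt_trichotomy s s' with hlt | heq | hlt
      · have := h3 s' hs'.1.1 hlt
        linarith
      · exact heq
      · have := h3' s hs.1.1 hlt
        linarith
    · intro v hv
      simp only [Finset.mem_filter] at hv
      obtain ⟨q, hq, hqv, -, hq'⟩ := exists_pred (𝕋.zero_mem k) hv.2.2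
      have hqT : q < T := hqv.trans_le (hle v hv.1)
      obtain ⟨h1, h2, h3⟩ := hsp q hq hqT
      have hqe : succOf T P q = v :=
        le_antisymm (h3 v hv.1 hqv) (not_lt.1 (hq' _ h1 h2))
      refine ⟨q, ?_, hqe⟩
      simp only [Finset.mem_filter]
      exact ⟨⟨hq, hqv.le.trans hv.2.1, hqT⟩, hqe.trans_le hv.2.1⟩
    · intro s hs; rfl
  rw [e1, e2, ← Finset.sum_filter_add_sum_filter_not (P.filter (fun s => s ≤ t ∧ s < T))
    (fun s => succOf T P s ≤ t), add_sub_cancel_left]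
  set W := (P.filter (fun s => s ≤ t ∧ s < T)).filter (fun s => ¬ succOf T P s ≤ t) with hW
  have hcard : W.card ≤ 1 := by
    rw [Finset.card_le_one]
    intro s hs s' hs'
    simp only [hW, Finset.mem_filter] at hs hs'
    obtain ⟨h1, h2, h3⟩ := hsp s hs.1.1 hs.1.2.2
    obtain ⟨h1', h2', h3'⟩ := hsp s' hs'.1.1 hs'.1.2.2
    rcases lt_trichotomy s s' with hlt | heq | hlt
    · have := h3 s' hs'.1.1 hlt
      linarith
    · exact heq
    · have := h3' s hs.1.1 hlt
      linarith
  refine (Finset.abs_sum_le_sum_abs _ _).trans ((Finset.sum_le_card_nsmul W _ (η ^ 2) ?_).trans ?_)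
  · intro s _
    rw [abs_mul, sq]
    exact mul_le_mul ((norm_le_pi_norm (γ (succOf T P s)) i).trans (hη _))
      ((norm_le_pi_norm (γ (succOf T P s)) j).trans (hη _)) (abs_nonneg _) hη0
  · rw [nsmul_eq_mul]
    have : (W.card : ℝ) ≤ 1 := by exact_mod_cast hcard
    nlinarith [sq_nonneg η]

/-! ### Refining step paths along the partitions -/

/-- The step path `β'` refines `β`: it agrees with `β` along the `m`-th partition, and along the
partitions with index between `m` and `m'` it agrees with step paths satisfying `R`. -/
structure Refines {T : ℝ} (𝕋 : PartitionSeq T) {d : ℕ} (R : (ℝ →₀ (Fin d → ℝ)) → Prop)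
    (m : ℕ) (β : ℝ →₀ (Fin d → ℝ)) (m' : ℕ) (β' : ℝ →₀ (Fin d → ℝ)) : Prop where
  le : m ≤ m'
  eq : ∀ s ∈ 𝕋.part m, stepPath β' s = stepPath β s
  jumpsIn : JumpsIn (𝕋.part m') β'
  mid : ∀ k, m ≤ k → k ≤ m' → ∃ γ, R γ ∧ JumpsIn (𝕋.part k) γ ∧
    ∀ s ∈ 𝕋.part k, stepPath γ s = stepPath β' s

lemma JumpsIn.mono {d : ℕ} {P P' : Finset ℝ} {γ : ℝ →₀ (Fin d → ℝ)} (h : JumpsIn P γ)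
    (hP : P ⊆ P') : JumpsIn P' γ :=
  fun u hu => ⟨hP (h u hu).1, (h u hu).2⟩

lemma Refines.trans {T : ℝ} {𝕋 : PartitionSeq T} {d : ℕ} {R : (ℝ →₀ (Fin d → ℝ)) → Prop}
    {m m' m'' : ℕ} {β β' β'' : ℝ →₀ (Fin d → ℝ)} (h : Refines 𝕋 R m β m' β')
    (h' : Refines 𝕋 R m' β' m'' β'') : Refines 𝕋 R m β m'' β'' where
  le := h.le.trans h'.le
  eq s hs := (h'.eq s (𝕋.mono h.le hs)).trans (h.eq s hs)
  jumpsIn := h'.jumpsIn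
  mid k hk hk' := by
    rcases le_total k m' with hkm | hkm
    · obtain ⟨γ, h1, h2, h3⟩ := h.mid k hk hkm
      exact ⟨γ, h1, h2, fun s hs => (h3 s hs).trans (h'.eq s (𝕋.mono hkm hs)).symm⟩
    · exact h'.mid k hkm hk'

lemma Refines.imp {T : ℝ} {𝕋 : PartitionSeq T} {d : ℕ} {R R' : (ℝ →₀ (Fin d → ℝ)) → Prop}
    {m m' : ℕ} {β β' : ℝ →₀ (Fin d → ℝ)} (h : Refines 𝕋 R m β m' β') (hR : ∀ γ, R γ → R' γ) :
    Refines 𝕋 R' m β m' β' where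
  le := h.le
  eq := h.eq
  jumpsIn := h.jumpsIn
  mid k hk hk' := by
    obtain ⟨γ, h1, h2⟩ := h.mid k hk hk'
    exact ⟨γ, hR γ h1, h2⟩

lemma Refines.of_le {T : ℝ} {𝕋 : PartitionSeq T} {d : ℕ} {R : (ℝ →₀ (Fin d → ℝ)) → Prop}
    {m m' : ℕ} {β : ℝ →₀ (Fin d → ℝ)} (hβ : JumpsIn (𝕋.part m) β) (hm : m ≤ m') (hR : R β) :
    Refines 𝕋 R m β m' β where
  le := hm
  eq _ _ := rfl
  jumpsIn := hβ.mono (𝕋.mono hm)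
  mid _ hk _ := ⟨β, hR, hβ.mono (𝕋.mono hk), fun _ _ => rfl⟩

/-- A jump at `p` can be split once the partitions become fine enough just before `p`. -/
lemma exists_refines_splitJump {T : ℝ} (𝕋 : PartitionSeq T) {d : ℕ} {m : ℕ}
    {β : ℝ →₀ (Fin d → ℝ)} (hβ : JumpsIn (𝕋.part m) β) {q p : ℝ} (hq : q ∈ 𝕋.part m)
    (hp : p ∈ 𝕋.part m) (hqp : q < p) (hno : ∀ u ∈ 𝕋.part m, q < u → ¬ u < p)
    (A : Fin d → ℝ) {R : (ℝ →₀ (Fin d → ℝ)) → Prop} (hR : R β)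
    (hR' : ∀ u, q < u → u < p → R (splitJump β u p A)) :
    ∃ m' u, u ∈ 𝕋.part m' ∧ q < u ∧ u < p ∧ (∀ v ∈ 𝕋.part m', u < v → ¬ v < p) ∧
      Refines 𝕋 R m β m' (splitJump β u p A) := by
  classical
  have hex : ∃ n, ∃ u ∈ 𝕋.part n, q < u ∧ u < p := by
    obtain ⟨n, -, h⟩ := 𝕋.exists_mem_Ioo hq hqp hp
    exact ⟨n, h⟩
  set m' := Nat.find hex with hm'
  obtain ⟨u₀, hu₀, hqu₀, hu₀p⟩ := Nat.find_spec hex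
  obtain ⟨u, hu, hup, huu, hno'⟩ := exists_pred hu₀ hu₀p
  have hqu : q < u := hqu₀.trans_le huu
  have hmm' : m ≤ m' := by
    by_contra hlt
    exact hno u₀ (𝕋.mono (not_le.1 hlt).le hu₀) hqu₀ hu₀p
  have hq0 : 0 ≤ q := (𝕋.subset_Icc m hq).1
  have hagree : ∀ k < m', ∀ s ∈ 𝕋.part k, stepPath β s = stepPath (splitJump β u p A) s := by
    intro k hk s hs
    have hks := Nat.find_min hex hk
    rw [stepPath_splitJump]
    by_cases hps : p ≤ s
    · simp [hps, hup.le.trans hps]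
    · by_cases hus : u ≤ s
      · exact absurd ⟨s, hs, hqu.trans_le hus, not_le.1 hps⟩ hks
      · simp [hps, hus]
  have hmlt : m < m' := by
    refine lt_of_le_of_ne hmm' fun h => hno u₀ ?_ hqu₀ hu₀p
    rw [h]; exact hu₀
  have hjumps : JumpsIn (𝕋.part m') (splitJump β u p A) := by
    intro v hv
    by_cases hvu : v = u
    · subst hvu; exact ⟨hu, hq0.trans_lt hqu⟩
    by_cases hvp : v = p
    · subst hvp; exact ⟨𝕋.mono hmm' hp, hq0.trans_lt hqp⟩
    rw [splitJump_apply_of_ne β A hvu hvp] at hv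
    exact hβ.mono (𝕋.mono hmm') v hv
  refine ⟨m', u, hu, hqu, hup, hno', hmm', fun s hs => (hagree m hmlt s hs).symm, hjumps, ?_⟩
  intro k hk hk'
  rcases hk'.lt_or_eq with hlt | heq
  · exact ⟨β, hR, hβ.mono (𝕋.mono hk), hagree k hlt⟩
  · rw [heq]
    exact ⟨_, hR' u hqu hup, hjumps, fun _ _ => rfl⟩

/-- `γ` arises from `β` by splitting off the list `B` of jumps from the jump at `p`, putting them
between `q` and `q'`, in this order. -/
structure LocalSplit {d : ℕ} (β γ : ℝ →₀ (Fin d → ℝ)) (q q' p : ℝ) (B : List (Fin d → ℝ)) :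
    Prop where
  apply_off : ∀ u, u ≤ q ∨ p < u → γ u = β u
  apply_right : γ p = β p - B.sum
  apply_mid : ∀ u, q < u → u < p → γ u = 0 ∨ γ u ∈ B
  path_of_le : ∀ t ≤ q, stepPath γ t = stepPath β t
  path_of_ge : ∀ t, p ≤ t → stepPath γ t = stepPath β t
  path_tail : ∀ t, q' ≤ t → t < p → stepPath γ t = stepPath β t + B.sum
  path_mid : ∀ t, q ≤ t → t < p → ∃ B₁, B₁ <+: B ∧ stepPath γ t = stepPath β t + B₁.sum
  cov_of_le : ∀ t ≤ q, ∀ i j, jumpCov γ i j t = jumpCov β i j t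
  cov_of_ge : ∀ t, p ≤ t → ∀ i j, jumpCov γ i j t =
    jumpCov β i j t + (B.map fun b => b i * b j).sum + γ p i * γ p j - β p i * β p j
  cov_tail : ∀ t, q' ≤ t → t < p → ∀ i j, jumpCov γ i j t =
    jumpCov β i j t + (B.map fun b => b i * b j).sum
  cov_mid : ∀ t, q ≤ t → t < p → ∃ B₁, B₁ <+: B ∧ ∀ i j, jumpCov γ i j t =
    jumpCov β i j t + (B₁.map fun b => b i * b j).sum

lemma LocalSplit.refl {d : ℕ} (β : ℝ →₀ (Fin d → ℝ)) {q p : ℝ}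
    (h : ∀ u, q < u → u < p → β u = 0) : LocalSplit β β q q p [] where
  apply_off _ _ := rfl
  apply_right := by simp
  apply_mid u h1 h2 := Or.inl (h u h1 h2)
  path_of_le _ _ := rfl
  path_of_ge _ _ := rfl
  path_tail := by simp
  path_mid t _ _ := ⟨[], by simp⟩
  cov_of_le _ _ _ _ := rfl
  cov_of_ge := by simp
  cov_tail := by simp
  cov_mid t _ _ := ⟨[], by simp⟩

lemma LocalSplit.splitJump {d : ℕ} {β γ : ℝ →₀ (Fin d → ℝ)} {q q' p u : ℝ}
    {B : List (Fin d → ℝ)} (h : LocalSplit β γ q q' p B) (hq : q ≤ q') (hu : q' < u) (hup : u < p)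
    (h0 : γ u = 0) (A : Fin d → ℝ) :
    LocalSplit β (splitJump γ u p A) q u p (B ++ [A]) where
  apply_off v hv := by
    have h1 : v ≠ u := by
      rcases hv with hv | hv
      · exact (hv.trans_lt (hq.trans_lt hu)).ne
      · exact (hup.trans hv).ne'
    have h2 : v ≠ p := by
      rcases hv with hv | hv
      · exact (hv.trans_lt (hq.trans_lt (hu.trans hup))).ne
      · exact hv.ne'
    rw [splitJump_apply_of_ne γ A h1 h2, h.apply_off v hv]
  apply_right := by
    rw [splitJump_apply_right γ A hup.ne, h.apply_right, List.sum_append, List.sum_singleton,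
      sub_sub]
  apply_mid v h1 h2 := by
    by_cases hvu : v = u
    · subst hvu
      rw [splitJump_apply_left γ A hup.ne, h0, zero_add]
      simp
    · rw [splitJump_apply_of_ne γ A hvu h2.ne]
      exact (h.apply_mid v h1 h2).imp_right fun h => List.mem_append_left _ h
  path_of_le t ht := by
    have h1 : t < u := ht.trans_lt (hq.trans_lt hu)
    rw [stepPath_splitJump, if_neg (not_le.2 h1), if_neg (not_le.2 (h1.trans hup)),
      h.path_of_le t ht]
    simp
  path_of_ge t ht := by
    rw [stepPath_splitJump, if_pos ht, if_pos (hup.le.trans ht), h.path_of_ge t ht]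
    simp
  path_tail t ht htp := by
    rw [stepPath_splitJump, if_pos ht, if_neg (not_le.2 htp), h.path_tail t (hu.le.trans ht) htp]
    simp [add_assoc]
  path_mid t ht htp := by
    rw [stepPath_splitJump, if_neg (not_le.2 htp)]
    by_cases hut : u ≤ t
    · refine ⟨_, List.prefix_refl _, ?_⟩
      rw [if_pos hut, h.path_tail t (hu.le.trans hut) htp]
      simp [add_assoc]
    · obtain ⟨B₁, hB₁, e⟩ := h.path_mid t ht htp
      exact ⟨B₁, hB₁.trans (List.prefix_append _ _), by rw [if_neg hut, e]; simp⟩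
  cov_of_le t ht i j := by
    have h1 : t < u := ht.trans_lt (hq.trans_lt hu)
    rw [jumpCov_splitJump γ A hup.ne h0, if_neg (not_le.2 h1), if_neg (not_le.2 (h1.trans hup)),
      h.cov_of_le t ht]
    simp
  cov_of_ge t ht i j := by
    rw [jumpCov_splitJump γ A hup.ne h0, if_pos (hup.le.trans ht), if_pos ht, h.cov_of_ge t ht,
      splitJump_apply_right γ A hup.ne]
    simp
    ring
  cov_tail t ht htp i j := by
    rw [jumpCov_splitJump γ A hup.ne h0, if_pos ht, if_neg (not_le.2 htp),
      h.cov_tail t (hu.le.trans ht) htp]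
    simp [add_assoc]
  cov_mid t ht htp := by
    by_cases hut : u ≤ t
    · refine ⟨_, List.prefix_refl _, fun i j => ?_⟩
      rw [jumpCov_splitJump γ A hup.ne h0, if_neg (not_le.2 htp), if_pos hut,
        h.cov_tail t (hu.le.trans hut) htp]
      simp [add_assoc]
    · obtain ⟨B₁, hB₁, e⟩ := h.cov_mid t ht htp
      refine ⟨B₁, hB₁.trans (List.prefix_append _ _), fun i j => ?_⟩
      rw [jumpCov_splitJump γ A hup.ne h0, if_neg (not_le.2 htp), if_neg hut, e]
      simp

/-- A jump can be split into any list of jumps, one after the other. -/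
lemma exists_localSplit {T : ℝ} (𝕋 : PartitionSeq T) {d : ℕ} {m : ℕ}
    {β : ℝ →₀ (Fin d → ℝ)} (hβ : JumpsIn (𝕋.part m) β) {q p : ℝ} (hq : q ∈ 𝕋.part m)
    (hp : p ∈ 𝕋.part m) (hqp : q < p) (hno : ∀ u ∈ 𝕋.part m, q < u → ¬ u < p)
    (B : List (Fin d → ℝ)) :
    ∃ m' q' γ, q' ∈ 𝕋.part m' ∧ q ≤ q' ∧ q' < p ∧ (∀ u ∈ 𝕋.part m', q' < u → ¬ u < p) ∧
      LocalSplit β γ q q' p B ∧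
      Refines 𝕋 (fun δ => ∃ B₁, B₁ <+: B ∧ ∃ q₁, LocalSplit β δ q q₁ p B₁) m β m' γ := by
  have hzero : ∀ {k : ℕ} {δ : ℝ →₀ (Fin d → ℝ)} {v : ℝ}, JumpsIn (𝕋.part k) δ →
      (∀ u ∈ 𝕋.part k, v < u → ¬ u < p) → ∀ u, v < u → u < p → δ u = 0 := by
    intro k δ v hδ hv u hvu hup
    by_contra hne
    exact hv u (hδ u hne).1 hvu hup
  induction B using List.reverseRecOn with
  | nil =>
    have hr := LocalSplit.refl β (hzero hβ hno)
    exact ⟨m, q, β, hq, le_rfl, hqp, hno, hr,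
      Refines.of_le hβ le_rfl ⟨[], List.prefix_refl _, q, hr⟩⟩
  | append_singleton B A ih =>
    obtain ⟨m₁, q₁, γ, h1, h2, h3, h4, h5, h6⟩ := ih
    obtain ⟨m', u, g1, g2, g3, g4, g5⟩ := exists_refines_splitJump 𝕋 h6.jumpsIn h1
      (𝕋.mono h6.le hp) h3 h4 A
      (R := fun δ => ∃ B₁, B₁ <+: (B ++ [A]) ∧ ∃ q₁, LocalSplit β δ q q₁ p B₁)
      ⟨B, List.prefix_append _ _, q₁, h5⟩
      (fun u hu hup => ⟨_, List.prefix_refl _, u,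
        h5.splitJump h2 hu hup (hzero h6.jumpsIn h4 u hu hup) A⟩)
    refine ⟨m', u, _, g1, (h2.trans_lt g2).le, g3, g4,
      h5.splitJump h2 g2 g3 (hzero h6.jumpsIn h4 u g2 g3) A, Refines.trans (h6.imp ?_) g5⟩
    rintro δ ⟨B₁, hB₁, h⟩
    exact ⟨B₁, hB₁.trans (List.prefix_append _ _), h⟩

/-! ### Lists of small jumps with prescribed covariation -/

lemma isPrefix_append_cases {α : Type*} {l l₁ l₂ : List α} (h : l <+: l₁ ++ l₂) :
    l <+: l₁ ∨ ∃ l', l = l₁ ++ l' ∧ l' <+: l₂ := by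
  obtain ⟨r, hr⟩ := h
  rcases List.append_eq_append_iff.1 hr with ⟨l', rfl, -⟩ | ⟨l', rfl, rfl⟩
  · exact Or.inl (List.prefix_append _ _)
  · exact Or.inr ⟨l', rfl, List.prefix_append _ _⟩

/-- `τ` is the covariation of a list of jumps of size at most `δ` whose partial sums stay within
distance `δ` of the origin, where they also end. -/
def IsLoopCov {d : ℕ} (δ : ℝ) (τ : Fin d → Fin d → ℝ) : Prop :=
  ∃ B : List (Fin d → ℝ), (∀ b ∈ B, ‖b‖ ≤ δ) ∧ B.sum = 0 ∧
    (∀ B₁, B₁ <+: B → ‖B₁.sum‖ ≤ δ) ∧ ∀ i j, (B.map fun b => b i * b j).sum = τ i j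

lemma IsLoopCov.zero {d : ℕ} {δ : ℝ} (hδ : 0 ≤ δ) :
    IsLoopCov δ (0 : Fin d → Fin d → ℝ) :=
  ⟨[], by simp, by simp, by simp [hδ], by simp⟩

lemma IsLoopCov.add {d : ℕ} {δ : ℝ} {τ τ' : Fin d → Fin d → ℝ} (h : IsLoopCov δ τ)
    (h' : IsLoopCov δ τ') : IsLoopCov δ (τ + τ') := by
  obtain ⟨B, h1, h2, h3, h4⟩ := h
  obtain ⟨B', h1', h2', h3', h4'⟩ := h'
  refine ⟨B ++ B', ?_, by simp [h2, h2'], ?_, by simp [h4, h4']⟩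
  · intro b hb
    rcases List.mem_append.1 hb with hb | hb
    · exact h1 b hb
    · exact h1' b hb
  · intro B₁ hB₁
    rcases isPrefix_append_cases hB₁ with h | ⟨B₂, rfl, h⟩
    · exact h3 _ h
    · simpa [h2] using h3' _ h

lemma IsLoopCov.nsmul {d : ℕ} {δ : ℝ} (hδ : 0 ≤ δ) {τ : Fin d → Fin d → ℝ} (h : IsLoopCov δ τ)
    (n : ℕ) : IsLoopCov δ (n • τ) := by
  induction n with
  | zero => simpa using IsLoopCov.zero hδ
  | succ n ih => rw [succ_nsmul]; exact ih.add h

lemma isLoopCov_pair {d : ℕ} {δ : ℝ} {g : Fin d → ℝ} (hg : ‖g‖ ≤ δ) :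
    IsLoopCov δ (fun i j => 2 * (g i * g j)) := by
  have hδ : 0 ≤ δ := (norm_nonneg _).trans hg
  refine ⟨[g, -g], by simp [hg], by simp, ?_, ?_⟩
  · intro B₁ hB₁
    rcases List.prefix_cons_iff.1 hB₁ with rfl | ⟨t, rfl, ht⟩
    · simpa using hδ
    rcases List.prefix_cons_iff.1 ht with rfl | ⟨t', rfl, ht'⟩
    · simpa using hg
    · obtain rfl := List.prefix_nil.1 ht'
      simpa using hδ
  · intro i j
    simp
    ring

lemma isLoopCov_rankOne {d : ℕ} {δ : ℝ} (hδ : 0 < δ) (g : Fin d → ℝ) :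
    IsLoopCov δ (fun i j => g i * g j) := by
  obtain ⟨K, hK⟩ := exists_nat_gt ((‖g‖ / δ) ^ 2)
  have hK0 : (0 : ℝ) < K := (sq_nonneg _).trans_lt hK
  set c : ℝ := 1 / √(2 * K) with hc
  have hs : 0 < √(2 * K : ℝ) := Real.sqrt_pos.2 (by positivity)
  have hc0 : 0 ≤ c := by positivity
  have hcg : ‖c • g‖ ≤ δ := by
    rw [norm_smul, Real.norm_of_nonneg hc0, hc, one_div, inv_mul_le_iff₀ hs, mul_comm]
    rw [← div_le_iff₀' hδ]
    refine Real.le_sqrt_of_sq_le ?_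
    linarith
  have h := (isLoopCov_pair hcg).nsmul hδ.le K
  convert h using 1
  ext i j
  have hcc : c * c = 1 / (2 * K) := by
    rw [hc, div_mul_div_comm, Real.mul_self_sqrt (by positivity), one_mul]
  simp only [Pi.smul_apply, smul_eq_mul, nsmul_eq_mul]
  have : (K : ℝ) * (2 * (c * g i * (c * g j))) = K * 2 * (c * c) * (g i * g j) := by ring
  rw [this, hcc]
  field_simp

open scoped MatrixOrder Matrix.Norms.L2Operator in
lemma isLoopCov_of_posSemidef {d : ℕ} {δ : ℝ} (hδ : 0 < δ) {τ : Matrix (Fin d) (Fin d) ℝ}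
    (hτ : τ.PosSemidef) : IsLoopCov δ (fun i j => τ i j) := by
  obtain ⟨M, rfl⟩ := CStarAlgebra.nonneg_iff_eq_star_mul_self.mp hτ.nonneg
  have h : IsLoopCov δ (∑ l, fun i j => M l i * M l j) :=
    Finset.sum_induction _ _ (fun _ _ => IsLoopCov.add) (IsLoopCov.zero hδ.le)
      fun l _ => isLoopCov_rankOne hδ (M l)
  convert h using 1
  ext i j
  simp [Matrix.mul_apply, Finset.sum_apply, Matrix.star_apply]

/-- Any jump `C` can be split into small jumps with covariation close to a given positive
semidefinite matrix. -/
lemma exists_list_cov_near {d : ℕ} {δ e : ℝ} (hδ : 0 < δ) (he : 0 < e) (C : Fin d → ℝ)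
    {τ : Matrix (Fin d) (Fin d) ℝ} (hτ : τ.PosSemidef) :
    ∃ B : List (Fin d → ℝ), (∀ b ∈ B, ‖b‖ ≤ δ) ∧ ‖C - B.sum‖ ≤ δ ∧
      (∀ B₁, B₁ <+: B → ‖B₁.sum‖ ≤ ‖C‖ + δ) ∧
      ∀ i j, |(B.map fun b => b i * b j).sum + (C - B.sum) i * (C - B.sum) j - τ i j| ≤ e := by
  obtain ⟨B, h1, h2, h3, h4⟩ := isLoopCov_of_posSemidef hδ hτ
  obtain ⟨k, hk⟩ := exists_nat_gt (max (‖C‖ / δ) (‖C‖ ^ 2 / e))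
  have hk1 := (le_max_left _ _).trans_lt hk
  have hk2 := (le_max_right _ _).trans_lt hk
  rw [div_lt_iff₀ hδ] at hk1
  rw [div_lt_iff₀ he] at hk2
  set c : ℝ := 1 / (k + 1) with hc
  have hk0 : (0 : ℝ) < k + 1 := by positivity
  have hck : (k + 1) * c = 1 := by rw [hc]; field_simp
  have hc0 : 0 < c := by positivity
  have hcC : ‖c • C‖ ≤ δ := by
    rw [norm_smul, Real.norm_of_nonneg hc0.le, hc, one_div, inv_mul_le_iff₀ hk0]
    linarith
  have hsum : (List.replicate k (c • C) ++ B).sum = (k * c) • C := by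
    rw [List.sum_append, List.sum_replicate, h2, add_zero, ← Nat.cast_smul_eq_nsmul ℝ, smul_smul]
  have hrem : C - (List.replicate k (c • C) ++ B).sum = c • C := by
    rw [hsum, sub_eq_iff_eq_add, ← add_smul]
    rw [show c + k * c = 1 by linarith, one_smul]
  refine ⟨List.replicate k (c • C) ++ B, ?_, by rw [hrem]; exact hcC, ?_, ?_⟩
  · intro b hb
    rcases List.mem_append.1 hb with hb | hb
    · rw [List.eq_of_mem_replicate hb]; exact hcC
    · exact h1 b hb
  · have hle : ∀ n ≤ k, ‖(n • (c • C))‖ ≤ ‖C‖ := by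
      intro n hn
      rw [← Nat.cast_smul_eq_nsmul ℝ, smul_smul, norm_smul, Real.norm_of_nonneg (by positivity)]
      have : (n : ℝ) ≤ k := by exact_mod_cast hn
      exact mul_le_of_le_one_left (norm_nonneg _) (by nlinarith)
    intro B₁ hB₁
    rcases isPrefix_append_cases hB₁ with h | ⟨B₂, rfl, h⟩
    · obtain ⟨hlen, he⟩ := List.prefix_replicate_iff.1 h
      rw [he, List.sum_replicate]
      linarith [hle _ hlen]
    · rw [List.sum_append, List.sum_replicate]
      exact (norm_add_le _ _).trans (add_le_add (hle k le_rfl) (h3 _ h))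
  · intro i j
    rw [hrem, List.map_append, List.sum_append, h4, List.map_replicate, List.sum_replicate]
    have : k • ((c • C) i * (c • C) j) + τ i j + (c • C) i * (c • C) j - τ i j =
        c * (C i * C j) := by
      simp only [Pi.smul_apply, smul_eq_mul, nsmul_eq_mul]
      linear_combination (c * C i * C j) * hck
    rw [this, abs_mul, abs_mul, abs_of_pos hc0, hc, one_div, inv_mul_le_iff₀ hk0]
    have hi : |C i| ≤ ‖C‖ := norm_le_pi_norm C i
    have hj : |C j| ≤ ‖C‖ := norm_le_pi_norm C j
    have := mul_le_mul hi hj (abs_nonneg _) (norm_nonneg _)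
    nlinarith

/-! ### Adjusting the jump covariation -/

lemma jumpCov_sub_congr {d : ℕ} {γ β : ℝ →₀ (Fin d → ℝ)} (i j : Fin d) {s t : ℝ} (hst : s ≤ t)
    (h : ∀ u, s < u → γ u = β u) :
    jumpCov γ i j t - jumpCov γ i j s = jumpCov β i j t - jumpCov β i j s := by
  classical
  have key : ∀ δ : ℝ →₀ (Fin d → ℝ), δ.support ⊆ γ.support ∪ β.support →
      jumpCov δ i j t - jumpCov δ i j s =
        ∑ u ∈ γ.support ∪ β.support, if s < u ∧ u ≤ t then δ u i * δ u j else 0 := by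
    intro δ hδ
    rw [jumpCov_eq_sum δ hδ, jumpCov_eq_sum δ hδ, ← Finset.sum_sub_distrib]
    refine Finset.sum_congr rfl fun u _ => ?_
    by_cases h1 : u ≤ s
    · simp [h1, h1.trans hst, not_lt.2 h1]
    · simp [h1, not_le.1 h1]
  rw [key γ Finset.subset_union_left, key β Finset.subset_union_right]
  refine Finset.sum_congr rfl fun u _ => ?_
  by_cases hu : s < u
  · rw [h u hu]
  · simp [hu]

lemma jumpCov_zero {d : ℕ} {P : Finset ℝ} {γ : ℝ →₀ (Fin d → ℝ)} (hγ : JumpsIn P γ)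
    (i j : Fin d) : jumpCov γ i j 0 = 0 := by
  rw [jumpCov_eq_sum γ Finset.Subset.rfl]
  refine Finset.sum_eq_zero fun u hu => ?_
  rw [if_neg (not_le.2 (hγ u (Finsupp.mem_support_iff.1 hu)).2)]

lemma JumpsIn.apply_eq_zero {d : ℕ} {P : Finset ℝ} {γ : ℝ →₀ (Fin d → ℝ)} (hγ : JumpsIn P γ)
    {u : ℝ} (hu : u ≤ 0) : γ u = 0 := by
  by_contra hne
  exact absurd (hγ u hne).2 (not_lt.2 hu)

lemma abs_sum_mul_initial_le {d : ℕ} {B B₁ : List (Fin d → ℝ)} (h : B₁ <+: B) {c : ℝ}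
    (hc : ∀ i, (B.map fun b => b i * b i).sum ≤ c) (i j : Fin d) :
    |(B₁.map fun b => b i * b j).sum| ≤ c := by
  have h1 : ∀ i, (B₁.map fun b => b i * b i).sum ≤ c := by
    intro i
    refine le_trans ?_ (hc i)
    obtain ⟨B₂, rfl⟩ := h
    rw [List.map_append, List.sum_append]
    refine le_add_of_nonneg_right (List.sum_nonneg ?_)
    intro y hy
    obtain ⟨b, -, rfl⟩ := List.mem_map.1 hy
    exact mul_self_nonneg _
  have h2 : ∀ L : List (Fin d → ℝ), 2 * |(L.map fun b => b i * b j).sum| ≤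
      (L.map fun b => b i * b i).sum + (L.map fun b => b j * b j).sum := by
    intro L
    induction L with
    | nil => simp
    | cons b L ih =>
      simp only [List.map_cons, List.sum_cons]
      have h3 := abs_add_le (b i * b j) (L.map fun b => b i * b j).sum
      have h4 : 2 * |b i * b j| ≤ b i * b i + b j * b j := by
        rw [abs_mul]
        nlinarith [sq_nonneg (|b i| - |b j|), abs_mul_abs_self (b i), abs_mul_abs_self (b j)]
      linarith
  linarith [h2 B₁, h1 i, h1 j]

/-- The step path `γ` has jumps of size at most `η'`, and the covariation of its jumps is, up to
`κ`, a concatenation of `G` and of the covariation of the jumps of `β`. -/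
def IsIntermediate {d : ℕ} (T : ℝ) (G : ℝ → Fin d → Fin d → ℝ) (β : ℝ →₀ (Fin d → ℝ))
    (η' κ : ℝ) (γ : ℝ →₀ (Fin d → ℝ)) : Prop :=
  (∀ u, ‖γ u‖ ≤ η') ∧ ∀ t ∈ Set.Icc 0 T, ∀ i j, ∃ r ∈ Set.Icc 0 T,
    |jumpCov γ i j t - jumpCov β i j t - (G r i j - jumpCov β i j r)| ≤ κ

/-- The jumps of `β` up to time `p` have been replaced by jumps of size at most `δ`, so that their
covariation is close to `G`. -/
structure AdjustedUpTo {d : ℕ} (T : ℝ) (G : ℝ → Fin d → Fin d → ℝ) (β γ : ℝ →₀ (Fin d → ℝ))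
    (η δ p : ℝ) : Prop where
  apply_off : ∀ u, p < u → γ u = β u
  path_of_ge : ∀ t, p ≤ t → stepPath γ t = stepPath β t
  cov_near : ∀ t, 0 ≤ t → t ≤ p → ∀ i j, |jumpCov γ i j t - G t i j| ≤ δ
  cov_near_right : ∀ i j, |jumpCov γ i j p - G p i j| ≤ δ / 4 * (p / T)
  small : ∀ u ≤ p, ‖γ u‖ ≤ δ
  path_near : ∀ t, ‖stepPath γ t - stepPath β t‖ ≤ η + δ

lemma AdjustedUpTo.exists_next {T : ℝ} (hT : 0 < T) (𝕋 : PartitionSeq T) {d : ℕ}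
    {G : ℝ → Fin d → Fin d → ℝ}
    (hGpos : ∀ q ∈ Set.Icc 0 T, ∀ p ∈ Set.Icc 0 T, q ≤ p →
      (Matrix.of fun i j => G p i j - G q i j).PosSemidef)
    {n m : ℕ} {β γ : ℝ →₀ (Fin d → ℝ)} {η δ : ℝ} (hδ : 0 < δ) (hη : ∀ u, ‖β u‖ ≤ η)
    (hβ : JumpsIn (𝕋.part n) β) {q₀ p : ℝ} (hq₀ : q₀ ∈ 𝕋.part n) (hp : p ∈ 𝕋.part n)
    (hq₀p : q₀ < p) (hno : ∀ u ∈ 𝕋.part n, q₀ < u → ¬ u < p)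
    (hG : ∀ t, q₀ ≤ t → t ≤ p → ∀ i j, |G t i j - G q₀ i j| ≤ δ / 4)
    (hnm : n ≤ m) (hγ : JumpsIn (𝕋.part m) γ) (h : AdjustedUpTo T G β γ η δ q₀) :
    ∃ m' γ', Refines 𝕋 (IsIntermediate T G β (2 * η + δ) (δ + (2 * η + δ) ^ 2 + η ^ 2))
      m γ m' γ' ∧ AdjustedUpTo T G β γ' η δ p := by
  have hη0 : 0 ≤ η := (norm_nonneg _).trans (hη 0)
  have hq₀I := 𝕋.subset_Icc n hq₀
  have hpI := 𝕋.subset_Icc n hp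
  obtain ⟨q, hq, hqp, hq₀q, hnoq⟩ := exists_pred (𝕋.mono hnm hq₀) hq₀p
  have hγ0 : ∀ u, q₀ < u → u < p → γ u = 0 := by
    intro u h1 h2
    rw [h.apply_off u h1]
    by_contra hne
    exact hno u (hβ u hne).1 h1 h2
  have hγp : γ p = β p := h.apply_off p hq₀p
  have hqT : q₀ / T ≤ 1 := (div_le_one hT).2 hq₀I.2
  have hpT : p / T ≤ 1 := (div_le_one hT).2 hpI.2
  set e : ℝ := δ / 4 * ((p - q₀) / T) with he
  have he0 : 0 < e := mul_pos (by positivity) (div_pos (sub_pos.2 hq₀p) hT)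
  have hed : e ≤ δ / 4 := by
    refine mul_le_of_le_one_right (by positivity) ((div_le_one hT).2 ?_)
    linarith [hq₀I.1, hpI.2]
  have hmid : ∀ t, q₀ ≤ t → t < p → ∀ i j, jumpCov γ i j t = jumpCov γ i j q₀ :=
    fun t h1 h2 i j => jumpCov_congr γ i j h1 fun u h3 h4 => hγ0 u h3 (h4.trans_lt h2)
  have hnear : ∀ i j, |jumpCov γ i j q₀ - G q₀ i j| ≤ δ / 4 := fun i j =>
    (h.cov_near_right i j).trans (mul_le_of_le_one_right (by positivity) hqT)
  have hmidG : ∀ t, q₀ ≤ t → t < p → ∀ i j, |jumpCov γ i j t - G t i j| ≤ δ / 2 := by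
    intro t h1 h2 i j
    rw [hmid t h1 h2]
    have e1 := hnear i j
    have e2 := hG t h1 h2.le i j
    rw [abs_le] at e1 e2 ⊢
    constructor <;> linarith
  obtain ⟨B, hB1, hB2, hB3, hB4⟩ := exists_list_cov_near hδ he0 (γ p)
    (hGpos q₀ hq₀I p hpI hq₀p.le)
  simp only [Matrix.of_apply] at hB4
  have hBc : ∀ i, (B.map fun b => b i * b i).sum ≤ δ / 2 := by
    intro i
    have e1 := (abs_le.1 (hB4 i i)).2
    have e2 := (abs_le.1 (hG p hq₀p.le le_rfl i i)).2
    nlinarith [mul_self_nonneg ((γ p - B.sum) i)]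
  have hpre : ∀ B₁, B₁ <+: B → ∀ i j, |(B₁.map fun b => b i * b j).sum| ≤ δ / 2 :=
    fun B₁ h₁ i j => abs_sum_mul_initial_le h₁ hBc i j
  obtain ⟨m', q', γ', -, -, -, -, hsplit, href⟩ :=
    exists_localSplit 𝕋 hγ hq (𝕋.mono hnm hp) hqp hnoq B
  have hlt : ∀ {δ' : ℝ →₀ (Fin d → ℝ)} {q₁ : ℝ} {B₁ : List (Fin d → ℝ)}, B₁ <+: B →
      LocalSplit γ δ' q q₁ p B₁ → ∀ t, 0 ≤ t → t < p → ∀ i j,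
        |jumpCov δ' i j t - G t i j| ≤ δ := by
    intro δ' q₁ B₁ hB₁ hs t ht0 htp i j
    rcases le_total t q with htq | hqt
    · rw [hs.cov_of_le t htq]
      rcases le_total t q₀ with h1 | h1
      · exact h.cov_near t ht0 h1 i j
      · linarith [hmidG t h1 htp i j]
    · obtain ⟨B₂, hB₂, e1⟩ := hs.cov_mid t hqt htp
      rw [e1]
      have e2 := hpre B₂ (hB₂.trans hB₁) i j
      have e3 := hmidG t (hq₀q.trans hqt) htp i j
      rw [abs_le] at e2 e3 ⊢
      constructor <;> linarith
  refine ⟨m', γ', href.imp ?_, ?_⟩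
  · rintro δ' ⟨B₁, hB₁, q₁, hs⟩
    have hδp : ‖δ' p‖ ≤ 2 * η + δ := by
      rw [hs.apply_right]
      have e1 := norm_sub_le (γ p) B₁.sum
      have e2 := hB3 B₁ hB₁
      have e3 := hη p
      rw [hγp] at e1 e2 ⊢
      linarith
    refine ⟨fun u => ?_, fun t ht i j => ?_⟩
    · by_cases hoff : u ≤ q ∨ p < u
      · rw [hs.apply_off u hoff]
        rcases le_or_gt u q₀ with h1 | h1
        · linarith [h.small u h1]
        · rw [h.apply_off u h1]
          linarith [hη u]
      · rw [not_or, not_le, not_lt] at hoff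
        rcases hoff.2.lt_or_eq with h1 | h1
        · rcases hs.apply_mid u hoff.1 h1 with h2 | h2
          · rw [h2, norm_zero]; positivity
          · linarith [hB1 _ (hB₁.subset h2)]
        · rw [h1]; exact hδp
    · rcases lt_or_ge t p with htp | hpt
      · refine ⟨t, ht, ?_⟩
        have := hlt hB₁ hs t ht.1 htp i j
        rw [show jumpCov δ' i j t - jumpCov β i j t - (G t i j - jumpCov β i j t) =
          jumpCov δ' i j t - G t i j by ring]
        nlinarith [sq_nonneg (2 * η + δ), sq_nonneg η]
      · refine ⟨q₀, hq₀I, ?_⟩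
        have e1 := hs.cov_of_ge t hpt i j
        have e2 := jumpCov_sub_congr (γ := γ) (β := β) i j (hq₀p.le.trans hpt)
          h.apply_off
        have e3 := hpre B₁ hB₁ i j
        have e4 := hnear i j
        have e5 : |δ' p i * δ' p j| ≤ (2 * η + δ) ^ 2 := by
          rw [abs_mul, sq]
          exact mul_le_mul ((norm_le_pi_norm (δ' p) i).trans hδp)
            ((norm_le_pi_norm (δ' p) j).trans hδp) (abs_nonneg _) (by positivity)
        have e6 : |γ p i * γ p j| ≤ η ^ 2 := by
          rw [hγp, abs_mul, sq]
          exact mul_le_mul ((norm_le_pi_norm (β p) i).trans (hη p))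
            ((norm_le_pi_norm (β p) j).trans (hη p)) (abs_nonneg _) hη0
        rw [abs_le] at e3 e4 e5 e6 ⊢
        constructor <;> linarith
  · have hright : ∀ i j, |jumpCov γ' i j p - G p i j| ≤ δ / 4 * (p / T) := by
      intro i j
      have e1 := hsplit.cov_of_ge p le_rfl i j
      have e2 := jumpCov_jump γ i j hq₀p hγ0
      have e3 := hB4 i j
      rw [← hsplit.apply_right] at e3
      have e4 := h.cov_near_right i j
      have e5 : δ / 4 * (p / T) = δ / 4 * (q₀ / T) + e := by rw [he]; ring
      rw [e5]
      rw [abs_le] at e3 e4 ⊢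
      constructor <;> linarith
    refine ⟨fun u hu => ?_, fun t ht => ?_, fun t ht0 htp i j => ?_, hright, fun u hu => ?_,
      fun t => ?_⟩
    · rw [hsplit.apply_off u (Or.inr hu), h.apply_off u (hq₀p.trans hu)]
    · rw [hsplit.path_of_ge t ht, h.path_of_ge t (hq₀p.le.trans ht)]
    · rcases htp.lt_or_eq with h1 | h1
      · exact hlt (List.prefix_refl _) hsplit t ht0 h1 i j
      · rw [h1]
        have := mul_le_of_le_one_right (show 0 ≤ δ / 4 by positivity) hpT
        linarith [hright i j]
    · rcases le_or_gt u q with huq | hqu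
      · rw [hsplit.apply_off u (Or.inl huq)]
        rcases le_or_gt u q₀ with h1 | h1
        · exact h.small u h1
        · rw [hγ0 u h1 (huq.trans_lt hqp), norm_zero]; exact hδ.le
      · rcases hu.lt_or_eq with h1 | h1
        · rcases hsplit.apply_mid u hqu h1 with h2 | h2
          · rw [h2, norm_zero]; exact hδ.le
          · exact hB1 _ h2
        · rw [h1, hsplit.apply_right]; exact hB2
    · rcases le_total t q with h1 | h1
      · rw [hsplit.path_of_le t h1]; exact h.path_near t
      · rcases le_or_gt p t with h2 | h2
        · rw [hsplit.path_of_ge t h2]; exact h.path_near t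
        · obtain ⟨B₁, hB₁, e1⟩ := hsplit.path_mid t h1 h2
          rw [e1, h.path_of_ge t (hq₀q.trans h1), add_sub_cancel_left]
          refine (hB3 B₁ hB₁).trans ?_
          rw [hγp]
          linarith [hη p]

/-- A step path can be refined to one with arbitrarily small jumps, whose covariation is close to
a prescribed one. -/
lemma exists_refines_cov_near {T : ℝ} (hT : 0 < T) (𝕋 : PartitionSeq T) {d : ℕ}
    {G : ℝ → Fin d → Fin d → ℝ} (hG0 : G 0 = 0) (hGcont : ContinuousOn G (Set.Icc 0 T))
    (hGpos : ∀ q ∈ Set.Icc 0 T, ∀ p ∈ Set.Icc 0 T, q ≤ p →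
      (Matrix.of fun i j => G p i j - G q i j).PosSemidef)
    {n : ℕ} {β : ℝ →₀ (Fin d → ℝ)} {η δ : ℝ} (hδ : 0 < δ) (hη : ∀ u, ‖β u‖ ≤ η)
    (hβ : JumpsIn (𝕋.part n) β) :
    ∃ m γ, n < m ∧
      Refines 𝕋 (IsIntermediate T G β (2 * η + δ) (δ + (2 * η + δ) ^ 2 + η ^ 2)) n β m γ ∧
      (∀ t ∈ Set.Icc 0 T, ∀ i j, |jumpCov γ i j t - G t i j| ≤ δ) ∧ (∀ u, ‖γ u‖ ≤ δ) ∧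
      ∀ t, ‖stepPath γ t - stepPath β t‖ ≤ η + δ := by
  have hη0 : 0 ≤ η := (norm_nonneg _).trans (hη 0)
  obtain ⟨ρ, hρ, hGρ⟩ := Metric.uniformContinuousOn_iff.1
    (isCompact_Icc.uniformContinuousOn_of_continuous hGcont) (δ / 4) (by positivity)
  obtain ⟨N, hN⟩ := 𝕋.mesh_to_zero ρ hρ
  set n₁ := max (n + 1) N with hn₁
  have hβ₁ : JumpsIn (𝕋.part n₁) β := hβ.mono (𝕋.mono (by omega))
  have hRβ : IsIntermediate T G β (2 * η + δ) (δ + (2 * η + δ) ^ 2 + η ^ 2) β := by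
    refine ⟨fun u => by linarith [hη u], fun t _ i j => ⟨0, ⟨le_rfl, hT.le⟩, ?_⟩⟩
    rw [jumpCov_zero hβ, hG0]
    simp only [sub_self, Pi.zero_apply, abs_zero]
    positivity
  have hstart : Refines 𝕋 (IsIntermediate T G β (2 * η + δ) (δ + (2 * η + δ) ^ 2 + η ^ 2))
      n β n₁ β := Refines.of_le hβ (by omega) hRβ
  have key : ∀ k : ℕ, ∀ p ∈ 𝕋.part n₁, ((𝕋.part n₁).filter (fun u => u < p)).card = k →
      ∃ m γ, Refines 𝕋 (IsIntermediate T G β (2 * η + δ) (δ + (2 * η + δ) ^ 2 + η ^ 2))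
        n₁ β m γ ∧ AdjustedUpTo T G β γ η δ p := by
    intro k
    induction k using Nat.strong_induction_on with
    | _ k ih =>
      intro p hp hk
      rcases (𝕋.subset_Icc n₁ hp).1.eq_or_lt with h0 | h0
      · refine ⟨n₁, β, Refines.of_le hβ₁ le_rfl hRβ, fun _ _ => rfl, fun _ _ => rfl, ?_, ?_, ?_, ?_⟩
        · intro t h1 h2 i j
          have : t = 0 := le_antisymm (h2.trans h0.ge) h1
          rw [this, jumpCov_zero hβ, hG0]
          simpa using hδ.le
        · intro i j
          rw [← h0, jumpCov_zero hβ, hG0]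
          simp
        · intro u hu
          rw [hβ.apply_eq_zero (hu.trans h0.ge), norm_zero]
          exact hδ.le
        · intro t
          rw [sub_self, norm_zero]
          positivity
      · obtain ⟨q₀, hq₀, hq₀p, -, hno⟩ := exists_pred (𝕋.zero_mem n₁) h0
        have hlt : ((𝕋.part n₁).filter (fun u => u < q₀)).card < k := by
          rw [← hk]
          refine Finset.card_lt_card (Finset.ssubset_iff_subset_ne.2 ⟨?_, fun h => ?_⟩)
          · intro u hu
            rw [Finset.mem_filter] at hu ⊢
            exact ⟨hu.1, hu.2.trans hq₀p⟩
          · have : q₀ ∈ (𝕋.part n₁).filter (fun u => u < q₀) := by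
              rw [h, Finset.mem_filter]; exact ⟨hq₀, hq₀p⟩
            exact lt_irrefl _ (Finset.mem_filter.1 this).2
        obtain ⟨m, γ, h1, h2⟩ := ih _ hlt q₀ hq₀ rfl
        have hmesh : p - q₀ < ρ := by
          have hs := succOf_spec (𝕋.top_mem n₁) (hq₀p.trans_le (𝕋.subset_Icc n₁ hp).2)
          have : p ≤ succOf T (𝕋.part n₁) q₀ := not_lt.1 (hno _ hs.1 hs.2.1)
          linarith [hN n₁ (le_max_right _ _) q₀ hq₀]
        have hosc : ∀ t, q₀ ≤ t → t ≤ p → ∀ i j, |G t i j - G q₀ i j| ≤ δ / 4 := by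
          intro t ht1 ht2 i j
          have hd := hGρ t ⟨(𝕋.subset_Icc n₁ hq₀).1.trans ht1,
            ht2.trans (𝕋.subset_Icc n₁ hp).2⟩ q₀ (𝕋.subset_Icc n₁ hq₀) (by
              rw [Real.dist_eq, abs_of_nonneg (sub_nonneg.2 ht1)]; linarith)
          rw [dist_eq_norm] at hd
          exact ((norm_le_pi_norm ((G t - G q₀) i) j).trans
            (norm_le_pi_norm (G t - G q₀) i)).trans hd.le
        obtain ⟨m', γ', h3, h4⟩ := h2.exists_next hT 𝕋 hGpos hδ hη hβ₁ hq₀ hp hq₀p hno hosc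
          h1.le h1.jumpsIn
        exact ⟨m', γ', h1.trans h3, h4⟩
  obtain ⟨m, γ, h1, h2⟩ := key _ T (𝕋.top_mem n₁) rfl
  refine ⟨m, γ, ?_, hstart.trans h1, fun t ht => h2.cov_near t ht.1 ht.2, fun u => ?_,
    h2.path_near⟩
  · have := h1.le; omega
  · by_cases hu : γ u = 0
    · rw [hu, norm_zero]; exact hδ.le
    · exact h2.small u (𝕋.subset_Icc m (h1.jumpsIn u hu).1).2

lemma eventually_norm_stepPath_sub_le {d : ℕ} {γ : ℝ →₀ (Fin d → ℝ)} {η : ℝ}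
    (hη : ∀ u, ‖γ u‖ ≤ η) (t₀ : ℝ) : ∀ᶠ t in 𝓝 t₀, ‖stepPath γ t - stepPath γ t₀‖ ≤ η := by
  have hη0 : 0 ≤ η := (norm_nonneg _).trans (hη 0)
  have hopen : IsOpen ((↑(γ.support.erase t₀) : Set ℝ)ᶜ) :=
    (Finset.finite_toSet _).isClosed.isOpen_compl
  obtain ⟨ε, hε, hball⟩ := Metric.isOpen_iff.1 hopen t₀ (by simp)
  have hzero : ∀ u, |u - t₀| < ε → u ≠ t₀ → γ u = 0 := by
    intro u hu hne
    have := hball (show u ∈ Metric.ball t₀ ε by rwa [Metric.mem_ball, Real.dist_eq])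
    by_contra h
    exact this (by simp [hne, h])
  filter_upwards [Metric.ball_mem_nhds t₀ hε] with t ht
  rw [Metric.mem_ball, Real.dist_eq] at ht
  rcases le_or_gt t₀ t with h | h
  · rw [stepPath_congr γ h fun u hu1 hu2 => hzero u ?_ hu1.ne', sub_self, norm_zero]
    · exact hη0
    · rw [abs_of_nonneg (by linarith)] at ht ⊢
      linarith
  · rw [norm_sub_rev, stepPath_jump γ h fun u hu1 hu2 => hzero u ?_ hu2.ne]
    · exact hη _
    · rw [abs_of_neg (by linarith)] at ht ⊢
      linarith

lemma measurable_stepPath {d : ℕ} (γ : ℝ →₀ (Fin d → ℝ)) : Measurable (stepPath γ) := by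
  unfold stepPath Finsupp.sum
  refine Finset.measurable_sum _ fun u _ => ?_
  exact Measurable.ite measurableSet_Ici measurable_const measurable_const

/-- A continuous, bounded field of symmetric positive semidefinite matrices. -/
structure IsCoeff {d : ℕ} (A : ℝ → (Fin d → ℝ) → Fin d → Fin d → ℝ) (C : ℝ) : Prop where
  cont : ∀ i j, Continuous fun p : ℝ × (Fin d → ℝ) => A p.1 p.2 i j
  bdd : ∀ s y i j, |A s y i j| ≤ C
  symm : ∀ s y i j, A s y i j = A s y j i
  nonneg : ∀ s y (z : Fin d → ℝ), 0 ≤ ∑ i, ∑ j, A s y i j * z i * z j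

section Coeff

variable {d : ℕ} {A : ℝ → (Fin d → ℝ) → Fin d → Fin d → ℝ} {C : ℝ}

lemma IsCoeff.intervalIntegrable (hA : IsCoeff A C) {F : ℝ → Fin d → ℝ} (hF : Measurable F)
    (i j : Fin d) (r t : ℝ) :
    IntervalIntegrable (fun s => A s (F s) i j) MeasureTheory.volume r t := by
  have hm : Measurable fun s => A s (F s) i j :=
    (hA.cont i j).measurable.comp (measurable_id.prodMk hF)
  refine (intervalIntegrable_const (c := C)).mono_fun hm.aestronglyMeasurable
    (Filter.Eventually.of_forall fun s => ?_)
  exact (hA.bdd _ _ _ _).trans (le_abs_self _)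

lemma IsCoeff.continuous_primitive (hA : IsCoeff A C) {F : ℝ → Fin d → ℝ} (hF : Measurable F) :
    Continuous fun t => fun i j => ∫ s in (0 : ℝ)..t, A s (F s) i j :=
  continuous_pi fun i => continuous_pi fun j =>
    intervalIntegral.continuous_primitive (fun r t => hA.intervalIntegrable hF i j r t) 0

lemma IsCoeff.posSemidef_primitive_sub (hA : IsCoeff A C) {F : ℝ → Fin d → ℝ} (hF : Measurable F)
    {q p : ℝ} (hqp : q ≤ p) :
    (Matrix.of fun i j => (∫ s in (0 : ℝ)..p, A s (F s) i j)
      - ∫ s in (0 : ℝ)..q, A s (F s) i j).PosSemidef := by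
  have hI := hA.intervalIntegrable hF
  have hsub : ∀ i j, (∫ s in (0 : ℝ)..p, A s (F s) i j) - ∫ s in (0 : ℝ)..q, A s (F s) i j
      = ∫ s in q..p, A s (F s) i j := fun i j =>
    intervalIntegral.integral_interval_sub_left (hI i j 0 p) (hI i j 0 q)
  simp only [hsub]
  refine Matrix.PosSemidef.of_dotProduct_mulVec_nonneg ?_ fun y => ?_
  · ext i j
    simp [hA.symm _ _ i j]
  · have h2 : 0 ≤ ∫ s in q..p, ∑ i, ∑ j, A s (F s) i j * y i * y j :=
      intervalIntegral.integral_nonneg hqp fun s _ => hA.nonneg _ _ _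
    have hsum : ∀ i, IntervalIntegrable (fun s => ∑ j, A s (F s) i j * y i * y j)
        MeasureTheory.volume q p := fun i => by
      have h := IntervalIntegrable.sum Finset.univ fun j _ =>
        ((hI i j q p).mul_const (y i)).mul_const (y j)
      rwa [Finset.sum_fn] at h
    rw [intervalIntegral.integral_finsetSum fun i _ => hsum i] at h2
    refine h2.trans_eq ?_
    simp only [dotProduct, Matrix.mulVec, Finset.mul_sum, Matrix.of_apply, star_trivial]
    refine Finset.sum_congr rfl fun i _ => ?_
    rw [intervalIntegral.integral_finsetSum fun j _ => ((hI i j q p).mul_const _).mul_const _]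
    refine Finset.sum_congr rfl fun j _ => ?_
    rw [intervalIntegral.integral_mul_const, intervalIntegral.integral_mul_const]
    ring

lemma IsCoeff.abs_primitive_sub_le (hA : IsCoeff A C) {F F' : ℝ → Fin d → ℝ} (hF : Measurable F)
    (hF' : Measurable F') (i j : Fin d) {r T : ℝ} (hr : r ∈ Set.Icc 0 T) :
    |(∫ s in (0 : ℝ)..r, A s (F s) i j) - ∫ s in (0 : ℝ)..r, A s (F' s) i j|
      ≤ ∫ s in (0 : ℝ)..T, |A s (F s) i j - A s (F' s) i j| := by
  have hI := hA.intervalIntegrable hF i j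
  have hI' := hA.intervalIntegrable hF' i j
  rw [← intervalIntegral.integral_sub (hI 0 r) (hI' 0 r)]
  refine (intervalIntegral.abs_integral_le_integral_abs hr.1).trans ?_
  exact intervalIntegral.integral_mono_interval le_rfl hr.1 hr.2
    (Filter.Eventually.of_forall fun s => abs_nonneg _) ((hI 0 T).sub (hI' 0 T)).abs

lemma IsCoeff.tendsto_integral_abs_sub (hA : IsCoeff A C) {F : ℕ → ℝ → Fin d → ℝ}
    {S : ℝ → Fin d → ℝ} (hF : ∀ k, Measurable (F k)) (hS : Measurable S)
    (hlim : ∀ s, Tendsto (fun k => F k s) atTop (𝓝 (S s))) (i j : Fin d) (T : ℝ) :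
    Tendsto (fun k => ∫ s in (0 : ℝ)..T, |A s (F k s) i j - A s (S s) i j|) atTop (𝓝 0) := by
  have hm : ∀ {F : ℝ → Fin d → ℝ}, Measurable F → Measurable fun s => A s (F s) i j := fun hF =>
    (hA.cont i j).measurable.comp (measurable_id.prodMk hF)
  have h := intervalIntegral.tendsto_integral_filter_of_dominated_convergence
    (μ := MeasureTheory.volume) (a := 0) (b := T) (l := atTop) (f := fun _ => (0 : ℝ))
    (F := fun k s => |A s (F k s) i j - A s (S s) i j|) (fun _ => C + C)
    (Filter.Eventually.of_forall fun k =>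
      (((hm (hF k)).sub (hm hS)).abs).aestronglyMeasurable)
    (Filter.Eventually.of_forall fun k => Filter.Eventually.of_forall fun s _ => ?_)
    intervalIntegrable_const (Filter.Eventually.of_forall fun s _ => ?_)
  · simpa using h
  · rw [Real.norm_eq_abs, abs_abs]
    exact (abs_sub _ _).trans (add_le_add (hA.bdd _ _ _ _) (hA.bdd _ _ _ _))
  · have h1 : Tendsto (fun k => A s (F k s) i j) atTop (𝓝 (A s (S s) i j)) :=
      ((hA.cont i j).tendsto (s, S s)).comp (tendsto_const_nhds.prodMk_nhds (hlim s))
    simpa using (h1.sub_const (A s (S s) i j)).abs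

end Coeff

/-! ### Successive refinements and their limit -/

/-- A sequence of step paths with ever smaller jumps, each refining the previous one so that the
covariation of its jumps is close to the target `Γ` evaluated at the previous one. -/
structure IsRefiningSeq {T : ℝ} (𝕋 : PartitionSeq T) {d : ℕ}
    (Γ : (ℝ →₀ (Fin d → ℝ)) → ℝ → Fin d → Fin d → ℝ) (η : ℝ) (n : ℕ → ℕ)
    (β : ℕ → ℝ →₀ (Fin d → ℝ)) : Prop where
  strictMono : StrictMono n
  jumpsIn : ∀ k, JumpsIn (𝕋.part (n k)) (β k)
  small : ∀ k u, ‖β k u‖ ≤ η / 2 ^ k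
  refines : ∀ k, Refines 𝕋 (IsIntermediate T (Γ (β k)) (β k) (3 * (η / 2 ^ k))
    (η / 2 ^ k + 10 * (η / 2 ^ k) ^ 2)) (n k) (β k) (n (k + 1)) (β (k + 1))
  cov_near : ∀ k, ∀ t ∈ Set.Icc 0 T, ∀ i j,
    |jumpCov (β (k + 1)) i j t - Γ (β k) t i j| ≤ η / 2 ^ k
  path_near : ∀ k t, ‖stepPath (β (k + 1)) t - stepPath (β k) t‖ ≤ 2 * (η / 2 ^ k)

lemma exists_isRefiningSeq {T : ℝ} (hT : 0 < T) (𝕋 : PartitionSeq T) {d : ℕ}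
    {Γ : (ℝ →₀ (Fin d → ℝ)) → ℝ → Fin d → Fin d → ℝ} (hΓ0 : ∀ β, Γ β 0 = 0)
    (hΓcont : ∀ β, Continuous (Γ β))
    (hΓpos : ∀ β q p, q ≤ p → (Matrix.of fun i j => Γ β p i j - Γ β q i j).PosSemidef)
    {n₀ : ℕ} {β₀ : ℝ →₀ (Fin d → ℝ)} {η : ℝ} (hη : 0 < η) (hβ : JumpsIn (𝕋.part n₀) β₀)
    (hsmall : ∀ u, ‖β₀ u‖ ≤ η) :
    ∃ n β, n 0 = n₀ ∧ β 0 = β₀ ∧ IsRefiningSeq 𝕋 Γ η n β := by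
  let σ : ℕ → Type := fun k => {p : ℕ × (ℝ →₀ (Fin d → ℝ)) //
    JumpsIn (𝕋.part p.1) p.2 ∧ ∀ u, ‖p.2 u‖ ≤ η / 2 ^ k}
  have hstep : ∀ k (p : σ k), ∃ q : σ (k + 1), p.1.1 < q.1.1 ∧
      Refines 𝕋 (IsIntermediate T (Γ p.1.2) p.1.2 (3 * (η / 2 ^ k))
        (η / 2 ^ k + 10 * (η / 2 ^ k) ^ 2)) p.1.1 p.1.2 q.1.1 q.1.2 ∧
      (∀ t ∈ Set.Icc 0 T, ∀ i j, |jumpCov q.1.2 i j t - Γ p.1.2 t i j| ≤ η / 2 ^ k) ∧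
      ∀ t, ‖stepPath q.1.2 t - stepPath p.1.2 t‖ ≤ 2 * (η / 2 ^ k) := by
    rintro k ⟨⟨m, β⟩, hβ, hs⟩
    have hk : 0 < η / 2 ^ k := by positivity
    have hhalf : η / 2 ^ (k + 1) = η / 2 ^ k / 2 := by rw [pow_succ]; field_simp
    obtain ⟨m', γ, h1, h2, h3, h4, h5⟩ := exists_refines_cov_near hT 𝕋 (hΓ0 β)
      (hΓcont β).continuousOn (fun q _ p _ h => hΓpos β q p h) (half_pos hk) hs hβ
    refine ⟨⟨(m', γ), h2.jumpsIn, fun u => hhalf ▸ h4 u⟩, h1, h2.imp ?_,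
      fun t ht i j => (h3 t ht i j).trans (by linarith), fun t => (h5 t).trans (by linarith)⟩
    rintro γ' ⟨h6, h7⟩
    refine ⟨fun u => (h6 u).trans (by linarith), fun t ht i j => ?_⟩
    obtain ⟨r, hr, h⟩ := h7 t ht i j
    exact ⟨r, hr, h.trans (by nlinarith)⟩
  choose f hf using hstep
  let s : ∀ k, σ k := fun k => Nat.rec (motive := σ) ⟨(n₀, β₀), hβ, by simpa using hsmall⟩
    (fun k p => f k p) k
  exact ⟨fun k => (s k).1.1, fun k => (s k).1.2, rfl, rfl,
    strictMono_nat_of_lt_succ fun k => (hf k (s k)).1, fun k => (s k).2.1, fun k => (s k).2.2,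
    fun k => (hf k (s k)).2.1, fun k => (hf k (s k)).2.2.1, fun k => (hf k (s k)).2.2.2⟩

namespace IsRefiningSeq

variable {T : ℝ} {𝕋 : PartitionSeq T} {d : ℕ}
  {Γ : (ℝ →₀ (Fin d → ℝ)) → ℝ → Fin d → Fin d → ℝ} {η : ℝ} {n : ℕ → ℕ}
  {β : ℕ → ℝ →₀ (Fin d → ℝ)}

lemma dist_succ_le (h : IsRefiningSeq 𝕋 Γ η n β) (t : ℝ) (k : ℕ) :
    dist (stepPath (β k) t) (stepPath (β (k + 1)) t) ≤ 4 * η / 2 / 2 ^ k := by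
  rw [dist_comm, dist_eq_norm]
  exact (h.path_near k t).trans_eq (by ring)

lemma exists_tendsto (h : IsRefiningSeq 𝕋 Γ η n β) :
    ∃ S : ℝ → Fin d → ℝ, ∀ t, Tendsto (fun k => stepPath (β k) t) atTop (𝓝 (S t)) := by
  choose S hS using fun t =>
    cauchySeq_tendsto_of_complete (cauchySeq_of_le_geometric_two (h.dist_succ_le t))
  exact ⟨S, hS⟩

variable {S : ℝ → Fin d → ℝ}

lemma norm_sub_le (h : IsRefiningSeq 𝕋 Γ η n β)
    (hS : ∀ t, Tendsto (fun k => stepPath (β k) t) atTop (𝓝 (S t))) (k : ℕ) (t : ℝ) :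
    ‖S t - stepPath (β k) t‖ ≤ 4 * η / 2 ^ k := by
  rw [← dist_eq_norm, dist_comm]
  exact dist_le_of_le_geometric_two_of_tendsto (h.dist_succ_le t) (hS t) k

lemma eq_of_mem (h : IsRefiningSeq 𝕋 Γ η n β)
    (hS : ∀ t, Tendsto (fun k => stepPath (β k) t) atTop (𝓝 (S t))) {k : ℕ} {s : ℝ}
    (hs : s ∈ 𝕋.part (n k)) : S s = stepPath (β k) s := by
  have heq : ∀ l, k ≤ l → stepPath (β l) s = stepPath (β k) s := by
    intro l hl
    induction l, hl using Nat.le_induction with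
    | base => rfl
    | succ l hl ih =>
      rw [← ih]
      exact (h.refines l).eq s (𝕋.mono (h.strictMono.monotone hl) hs)
  exact tendsto_nhds_unique (hS s)
    (tendsto_const_nhds.congr' ((eventually_ge_atTop k).mono fun l hl => (heq l hl).symm))

lemma tendsto_div_two_pow (η : ℝ) : Tendsto (fun k : ℕ => η / 2 ^ k) atTop (𝓝 0) :=
  tendsto_const_nhds.div_atTop (tendsto_pow_atTop_atTop_of_one_lt one_lt_two)

lemma continuous_limit (h : IsRefiningSeq 𝕋 Γ η n β)
    (hS : ∀ t, Tendsto (fun k => stepPath (β k) t) atTop (𝓝 (S t))) : Continuous S := by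
  rw [continuous_iff_continuousAt]
  intro t₀
  refine Metric.tendsto_nhds.2 fun ε hε => ?_
  obtain ⟨k, hk⟩ := ((tendsto_div_two_pow η).eventually_lt_const
    (show 0 < ε / 9 by positivity)).exists
  filter_upwards [eventually_norm_stepPath_sub_le (h.small k) t₀] with t ht
  have h1 := h.norm_sub_le hS k t
  have h2 := h.norm_sub_le hS k t₀
  rw [mul_div_assoc] at h1 h2
  rw [dist_eq_norm]
  calc ‖S t - S t₀‖ = ‖(S t - stepPath (β k) t) + (stepPath (β k) t - stepPath (β k) t₀)
        - (S t₀ - stepPath (β k) t₀)‖ := by congr 1; abel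
    _ ≤ ‖S t - stepPath (β k) t‖ + ‖stepPath (β k) t - stepPath (β k) t₀‖
        + ‖S t₀ - stepPath (β k) t₀‖ :=
      (_root_.norm_sub_le _ _).trans (add_le_add (norm_add_le _ _) le_rfl)
    _ < ε := by linarith

lemma abs_covSum_sub_le (h : IsRefiningSeq 𝕋 Γ η n β)
    (hS : ∀ t, Tendsto (fun k => stepPath (β k) t) atTop (𝓝 (S t))) (x : Fin d → ℝ)
    (G : ℝ → ℝ) (i j : Fin d) (e : ℕ → ℝ)
    (hG : ∀ k, ∀ r ∈ Set.Icc 0 T, |Γ (β k) r i j - G r| ≤ e k) {t : ℝ} (ht : t ∈ Set.Icc 0 T)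
    {k m : ℕ} (hm : n (k + 1) ≤ m) (hm' : m ≤ n (k + 2)) :
    |covSum T 𝕋 (fun s => x + S s) i j t m - G t| ≤
      5 * (η / 2 ^ k) + 19 * (η / 2 ^ (k + 1)) ^ 2 + e (k + 1) + 2 * e k := by
  obtain ⟨γ, ⟨h1, h2⟩, h3, h4⟩ := (h.refines (k + 1)).mid m hm hm'
  have h5 := abs_le.1 (abs_covSum_sub_jumpCov_le 𝕋 (S := fun s => x + S s) x h3 (fun s hs => by
    rw [h4 s hs, h.eq_of_mem hS (𝕋.mono hm' hs)]) h1 i j t)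
  obtain ⟨r, hr, h6⟩ := h2 t ht i j
  have h6 := abs_le.1 h6
  have h7 := abs_le.1 (hG (k + 1) r hr)
  have h8 := abs_le.1 (hG k r hr)
  have h9 := abs_le.1 (hG k t ht)
  have h10 := abs_le.1 (h.cov_near k r hr i j)
  have h11 := abs_le.1 (h.cov_near k t ht i j)
  have hhalf : η / 2 ^ (k + 1) = η / 2 ^ k / 2 := by rw [pow_succ]; field_simp
  have hk : 0 ≤ η / 2 ^ k := (norm_nonneg _).trans (h.small k 0)
  rw [abs_le]
  constructor <;> linarith

lemma tendsto_covSum (h : IsRefiningSeq 𝕋 Γ η n β)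
    (hS : ∀ t, Tendsto (fun k => stepPath (β k) t) atTop (𝓝 (S t))) (x : Fin d → ℝ)
    (G : ℝ → ℝ) (i j : Fin d) (e : ℕ → ℝ) (he : Tendsto e atTop (𝓝 0))
    (hG : ∀ k, ∀ r ∈ Set.Icc 0 T, |Γ (β k) r i j - G r| ≤ e k) {t : ℝ} (ht : t ∈ Set.Icc 0 T) :
    Tendsto (fun m => covSum T 𝕋 (fun s => x + S s) i j t m) atTop (𝓝 (G t)) := by
  have hb : Tendsto (fun k : ℕ => 5 * (η / 2 ^ k) + 19 * (η / 2 ^ (k + 1)) ^ 2 + e (k + 1)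
      + 2 * e k) atTop (𝓝 0) := by
    have h1 := tendsto_div_two_pow η
    have h2 := h1.comp (tendsto_add_atTop_nat 1)
    have h3 := he.comp (tendsto_add_atTop_nat 1)
    simpa using (((h1.const_mul 5).add ((h2.pow 2).const_mul 19)).add h3).add (he.const_mul 2)
  refine Metric.tendsto_atTop.2 fun ε hε => ?_
  obtain ⟨K, hK⟩ := eventually_atTop.1 (hb.eventually_lt_const hε)
  refine ⟨n (K + 1), fun m hm => ?_⟩
  have hex : ∃ l, m < n l := ⟨m + 1, h.strictMono.le_apply⟩
  obtain ⟨l, hl⟩ : ∃ l, Nat.find hex = l + 2 := by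
    have : K + 1 < Nat.find hex := h.strictMono.lt_iff_lt.1 (hm.trans_lt (Nat.find_spec hex))
    exact ⟨Nat.find hex - 2, by omega⟩
  have h1 : m < n (l + 2) := hl ▸ Nat.find_spec hex
  have h2 : n (l + 1) ≤ m := not_lt.1 (Nat.find_min hex (by omega))
  have h3 : K + 1 < l + 2 := h.strictMono.lt_iff_lt.1 (hm.trans_lt h1)
  rw [Real.dist_eq]
  exact (h.abs_covSum_sub_le hS x G i j e hG ht h2 h1.le).trans_lt (hK l (by omega))

end IsRefiningSeq

/-! ### Step paths close to a continuous path -/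

lemma JumpsIn.stepPath_zero {d : ℕ} {P : Finset ℝ} {γ : ℝ →₀ (Fin d → ℝ)} (hγ : JumpsIn P γ) :
    stepPath γ 0 = 0 := by
  unfold stepPath
  refine Finset.sum_eq_zero fun u hu => if_neg fun h => ?_
  exact (Finsupp.mem_support_iff.1 hu) (hγ.apply_eq_zero h)

lemma exists_stepPath_near {T : ℝ} (𝕋 : PartitionSeq T) {d : ℕ} {φ : ℝ → Fin d → ℝ}
    (hφ : Continuous φ) {η : ℝ} (hη : 0 < η) :
    ∃ n γ, JumpsIn (𝕋.part n) γ ∧ (∀ u, ‖γ u‖ ≤ η) ∧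
      ∀ t ∈ Set.Icc 0 T, ‖φ 0 + stepPath γ t - φ t‖ ≤ η := by
  classical
  obtain ⟨ρ, hρ, hφρ⟩ := Metric.uniformContinuousOn_iff.1
    (isCompact_Icc.uniformContinuousOn_of_continuous (s := Set.Icc 0 T) hφ.continuousOn) η hη
  obtain ⟨n, hn⟩ := 𝕋.mesh_to_zero ρ hρ
  set P := 𝕋.part n with hP
  have hpred : ∀ t, ∃ q, 0 < t → q ∈ P ∧ q < t ∧ ∀ u ∈ P, q < u → ¬ u < t := by
    intro t
    by_cases h0 : 0 < t
    · obtain ⟨q, h1, h2, -, h3⟩ := exists_pred (𝕋.zero_mem n) h0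
      exact ⟨q, fun _ => ⟨h1, h2, h3⟩⟩
    · exact ⟨0, fun h => absurd h h0⟩
  choose pr hpr using hpred
  have hclose : ∀ t, 0 < t → t ≤ T → ‖φ t - φ (pr t)‖ ≤ η := by
    intro t h0 hT
    obtain ⟨h1, h2, h3⟩ := hpr t h0
    have hs := succOf_spec (𝕋.top_mem n) (h2.trans_le hT)
    have h4 : t ≤ succOf T P (pr t) := not_lt.1 (h3 _ hs.1 hs.2.1)
    have h5 := hn n le_rfl _ h1
    have h6 := 𝕋.subset_Icc n h1
    rw [← dist_eq_norm]
    refine (hφρ t ⟨h0.le, hT⟩ (pr t) h6 ?_).le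
    rw [Real.dist_eq, abs_of_pos (sub_pos.2 h2)]
    linarith
  let γ : ℝ →₀ (Fin d → ℝ) := Finsupp.onFinset P
    (fun p => if p ∈ P ∧ 0 < p then φ p - φ (pr p) else 0) fun p hp => by
      by_contra h
      exact hp (if_neg fun h' => h h'.1)
  have hγ : ∀ p, γ p = if p ∈ P ∧ 0 < p then φ p - φ (pr p) else 0 := fun p => rfl
  have hjump : JumpsIn P γ := by
    intro u hu
    by_contra h
    exact hu ((hγ u).trans (if_neg h))
  have hnodes : ∀ p ∈ P, φ 0 + stepPath γ p = φ p := by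
    by_contra! hbad
    have hne : (P.filter fun p => φ 0 + stepPath γ p ≠ φ p).Nonempty :=
      hbad.imp fun p hp => Finset.mem_filter.2 hp
    obtain ⟨hp, hpne⟩ := Finset.mem_filter.1 (Finset.min'_mem _ hne)
    have hmin := fun u hu => Finset.min'_le (P.filter fun p => φ 0 + stepPath γ p ≠ φ p) u hu
    set p := (P.filter fun p => φ 0 + stepPath γ p ≠ φ p).min' hne
    refine hpne ?_
    rcases (𝕋.subset_Icc n hp).1.eq_or_lt with h0 | h0
    · rw [← h0, hjump.stepPath_zero, add_zero]
    · obtain ⟨h1, h2, h3⟩ := hpr p h0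
      have h4 : φ 0 + stepPath γ (pr p) = φ (pr p) := by
        by_contra h
        exact absurd (hmin _ (Finset.mem_filter.2 ⟨h1, h⟩)) (not_le.2 h2)
      have h5 := stepPath_jump γ h2 fun u hu1 hu2 => (hγ u).trans
        (if_neg fun h => h3 u h.1 hu1 hu2)
      rw [hγ, if_pos ⟨hp, h0⟩, sub_eq_iff_eq_add] at h5
      rw [h5, ← h4]
      abel
  refine ⟨n, γ, hjump, fun u => ?_, fun t ht => ?_⟩
  · rw [hγ]
    split_ifs with h
    · exact hclose u h.2 (𝕋.subset_Icc n h.1).2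
    · rw [norm_zero]; exact hη.le
  · by_cases htP : t ∈ P
    · rw [hnodes t htP, sub_self, norm_zero]; exact hη.le
    · have h0 : 0 < t := ht.1.lt_of_ne fun h => htP (h ▸ 𝕋.zero_mem n)
      obtain ⟨h1, h2, h3⟩ := hpr t h0
      rw [stepPath_congr γ h2.le fun u hu1 hu2 => (hγ u).trans (if_neg fun h =>
        h3 u h.1 hu1 (hu2.lt_of_ne fun h' => htP (h' ▸ h.1))), hnodes _ h1, norm_sub_rev]
      exact hclose t h0 ht.2

lemma exists_continuous_interpolation {d N : ℕ} {t : Fin N → ℝ} (ht_pos : ∀ i, 0 < t i)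
    (ht : Function.Injective t) (x : Fin d → ℝ) (y : Fin N → Fin d → ℝ) :
    ∃ φ : ℝ → Fin d → ℝ, Continuous φ ∧ φ 0 = x ∧ ∀ i, φ (t i) = y i := by
  classical
  let v : Option (Fin N) → ℝ := fun o => o.elim 0 t
  let r : Option (Fin N) → Fin d → ℝ := fun o => o.elim x y
  have hv : Function.Injective v := by
    rintro (_ | i) (_ | j) h
    · rfl
    · exact absurd h (ht_pos j).ne
    · exact absurd h (ht_pos i).ne'
    · exact congrArg some (ht h)
  have hnode : ∀ o, (fun c => (Lagrange.interpolate Finset.univ v fun o => r o c).eval (v o))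
      = r o := fun o => funext fun c =>
    Lagrange.eval_interpolate_at_node _ hv.injOn (Finset.mem_univ o)
  exact ⟨fun τ c => (Lagrange.interpolate Finset.univ v fun o => r o c).eval τ,
    continuous_pi fun c => Polynomial.continuous _, hnode none, fun i => hnode (some i)⟩

/-- Near a continuous path there is one whose covariation is driven by the coefficient `A`. -/
lemma IsCoeff.exists_path_near {T : ℝ} (hT : 0 < T) (𝕋 : PartitionSeq T) {d : ℕ}
    {A : ℝ → (Fin d → ℝ) → Fin d → Fin d → ℝ} {C : ℝ} (hA : IsCoeff A C) {φ : ℝ → Fin d → ℝ}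
    (hφ : Continuous φ) {ε : ℝ} (hε : 0 < ε) :
    ∃ S : ℝ → Fin d → ℝ, Continuous S ∧ S 0 = φ 0 ∧ (∀ t ∈ Set.Icc 0 T, ‖S t - φ t‖ ≤ ε) ∧
      ∀ i j, ∀ t ∈ Set.Icc 0 T, Tendsto (fun n => covSum T 𝕋 S i j t n) atTop
        (𝓝 (∫ s in (0 : ℝ)..t, A s (S s) i j)) := by
  have hη : 0 < ε / 5 := by positivity
  obtain ⟨n₀, β₀, h1, h2, h3⟩ := exists_stepPath_near 𝕋 hφ hη
  have hmeas : ∀ β : ℝ →₀ (Fin d → ℝ), Measurable fun s => φ 0 + stepPath β s := fun β =>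
    (measurable_stepPath β).const_add (φ 0)
  obtain ⟨n, β, -, hβ₀, hβ⟩ := exists_isRefiningSeq hT 𝕋
    (Γ := fun β t i j => ∫ s in (0 : ℝ)..t, A s (φ 0 + stepPath β s) i j)
    (fun β => by ext i j; simp) (fun β => hA.continuous_primitive (hmeas β))
    (fun β q p h => hA.posSemidef_primitive_sub (hmeas β) h) hη h1 h2
  obtain ⟨S, hS⟩ := hβ.exists_tendsto
  have hScont : Continuous fun s => φ 0 + S s := continuous_const.add (hβ.continuous_limit hS)
  refine ⟨fun s => φ 0 + S s, hScont, ?_, fun t ht => ?_, fun i j t ht => ?_⟩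
  · simp only [hβ.eq_of_mem hS (𝕋.zero_mem (n 0)), (hβ.jumpsIn 0).stepPath_zero, add_zero]
  · have h4 := hβ.norm_sub_le hS 0 t
    rw [hβ₀, pow_zero, div_one] at h4
    calc ‖φ 0 + S t - φ t‖ = ‖(S t - stepPath β₀ t) + (φ 0 + stepPath β₀ t - φ t)‖ := by
          congr 1; abel
      _ ≤ ‖S t - stepPath β₀ t‖ + ‖φ 0 + stepPath β₀ t - φ t‖ := norm_add_le _ _
      _ ≤ ε := by linarith [h3 t ht]
  · exact hβ.tendsto_covSum hS (φ 0) (fun t => ∫ s in (0 : ℝ)..t, A s (φ 0 + S s) i j) i j _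
      (hA.tendsto_integral_abs_sub (fun k => hmeas (β k)) hScont.measurable
        (fun s => (hS s).const_add (φ 0)) i j T)
      (fun k r hr => hA.abs_primitive_sub_le (hmeas (β k)) hScont.measurable i j hr) ht

/-- Density of the finite-dimensional distributions of `𝒮_a`: for continuous, bounded,
positive definite `a` on `[0,T̃] × ℝ^d` with `T̃ > T` and times `0 < t₁ < ⋯ < t_N ≤ T`, the set
`{(S(t₁),…,S(t_N)) : S ∈ 𝒮_a, S(0) = x}` is dense in `(ℝ^d)^N`. -/
theorem stmt15 (T Ttil : ℝ) (hT : 0 < T) (hTt : T < Ttil) (𝕋 : PartitionSeq T)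
    (d N : ℕ)
    (a : ℝ → (Fin d → ℝ) → Fin d → Fin d → ℝ)
    (ha_cont : ∀ i j, ContinuousOn (fun p : ℝ × (Fin d → ℝ) => a p.1 p.2 i j)
      (Set.Icc 0 Ttil ×ˢ (Set.univ : Set (Fin d → ℝ))))
    (ha_bdd : ∃ Cb : ℝ, ∀ t ∈ Set.Icc (0 : ℝ) Ttil, ∀ x : Fin d → ℝ, ∀ i j,
      |a t x i j| ≤ Cb)
    (ha_symm : ∀ t ∈ Set.Icc (0 : ℝ) Ttil, ∀ x : Fin d → ℝ, ∀ i j, a t x i j = a t x j i)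
    (ha_pd : ∀ t ∈ Set.Icc (0 : ℝ) Ttil, ∀ x : Fin d → ℝ, ∀ y : Fin d → ℝ, y ≠ 0 →
      0 < ∑ i, ∑ j, a t x i j * y i * y j)
    (t : Fin N → ℝ) (ht_pos : ∀ i, 0 < t i) (ht_mono : StrictMono t) (ht_le : ∀ i, t i ≤ T)
    (x : Fin d → ℝ) :
    Dense {y : Fin N → Fin d → ℝ |
      ∃ S ∈ SclassA T 𝕋 a, S 0 = x ∧ ∀ i, y i = S (t i)} := by
  obtain ⟨Cb, hCb⟩ := ha_bdd
  have hTt0 : (0 : ℝ) ≤ Ttil := (hT.trans hTt).le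
  have hproj : ∀ s, (Set.projIcc 0 Ttil hTt0 s : ℝ) ∈ Set.Icc 0 Ttil := fun s => Subtype.prop _
  have hA : IsCoeff (fun s => a (Set.projIcc 0 Ttil hTt0 s)) Cb := by
    refine ⟨fun i j => ?_, fun s y => hCb _ (hproj s) y, fun s y => ha_symm _ (hproj s) y,
      fun s y z => ?_⟩
    · exact (ha_cont i j).comp_continuous
        (f := fun p : ℝ × (Fin d → ℝ) => ((Set.projIcc 0 Ttil hTt0 p.1 : ℝ), p.2))
        ((continuous_subtype_val.comp (continuous_projIcc.comp continuous_fst)).prodMk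
          continuous_snd) fun p => ⟨hproj p.1, Set.mem_univ _⟩
    · rcases eq_or_ne z 0 with rfl | hz
      · simp
      · exact (ha_pd _ (hproj s) y z hz).le
  refine Metric.dense_iff.2 fun y ε hε => ?_
  obtain ⟨φ, hφ, hφ0, hφt⟩ := exists_continuous_interpolation ht_pos ht_mono.injective x y
  obtain ⟨S, h1, h2, h3, h4⟩ := hA.exists_path_near hT 𝕋 hφ (half_pos hε)
  refine ⟨fun i => S (t i), ?_, S, ⟨h1.continuousOn, fun i j r hr => ?_⟩, h2.trans hφ0,
    fun i => rfl⟩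
  · rw [Metric.mem_ball]
    refine ((dist_pi_le_iff (half_pos hε).le).2 fun i => ?_).trans_lt (half_lt_self hε)
    rw [← hφt i, dist_eq_norm]
    exact h3 _ ⟨(ht_pos i).le, ht_le i⟩
  · convert h4 i j r hr using 2
    refine intervalIntegral.integral_congr fun s hs => ?_
    rw [Set.uIcc_of_le hr.1] at hs
    simp only [Set.projIcc_of_mem hTt0 ⟨hs.1, (hs.2.trans hr.2).trans hTt.le⟩]
end
end
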